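/- Let $d\ge 2$ be an integer, $p_0\in(\tfrac d2,\infty]$, $p_1\in[1,\infty]$ with $\frac1{p_0}+\frac1{p_1}<\frac2{d-1}$, and let $\varkappa\in[1,2]$ be defined by $\frac2\varkappa=\frac1{p_0}+1$. Put $\vartheta_1:=(1-\frac{d-1}{2p_0})^{-1}$, $\vartheta_2:=(1-\frac d{2p_0})^{-1}$, and let $1\le p_3\le q_3\le\infty$ satisfy $$\frac{(d-1)\vartheta_1}{p_3}+\frac{2+\vartheta_1+d(\vartheta_2-\vartheta_1)}{q_3}<2 .$$ Notation. For functions $f$ on $\mathbb R\times\mathbb R^d$ let $\|f\|_{\mathbb L^{q,p}_{t,x}}:=\big\|\,t\mapsto\|f(t,\cdot)\|_{L^p(\mathbb R^d)}\big\|_{L^q(\mathbb R)}$ and $\|f\|_{\mathbb L^{p,q}_{x,t}}:=\big\|\,x\mapsto\|f(\cdot,x)\|_{L^q(\mathbb R)}\big\|_{L^p(\mathbb R^d)}$. Let $B_r\subset\mathbb R^d$ be the Euclidean ball of radius $r$ about $0$, $Q_r:=[-r^2,r^2]\times B_r$, and let $\widetilde{\mathbb L}^{p,q}_{x,t}$ be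 the space of locally integrable $f$ with $\sup_{(s,z)\in\mathbb R\times\mathbb R^d}\|\mathbf 1_{Q_1+(s,z)}f\|_{\mathbb L^{p,q}_{x,t}}<\infty$. For $w$ with weak spatial gradient $\nabla w$ in the interior of $Q$ let $\|w\|_{\mathscr V_Q}:=\|\mathbf 1_Qw\|_{\mathbb L^{\infty,2}_{t,x}}+\|\mathbf 1_Q\nabla w\|_{\mathbb L^{\varkappa,2}_{x,t}}$. Let $\mathscr I_\varkappa:=\{(r,s)\in[2,\infty)\times[1,\infty):\frac12-\frac1r<\frac1s(\frac2d+1-\frac2\varkappa)\}$. For $1\le\tau_1<\tau_2\le2$ let $\mathscr C_{\tau_1,\tau_2}$ be the class of functions $\eta(t,x)=\eta_{\rm t}(t)\eta_{\rm x}(x)$ with $\eta_{\rm x}\in C^1_c(B_{\tau_2};[0,1])$, $\eta_{\rm t}\in C^1_c([-\tau_2^2,\tau_2^2];[0,1])$, $\eta_{\rm x}=1$ on $B_{\tau_1}$, $\eta_{\rm t}=1$ on $[-\tau_1^2,\tau_1^2]$ and $\|\partial_t\eta_{\rm t}\|_\infty\le4(\tau_2-\tau_1)^{-1}$; $\nabla\eta$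 denotes the spatial gradient. Claim. For every $\varepsilon\in(0,1)$ there are $(r,s)\in\mathscr I_\varkappa$ and $\gamma>0$, depending only on $d,p_0,p_1,p_3,q_3,\varepsilon$, and for all $K_1,K_2\ge0$ a constant $C_\varepsilon>0$, depending only on these parameters and on $K_1,K_2$, such that the following holds. Let $1\le\tau_1<\tau_2\le2$, let $g_1\in\widetilde{\mathbb L}^{p_1,\infty}_{x,t}$ and $g_2\in\widetilde{\mathbb L}^{p_3,q_3}_{x,t}$ with $\|\mathbf 1_{Q_{\tau_2}}g_1\|_{\mathbb L^{p_1,\infty}_{x,t}}\le K_1$ and $\|\mathbf 1_{Q_{\tau_2}}g_2\|_{\mathbb L^{p_3,q_3}_{x,t}}\le K_2$, and let $w$ be essentially bounded on $Q_{\tau_2}$ and weakly differentiable in $x$ in the interior of $Q_{\tau_2}$, with $\|w\|_{\mathscr V_{Q_{\tau_2}}}<\infty$. Then $$\inf_{\eta\in\mathscr C_{\tau_1,\tau_2}}\Big(\big\|g_1w^2|\nabla\eta|^2\big\|_{\mathbb L^{1,1}_{t,x}}+\big\|g_2w^2|\nabla\eta|\big\|_{\mathbb L^{1,1}_{t,x}}\Big)\le\varepsilon\|w\|^2_{\mathscr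 V_{Q_{\tau_2}}}+C_\varepsilon(\tau_2-\tau_1)^{-\gamma}\big\|\mathbf 1_{Q_{\tau_2}}w\big\|^2_{\mathbb L^{s,r}_{t,x}} .$$ -/

import Mathlib

open MeasureTheory Set
open scoped ENNReal NNReal

noncomputable section

/-- The spatial space `ℝ^d` with its Euclidean norm. -/
abbrev Vec (d : ℕ) := EuclideanSpace ℝ (Fin d)

/-- Mixed norm `‖f‖_{𝕃^{q,p}_{t,x}}` (time outside, space inside). Both norms are `[0,∞]`-valued,
so an infinite inner norm is not lost. -/
def normTX {d : ℕ} {F : Type*} [NormedAddCommGroup F] (q p : ℝ≥0∞) (f : ℝ × Vec d → F) : ℝ≥0∞ :=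
  eLpNorm (fun t : ℝ => eLpNorm (fun x : Vec d => f (t, x)) p volume) q volume

/-- Mixed norm `‖f‖_{𝕃^{p,q}_{x,t}}` (space outside, time inside). -/
def normXT {d : ℕ} {F : Type*} [NormedAddCommGroup F] (p q : ℝ≥0∞) (f : ℝ × Vec d → F) : ℝ≥0∞ :=
  eLpNorm (fun x : Vec d => eLpNorm (fun t : ℝ => f (t, x)) q volume) p volume

/-- The parabolic cylinder `Q_r^{s,z} = [s-r²,s+r²] × B_r(z)`. -/
def cylAt {d : ℕ} (r : ℝ) (s : ℝ) (z : Vec d) : Set (ℝ × Vec d) :=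
  Icc (s - r ^ 2) (s + r ^ 2) ×ˢ Metric.ball z r

/-- The centred parabolic cylinder `Q_r = [-r²,r²] × B_r`. -/
def cyl (d : ℕ) (r : ℝ) : Set (ℝ × Vec d) :=
  Icc (-r ^ 2) (r ^ 2) ×ˢ Metric.ball 0 r

/-- Membership in the localized space `𝕃̃^{p,q}_{x,t}`. -/
def MemLocXT {d : ℕ} (p q : ℝ≥0∞) (f : ℝ × Vec d → ℝ) : Prop :=
  LocallyIntegrable f volume ∧
    (⨆ (s : ℝ) (z : Vec d), normXT p q ((cylAt 1 s z).indicator f)) < ⊤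

/-- `1/p` as a real number, for `p ∈ (0,∞]`, with `1/∞ = 0`. -/
def recip (p : ℝ≥0∞) : ℝ := (p⁻¹).toReal

/-- `ϑ₁ = (1-(d-1)/(2p₀))⁻¹`. -/
def theta1 (d : ℕ) (p0 : ℝ≥0∞) : ℝ := (1 - ((d : ℝ) - 1) / 2 * recip p0)⁻¹

/-- `ϑ₂ = (1-d/(2p₀))⁻¹`. -/
def theta2 (d : ℕ) (p0 : ℝ≥0∞) : ℝ := (1 - (d : ℝ) / 2 * recip p0)⁻¹

/-- The exponent `ϰ` given by `2/ϰ = 1/p₀ + 1`. -/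
def kappa (p0 : ℝ≥0∞) : ℝ := 2 / (recip p0 + 1)

/-- The index set `ℐ_ϰ`, consisting of pairs `(r,s)`. -/
def scrI (d : ℕ) (k : ℝ) : Set (ℝ × ℝ) :=
  {rs | 2 ≤ rs.1 ∧ 1 ≤ rs.2 ∧
    1 / 2 - 1 / rs.1 < (1 / rs.2) * (2 / (d : ℝ) + 1 - 2 / k)}

/-- `Dw` is the weak spatial gradient of `w` in the open set `U` of space-time. -/
def HasWeakSpatialGradOn {d : ℕ} (U : Set (ℝ × Vec d)) (w : ℝ × Vec d → ℝ)
    (Dw : ℝ × Vec d → Vec d) : Prop :=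
  LocallyIntegrableOn w U volume ∧ LocallyIntegrableOn Dw U volume ∧
    ∀ φ : ℝ × Vec d → ℝ, ContDiff ℝ (⊤ : ℕ∞) φ → HasCompactSupport φ → tsupport φ ⊆ U →
      ∀ v : Vec d, ∫ z, w z * fderiv ℝ φ z (0, v) = -∫ z, inner ℝ (Dw z) v * φ z

/-- The energy norm `‖w‖_{𝒱_Q}` with parameter `ϰ = k` of a function `w` whose weak spatial
gradient is `Dw`. -/
def normV {d : ℕ} (k : ℝ) (Q : Set (ℝ × Vec d)) (w : ℝ × Vec d → ℝ)
    (Dw : ℝ × Vec d → Vec d) : ℝ≥0∞ :=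
  normTX ⊤ 2 (Q.indicator w) + normXT (ENNReal.ofReal k) 2 (Q.indicator Dw)

/-- The class `𝒞` of cut-off functions `η(t,x) = η_t(t) η_x(x)`. -/
def cutoffClass (d : ℕ) (τ₁ τ₂ : ℝ) : Set (ℝ × Vec d → ℝ) :=
  {η | ∃ (ηt : ℝ → ℝ) (ηx : Vec d → ℝ),
    (∀ z, η z = ηt z.1 * ηx z.2) ∧
    ContDiff ℝ 1 ηt ∧ (∀ t, ηt t ∈ Icc (0 : ℝ) 1) ∧ tsupport ηt ⊆ Icc (-τ₂ ^ 2) (τ₂ ^ 2) ∧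
    (∀ t ∈ Icc (-τ₁ ^ 2) (τ₁ ^ 2), ηt t = 1) ∧ (∀ t, |deriv ηt t| ≤ 4 * (τ₂ - τ₁)⁻¹) ∧
    ContDiff ℝ 1 ηx ∧ (∀ x, ηx x ∈ Icc (0 : ℝ) 1) ∧ HasCompactSupport ηx ∧
    tsupport ηx ⊆ Metric.ball 0 τ₂ ∧ (∀ x ∈ Metric.ball (0 : Vec d) τ₁, ηx x = 1)}

/-- Euclidean length `|∇η|(t,x)` of the spatial gradient of a space-time function. -/
def gradLen {d : ℕ} (η : ℝ × Vec d → ℝ) (z : ℝ × Vec d) : ℝ :=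
  ‖gradient (fun y : Vec d => η (z.1, y)) z.2‖

end

theorem lintegral_rpow_le_rpow_lintegral {α : Type*} [MeasurableSpace α] (μ : Measure α)
    {f : α → ℝ≥0∞} (hf : AEMeasurable f μ) {s : ℝ} (hs0 : 0 ≤ s) (hs1 : s ≤ 1) :
    ∫⁻ a, f a ^ s ∂μ ≤ (∫⁻ a, f a ∂μ) ^ s * μ univ ^ (1 - s) := by
  have h := ENNReal.lintegral_mul_norm_pow_le (μ := μ) hf (aemeasurable_const (b := (1 : ℝ≥0∞)))
    hs0 (sub_nonneg.2 hs1) (by ring)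
  simpa using h

theorem rpow_lintegral_le_lintegral_rpow {α : Type*} [MeasurableSpace α] (μ : Measure α)
    [IsProbabilityMeasure μ] {f : α → ℝ≥0∞} (hf : AEMeasurable f μ) {p : ℝ} (hp : 1 ≤ p) :
    (∫⁻ a, f a ∂μ) ^ p ≤ ∫⁻ a, f a ^ p ∂μ := by
  have hp0 : 0 < p := by linarith
  have h := lintegral_rpow_le_rpow_lintegral μ (hf.pow_const p) (s := p⁻¹) (by positivity)
    (inv_le_one_of_one_le₀ hp)
  simp only [ENNReal.rpow_rpow_inv hp0.ne', measure_univ, ENNReal.one_rpow, mul_one] at h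
  calc (∫⁻ a, f a ∂μ) ^ p ≤ ((∫⁻ a, f a ^ p ∂μ) ^ p⁻¹) ^ p :=
        ENNReal.rpow_le_rpow h hp0.le
    _ = _ := ENNReal.rpow_inv_rpow hp0.ne' _

theorem minkowski_aux {α β : Type*} [MeasurableSpace α] [MeasurableSpace β] {μ : Measure α}
    {ν : Measure β} [SFinite μ] [SFinite ν] {f : α → β → ℝ≥0∞}
    (hf : Measurable (Function.uncurry f)) {p : ℝ} (hp : 1 < p) {g : α → ℝ≥0∞} (hg : Measurable g)
    (hgf : ∀ a, g a ≤ ∫⁻ b, f a b ∂ν) (hgtop : ∫⁻ a, g a ^ p ∂μ ≠ ⊤) :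
    (∫⁻ a, g a ^ p ∂μ) ^ (1 / p) ≤ ∫⁻ b, (∫⁻ a, f a b ^ p ∂μ) ^ (1 / p) ∂ν := by
  have hp0 : 0 < p := by linarith
  set S := ∫⁻ a, g a ^ p ∂μ with hS
  by_cases hS0 : S = 0
  · rw [hS0, ENNReal.zero_rpow_of_pos (by positivity)]; exact zero_le
  have hq : p.HolderConjugate p.conjExponent := Real.HolderConjugate.conjExponent hp
  set q := p.conjExponent
  have hqp : (p - 1) * q = p := by rw [hq.sub_one_mul_conj]
  have key : S ≤ (∫⁻ b, (∫⁻ a, f a b ^ p ∂μ) ^ (1 / p) ∂ν) * S ^ (1 / q) := by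
    calc S ≤ ∫⁻ a, (∫⁻ b, f a b ∂ν) * g a ^ (p - 1) ∂μ := by
          apply lintegral_mono
          intro a
          have : g a ^ p = g a * g a ^ (p - 1) := by
            have := ENNReal.rpow_add_of_nonneg (x := g a) 1 (p - 1) zero_le_one (by linarith)
            rwa [ENNReal.rpow_one, add_sub_cancel] at this
          simp only [this]
          gcongr
          exact hgf a
      _ = ∫⁻ a, ∫⁻ b, f a b * g a ^ (p - 1) ∂ν ∂μ := by
          congr 1; ext a
          exact (lintegral_mul_const _ (hf.comp (measurable_prodMk_left (x := a)))).symm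
      _ = ∫⁻ b, ∫⁻ a, f a b * g a ^ (p - 1) ∂μ ∂ν := by
          apply lintegral_lintegral_swap
          exact (hf.mul ((hg.comp measurable_fst).pow_const _)).aemeasurable
      _ ≤ ∫⁻ b, (∫⁻ a, f a b ^ p ∂μ) ^ (1 / p) * S ^ (1 / q) ∂ν := by
          apply lintegral_mono
          intro b
          have := ENNReal.lintegral_mul_le_Lp_mul_Lq μ hq (f := fun a => f a b)
            (g := fun a => g a ^ (p - 1)) (hf.comp measurable_prodMk_right).aemeasurable
            (hg.pow_const _).aemeasurable
          simpa [← ENNReal.rpow_mul, hqp] using this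
      _ = _ := by
          rw [lintegral_mul_const]
          exact (Measurable.lintegral_prod_left' (f := fun z : α × β => f z.1 z.2 ^ p)
            (hf.pow_const p)).pow_const _
  have hSq0 : S ^ (1 / q) ≠ 0 := by simp [hS0, hgtop]
  have hSqt : S ^ (1 / q) ≠ ⊤ := ENNReal.rpow_ne_top_of_nonneg (by
    have := hq.symm.pos; positivity) hgtop
  have h2 : S ^ (1 / p) * S ^ (1 / q) = S := by
    rw [← ENNReal.rpow_add _ _ hS0 hgtop]
    have := hq.inv_add_inv_eq_one
    simp [this]
  exact (ENNReal.mul_le_mul_iff_left hSq0 hSqt).1 (h2.le.trans key)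

theorem lintegral_minkowski {α β : Type*} [MeasurableSpace α] [MeasurableSpace β] {μ : Measure α}
    {ν : Measure β} [SigmaFinite μ] [SFinite ν] {f : α → β → ℝ≥0∞}
    (hf : Measurable (Function.uncurry f)) {p : ℝ} (hp : 1 ≤ p) :
    (∫⁻ a, (∫⁻ b, f a b ∂ν) ^ p ∂μ) ^ (1 / p) ≤ ∫⁻ b, (∫⁻ a, f a b ^ p ∂μ) ^ (1 / p) ∂ν := by
  rcases hp.eq_or_lt with rfl | hp
  · simpa using (lintegral_lintegral_swap hf.aemeasurable).le
  have hp0 : 0 < p := by linarith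
  set F := fun a => ∫⁻ b, f a b ∂ν
  have hF : Measurable F := hf.lintegral_prod_right'
  let g : ℕ → α → ℝ≥0∞ := fun k => (spanningSets μ k).indicator (fun a => min (F a) k)
  have hgm : ∀ k, Measurable (g k) := fun k =>
    (hF.min measurable_const).indicator (measurableSet_spanningSets μ k)
  have hgF : ∀ k a, g k a ≤ F a := fun k a => by
    refine (indicator_le_self' (fun _ _ => zero_le) a).trans (min_le_left _ _)
  have hgmono : Monotone g := by
    intro k l hkl a
    refine (indicator_le_indicator_of_subset (monotone_spanningSets μ hkl) (fun _ => zero_le) a).trans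
      (indicator_le_indicator ?_)
    exact min_le_min le_rfl (by exact_mod_cast hkl)
  have hgsup : ∀ a, ⨆ k, g k a = F a := by
    intro a
    apply le_antisymm (iSup_le fun k => hgF k a)
    obtain ⟨k0, hk0⟩ := mem_iUnion.1 ((iUnion_spanningSets μ).symm ▸ mem_univ a : a ∈ ⋃ k, spanningSets μ k)
    apply le_of_forall_lt
    intro c hc
    obtain ⟨k1, hk1⟩ := ENNReal.exists_nat_gt (ne_top_of_lt hc)
    refine lt_of_lt_of_le ?_ (le_iSup _ (max k0 k1))
    have : a ∈ spanningSets μ (max k0 k1) := monotone_spanningSets μ (le_max_left _ _) hk0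
    simp only [g, indicator_of_mem this]
    refine lt_min hc (hk1.trans_le ?_)
    exact_mod_cast le_max_right _ _
  have hconv : ∫⁻ a, F a ^ p ∂μ = ⨆ k, ∫⁻ a, g k a ^ p ∂μ := by
    rw [← lintegral_iSup (fun k => (hgm k).pow_const p)
      (fun k l hkl a => ENNReal.rpow_le_rpow (hgmono hkl a) hp0.le)]
    congr 1; ext a
    rw [← hgsup a]
    exact (ENNReal.orderIsoRpow p hp0).map_iSup _
  rw [one_div]
  rw [ENNReal.rpow_inv_le_iff hp0, hconv]
  refine iSup_le fun k => ?_
  rw [← ENNReal.rpow_inv_le_iff hp0]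
  have := minkowski_aux (μ := μ) (ν := ν) hf hp (hgm k) (hgF k) ?_
  · simpa using this
  · refine ne_top_of_le_ne_top ?_ (lintegral_mono (g := (spanningSets μ k).indicator
      (fun _ => (k : ℝ≥0∞) ^ p)) fun a => ?_)
    · rw [lintegral_indicator_const (measurableSet_spanningSets μ k)]
      exact ENNReal.mul_ne_top (ENNReal.rpow_ne_top_of_nonneg hp0.le (by simp))
        (measure_spanningSets_lt_top μ k).ne
    · by_cases ha : a ∈ spanningSets μ k
      · simp only [g, indicator_of_mem ha]
        exact ENNReal.rpow_le_rpow (min_le_right _ _) hp0.le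
      · simp [g, indicator_of_notMem ha, hp0]

/-- Averaging against a probability measure of translates does not increase mixed norms. -/
theorem mixed_average_le {E₁ E₂ : Type*} [MeasurableSpace E₁] [AddGroup E₁] [MeasurableAdd₂ E₁]
    [MeasurableNeg E₁] [MeasurableSub₂ E₁] [MeasurableSpace E₂] [AddGroup E₂] [MeasurableAdd₂ E₂]
    [MeasurableNeg E₂] [MeasurableSub₂ E₂]
    (μ : Measure E₁) [SigmaFinite μ] [μ.IsAddRightInvariant]
    (ν : Measure E₂) [SigmaFinite ν] [ν.IsAddRightInvariant]
    (P : Measure (E₁ × E₂)) [IsProbabilityMeasure P] {f : E₁ × E₂ → ℝ≥0∞} (hf : Measurable f)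
    {p q : ℝ} (hp : 1 ≤ p) (hq : 1 ≤ q) :
    ∫⁻ x, (∫⁻ t, (∫⁻ z, f (t - z.1, x - z.2) ∂P) ^ p ∂μ) ^ (q / p) ∂ν
      ≤ ∫⁻ x, (∫⁻ t, f (t, x) ^ p ∂μ) ^ (q / p) ∂ν := by
  have hp0 : 0 < p := by linarith
  have hq0 : 0 < q := by linarith
  have hFm : Measurable fun x => ∫⁻ t, f (t, x) ^ p ∂μ :=
    Measurable.lintegral_prod_left' (f := fun z : E₁ × E₂ => f z ^ p) (hf.pow_const p)
  have h1 : ∀ x, (∫⁻ t, (∫⁻ z, f (t - z.1, x - z.2) ∂P) ^ p ∂μ) ^ (q / p) ≤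
      ∫⁻ z, (∫⁻ t, f (t, x - z.2) ^ p ∂μ) ^ (q / p) ∂P := by
    intro x
    have hm := lintegral_minkowski (μ := μ) (ν := P)
      (f := fun t z => f (t - z.1, x - z.2)) (by fun_prop) hp
    have h2 : ∀ z : E₁ × E₂, ∫⁻ t, f (t - z.1, x - z.2) ^ p ∂μ = ∫⁻ t, f (t, x - z.2) ^ p ∂μ :=
      fun z => lintegral_sub_right_eq_self (fun t => f (t, x - z.2) ^ p) z.1
    simp only [h2] at hm
    calc _ = ((∫⁻ t, (∫⁻ z, f (t - z.1, x - z.2) ∂P) ^ p ∂μ) ^ (1 / p)) ^ q := by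
          rw [← ENNReal.rpow_mul]; congr 1; ring
      _ ≤ (∫⁻ z, (∫⁻ t, f (t, x - z.2) ^ p ∂μ) ^ (1 / p) ∂P) ^ q :=
          ENNReal.rpow_le_rpow hm hq0.le
      _ ≤ ∫⁻ z, ((∫⁻ t, f (t, x - z.2) ^ p ∂μ) ^ (1 / p)) ^ q ∂P := by
          apply rpow_lintegral_le_lintegral_rpow _ _ hq
          exact ((hFm.comp (measurable_const.sub measurable_snd)).pow_const _).aemeasurable
      _ = _ := by
          simp_rw [← ENNReal.rpow_mul]; congr! 3; ring
  calc _ ≤ ∫⁻ x, ∫⁻ z, (∫⁻ t, f (t, x - z.2) ^ p ∂μ) ^ (q / p) ∂P ∂ν := lintegral_mono h1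
    _ = ∫⁻ z, ∫⁻ x, (∫⁻ t, f (t, x - z.2) ^ p ∂μ) ^ (q / p) ∂ν ∂P := by
        apply lintegral_lintegral_swap
        exact ((hFm.comp (measurable_fst.sub (measurable_snd.comp measurable_snd))).pow_const
          _).aemeasurable
    _ = ∫⁻ z : E₁ × E₂, ∫⁻ x, (∫⁻ t, f (t, x) ^ p ∂μ) ^ (q / p) ∂ν ∂P := by
        congr 1; ext z
        exact lintegral_sub_right_eq_self (fun x => (∫⁻ t, f (t, x) ^ p ∂μ) ^ (q / p)) z.2
    _ = _ := by simp

/-- The uniform probability measure on the unit ball. -/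
noncomputable def ballAvg (n : ℕ) : Measure (Vec n) :=
  (volume (Metric.ball (0 : Vec n) 1))⁻¹ • volume.restrict (Metric.ball 0 1)

theorem ball_volume_ne_zero (n : ℕ) : volume (Metric.ball (0 : Vec n) 1) ≠ 0 :=
  (Metric.measure_ball_pos _ _ one_pos).ne'

instance (n : ℕ) : IsProbabilityMeasure (ballAvg n) :=
  ⟨by simp [ballAvg, ENNReal.inv_mul_cancel (ball_volume_ne_zero n) measure_ball_lt_top.ne]⟩

theorem ballAvg_ae_mem (n : ℕ) : ∀ᵐ ξ ∂(ballAvg n), ξ ∈ Metric.ball (0 : Vec n) 1 :=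
  Measure.ae_smul_measure (ae_restrict_mem measurableSet_ball) _

theorem lintegral_ballAvg_le {n : ℕ} {g : Vec n → ℝ≥0∞} (hg : Measurable g) {r : ℝ} (hr : 0 < r)
    (y : Vec n) :
    ∫⁻ ξ, g (y + r • ξ) ∂(ballAvg n) ≤
      (volume (Metric.ball (0 : Vec n) 1))⁻¹ * (ENNReal.ofReal (r ^ (-(n : ℝ))) * ∫⁻ x, g x) := by
  rw [ballAvg, lintegral_smul_measure, smul_eq_mul]
  gcongr
  calc ∫⁻ ξ in Metric.ball 0 1, g (y + r • ξ) ≤ ∫⁻ ξ, g (y + r • ξ) := setLIntegral_le_lintegral _ _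
    _ = ∫⁻ x, g (y + x) ∂(Measure.map (r • ·) volume) := by
        rw [lintegral_map (by fun_prop) (by fun_prop)]
    _ = ENNReal.ofReal (r ^ (-(n : ℝ))) * ∫⁻ x, g x := by
        rw [Measure.map_addHaar_smul _ hr.ne', lintegral_smul_measure,
          lintegral_add_left_eq_self]
        simp only [finrank_euclideanSpace, Fintype.card_fin, smul_eq_mul]
        rw [abs_of_pos (by positivity), Real.rpow_neg hr.le, Real.rpow_natCast]
    _ ≤ _ := le_rfl

theorem lintegral_Ioc_rpow_neg {β R : ℝ} (hβ : β < 1) (hR : 0 < R) :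
    ∫⁻ r in Ioc 0 R, ENNReal.ofReal (r ^ (-β)) = ENNReal.ofReal (R ^ (1 - β) / (1 - β)) := by
  have hi : IntervalIntegrable (fun r : ℝ => r ^ (-β)) volume 0 R :=
    intervalIntegral.intervalIntegrable_rpow' (by linarith)
  rw [← ofReal_integral_eq_lintegral_ofReal]
  · rw [← intervalIntegral.integral_of_le hR.le, integral_rpow (Or.inl (by linarith)),
      Real.zero_rpow (by linarith)]
    ring_nf
  · exact (intervalIntegrable_iff_integrableOn_Ioc_of_le hR.le).1 hi
  · exact (ae_restrict_mem measurableSet_Ioc).mono fun r hr => by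
      have := hr.1; simp only [Pi.zero_apply]; positivity

theorem exists_potential_bound (n : ℕ) {θ ω : ℝ} (hθ0 : 0 < θ) (hθ1 : θ ≤ 1) (hω0 : 0 ≤ ω)
    (hωθ : ω ≤ θ) (hn : n * (θ - ω) < 1) :
    ∃ C : ℝ≥0∞, C ≠ ⊤ ∧ ∀ R : ℝ, 0 < R → R ≤ 1 → ∀ H : Vec n → ℝ≥0∞, Measurable H →
      ∀ M : ℝ≥0∞, M ≠ 0 → M ≠ ⊤ → ∫⁻ y, H y ^ (1 / θ) ≤ M ^ (1 / θ) →
      ∃ J : Vec n → ℝ≥0∞, Measurable J ∧ ∫⁻ y, J y ≤ 1 ∧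
        ∀ y, ∫⁻ r in Ioc 0 R, ∫⁻ ξ, H (y + r • ξ) ∂(ballAvg n) ≤ C * M * J y ^ ω := by
  set β := n * (θ - ω) with hβ
  set c := (volume (Metric.ball (0 : Vec n) 1))⁻¹ with hc
  have hct : c ≠ ⊤ := ENNReal.inv_ne_top.2 (ball_volume_ne_zero n)
  set Z := ENNReal.ofReal (1 / (1 - β)) with hZ
  have hZ0 : Z ≠ 0 := by
    rw [hZ, Ne, ENNReal.ofReal_eq_zero, not_le]; exact one_div_pos.2 (by linarith)
  have hZt : Z ≠ ⊤ := ENNReal.ofReal_ne_top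
  refine ⟨c ^ (θ - ω) * Z, ENNReal.mul_ne_top (ENNReal.rpow_ne_top_of_nonneg (by linarith) hct) hZt,
    ?_⟩
  intro R hR hR1 H hH M hM0 hMt hHM
  set μ : Measure ℝ := (volume.restrict (Ioc 0 R)).withDensity (fun r => ENNReal.ofReal (r ^ (-β)))
    with hμ
  have hdm : Measurable (fun r : ℝ => ENNReal.ofReal (r ^ (-β))) := by fun_prop
  have hμu : μ univ ≤ Z := by
    rw [hμ, withDensity_apply _ MeasurableSet.univ, Measure.restrict_univ,
      lintegral_Ioc_rpow_neg hn hR]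
    apply ENNReal.ofReal_le_ofReal
    have := Real.rpow_le_one hR.le hR1 (z := 1 - β) (by linarith)
    exact div_le_div_of_nonneg_right this (by linarith)
  let S : ℝ → Vec n → ℝ≥0∞ := fun r y => ∫⁻ ξ, H (y + r • ξ) ^ (1 / θ) ∂(ballAvg n)
  have hSm : Measurable (Function.uncurry S) := by
    apply Measurable.lintegral_prod_right'
      (f := fun z : (ℝ × Vec n) × Vec n => H (z.1.2 + z.1.1 • z.2) ^ (1 / θ))
    fun_prop
  have hM0' : M ^ (1 / θ) ≠ 0 := by simp [hM0, hMt]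
  have hMt' : M ^ (1 / θ) ≠ ⊤ := ENNReal.rpow_ne_top_of_nonneg (by positivity) hMt
  set N := M ^ (1 / θ) * Z with hN
  have hN0 : N ≠ 0 := mul_ne_zero hM0' hZ0
  have hNt : N ≠ ⊤ := ENNReal.mul_ne_top hMt' hZt
  have hSy : Measurable fun y => ∫⁻ r, S r y ∂μ :=
    Measurable.lintegral_prod_left' (f := fun z : ℝ × Vec n => S z.1 z.2) hSm
  refine ⟨fun y => N⁻¹ * ∫⁻ r, S r y ∂μ, by fun_prop, ?_, ?_⟩
  · rw [lintegral_const_mul _ hSy, lintegral_lintegral_swap (by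
      exact (hSm.comp measurable_swap).aemeasurable)]
    have h1 : ∀ r, ∫⁻ y, S r y ≤ M ^ (1 / θ) := by
      intro r
      simp only [S]
      rw [lintegral_lintegral_swap (by fun_prop)]
      calc _ ≤ ∫⁻ ξ, M ^ (1 / θ) ∂(ballAvg n) := by
            apply lintegral_mono
            intro ξ
            simp only
            rwa [lintegral_add_right_eq_self (fun y => H y ^ (1 / θ)) (r • ξ)]
        _ = _ := by simp
    calc _ ≤ N⁻¹ * ∫⁻ r, M ^ (1 / θ) ∂μ := by gcongr with r; exact h1 r
      _ ≤ N⁻¹ * N := by rw [lintegral_const, hN]; gcongr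
      _ = 1 := ENNReal.inv_mul_cancel hN0 hNt
  · intro y
    have hSr : ∀ r ∈ Ioc (0 : ℝ) R, ∫⁻ ξ, H (y + r • ξ) ∂(ballAvg n) ≤
        ENNReal.ofReal (r ^ (-β)) * (c ^ (θ - ω) * (M ^ (1 / θ)) ^ (θ - ω) * S r y ^ ω) := by
      intro r hr
      have hj := lintegral_rpow_le_rpow_lintegral (ballAvg n)
        (f := fun ξ => H (y + r • ξ) ^ (1 / θ)) (by fun_prop) hθ0.le hθ1
      simp only [← ENNReal.rpow_mul, one_div, inv_mul_cancel₀ hθ0.ne', ENNReal.rpow_one,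
        measure_univ, ENNReal.one_rpow, mul_one] at hj
      have hSb : S r y ≤ c * (ENNReal.ofReal (r ^ (-(n : ℝ))) * M ^ (1 / θ)) :=
        (lintegral_ballAvg_le (g := fun x => H x ^ (1 / θ)) (by fun_prop) hr.1 y).trans (by gcongr)
      calc _ ≤ S r y ^ θ := by simpa [S] using hj
        _ = S r y ^ (θ - ω) * S r y ^ ω := by
            rw [← ENNReal.rpow_add_of_nonneg _ _ (by linarith) hω0]; congr 1; ring
        _ ≤ (c * (ENNReal.ofReal (r ^ (-(n : ℝ))) * M ^ (1 / θ))) ^ (θ - ω) * S r y ^ ω := by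
            gcongr
        _ = _ := by
            rw [ENNReal.mul_rpow_of_nonneg _ _ (by linarith),
              ENNReal.mul_rpow_of_nonneg _ _ (by linarith),
              ENNReal.ofReal_rpow_of_nonneg (Real.rpow_nonneg hr.1.le _) (by linarith),
              ← Real.rpow_mul hr.1.le, neg_mul]
            ring
    have hmeas : Measurable fun r => c ^ (θ - ω) * (M ^ (1 / θ)) ^ (θ - ω) * S r y ^ ω := by
      have : Measurable fun r => S r y := hSm.comp (measurable_id.prodMk measurable_const)
      fun_prop
    have hSr' : Measurable fun r => S r y := hSm.comp (measurable_id.prodMk measurable_const)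
    calc _ ≤ ∫⁻ r in Ioc 0 R, ENNReal.ofReal (r ^ (-β)) *
            (c ^ (θ - ω) * (M ^ (1 / θ)) ^ (θ - ω) * S r y ^ ω) :=
          setLIntegral_mono' measurableSet_Ioc hSr
      _ = ∫⁻ r, c ^ (θ - ω) * (M ^ (1 / θ)) ^ (θ - ω) * S r y ^ ω ∂μ := by
          rw [hμ, lintegral_withDensity_eq_lintegral_mul _ hdm hmeas]; rfl
      _ = c ^ (θ - ω) * (M ^ (1 / θ)) ^ (θ - ω) * ∫⁻ r, S r y ^ ω ∂μ :=
          lintegral_const_mul _ (hSr'.pow_const _)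
      _ ≤ c ^ (θ - ω) * (M ^ (1 / θ)) ^ (θ - ω) * ((∫⁻ r, S r y ∂μ) ^ ω * Z ^ (1 - ω)) := by
          gcongr
          refine (lintegral_rpow_le_rpow_lintegral μ hSr'.aemeasurable hω0 (by linarith)).trans ?_
          gcongr
          linarith
      _ = c ^ (θ - ω) * (M ^ (1 / θ)) ^ (θ - ω) *
            ((N * (N⁻¹ * ∫⁻ r, S r y ∂μ)) ^ ω * Z ^ (1 - ω)) := by
          rw [← mul_assoc N, ENNReal.mul_inv_cancel hN0 hNt, one_mul]
      _ = c ^ (θ - ω) * ((M ^ (1 / θ)) ^ (θ - ω) * (M ^ (1 / θ)) ^ ω) * (Z ^ ω * Z ^ (1 - ω)) *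
            (N⁻¹ * ∫⁻ r, S r y ∂μ) ^ ω := by
          rw [ENNReal.mul_rpow_of_nonneg N _ hω0, hN, ENNReal.mul_rpow_of_nonneg _ Z hω0]; ring
      _ = _ := by
          rw [← ENNReal.rpow_add _ _ hM0' hMt', ← ENNReal.rpow_add _ _ hZ0 hZt, ← ENNReal.rpow_mul]
          have h1 : 1 / θ * (θ - ω + ω) = 1 := by field_simp; ring
          rw [h1, add_sub_cancel]; simp only [ENNReal.rpow_one]; ring

/-- Exponents on a hyperplane slice of dimension `n`: a power `m` of the function is estimated by a
potential of its gradient, the result lies in `L^{1/ω}` of the slice. -/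
structure SliceExponents (n : ℕ) (κ b m ω : ℝ) : Prop where
  one_le_kappa : 1 ≤ κ
  kappa_le_two : κ ≤ 2
  two_le_b : 2 ≤ b
  one_lt_m : 1 < m
  theta_le_one : (m - 1) / b + 1 / κ ≤ 1
  omega_nonneg : 0 ≤ ω
  omega_le : ω ≤ (m - 1) / b + 1 / κ
  subcritical : n * ((m - 1) / b + 1 / κ - ω) < 1

theorem lintegral_mul_two_rpow_le {α : Type*} [MeasurableSpace α] {μ : Measure α}
    {f g : α → ℝ≥0∞} (hf : AEMeasurable f μ) (hg : AEMeasurable g μ) {s t : ℝ} (hs : 0 ≤ s)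
    (ht : 0 ≤ t) (hst : 0 < s + t) :
    (∫⁻ a, (f a ^ s * g a ^ t) ^ (1 / (s + t)) ∂μ) ^ (s + t) ≤
      (∫⁻ a, f a ∂μ) ^ s * (∫⁻ a, g a ∂μ) ^ t := by
  have h := ENNReal.lintegral_mul_norm_pow_le (μ := μ) hf hg (p := s / (s + t)) (q := t / (s + t))
    (by positivity) (by positivity) (by field_simp)
  calc _ = (∫⁻ a, f a ^ (s / (s + t)) * g a ^ (t / (s + t)) ∂μ) ^ (s + t) := by
        congr 2; ext a
        rw [ENNReal.mul_rpow_of_nonneg _ _ (by positivity), ← ENNReal.rpow_mul, ← ENNReal.rpow_mul,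
          mul_one_div, mul_one_div]
    _ ≤ _ := ENNReal.rpow_le_rpow h hst.le
    _ = _ := by
        rw [ENNReal.mul_rpow_of_nonneg _ _ hst.le, ← ENNReal.rpow_mul, ← ENNReal.rpow_mul,
          div_mul_cancel₀ _ hst.ne', div_mul_cancel₀ _ hst.ne']

theorem slice_power_bound {n : ℕ} {κ b m ω : ℝ} (h : SliceExponents n κ b m ω) :
    ∃ C : ℝ≥0∞, C ≠ ⊤ ∧ ∀ R : ℝ, 0 < R → R ≤ 1 →
      ∀ (I : Set ℝ) (Ω : Set (Vec n)), MeasurableSet I → volume I ≤ 8 →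
      ∀ f D : ℝ × Vec n → ℝ≥0∞, Measurable f → Measurable D → (∀ t ∉ I, ∀ y, f (t, y) = 0) →
      (∀ t, ∀ y ∈ Ω, ∀ ξ ∈ Metric.ball (0 : Vec n) 1, f (t, y) ^ m ≤ f (t, y + R • ξ) ^ m +
        ∫⁻ r in Ioc 0 R, ENNReal.ofReal m * (f (t, y + r • ξ) ^ (m - 1) * D (t, y + r • ξ))) →
      ∀ V Λ : ℝ≥0∞, V ≠ 0 → V ≠ ⊤ → Λ ≠ 0 → Λ ≠ ⊤ →
      ∫⁻ y, ∫⁻ t, f (t, y) ^ b ≤ Λ ^ b →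
      ∫⁻ y, (∫⁻ t, D (t, y) ^ (2 : ℝ)) ^ (κ / 2) ≤ V ^ κ →
      ∃ J : Vec n → ℝ≥0∞, Measurable J ∧ ∫⁻ y, J y ≤ 1 ∧ ∀ y ∈ Ω,
        (∫⁻ t, (f (t, y) ^ m) ^ (1 / ((m - 1) / b + 1 / 2))) ^ ((m - 1) / b + 1 / 2) ≤
          C * ENNReal.ofReal (R ^ (-(n : ℝ))) * (V * Λ ^ (m - 1) + Λ ^ m) * (1 + J y) ^ ω := by
  obtain ⟨hκ1, hκ2, hb, hm, hθ1, hω0, hωθ, hsub⟩ := h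
  have hb0 : 0 < b := by linarith
  have hκ0 : 0 < κ := by linarith
  have hmb : 0 < (m - 1) / b := div_pos (by linarith) hb0
  set θ := (m - 1) / b + 1 / κ with hθ
  set E := (m - 1) / b + 1 / 2 with hE
  have hE0 : 0 < E := by positivity
  have hθ0 : 0 < θ := by positivity
  have hEθ : E ≤ θ := by
    rw [hE, hθ]; gcongr
  have hE1 : E ≤ 1 := hEθ.trans hθ1
  have hmE : m / b ≤ E := by
    have : m / b = (m - 1) / b + 1 / b := by ring
    rw [this, hE]; gcongr
  have hp1 : 1 ≤ 1 / E := by rw [le_div_iff₀ hE0]; linarith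
  have hmb1 : m / b ≤ 1 := hmE.trans hE1
  have hmb0 : 0 ≤ m / b := by positivity
  obtain ⟨C₀, hC₀, hpot⟩ := exists_potential_bound n hθ0 hθ1 hω0 hωθ hsub
  set c := (volume (Metric.ball (0 : Vec n) 1))⁻¹ with hc
  have hct : c ≠ ⊤ := ENNReal.inv_ne_top.2 (ball_volume_ne_zero n)
  refine ⟨ENNReal.ofReal m * C₀ + 8 ^ (E - m / b) * c ^ (m / b), ?_, ?_⟩
  · refine ENNReal.add_ne_top.2 ⟨ENNReal.mul_ne_top ENNReal.ofReal_ne_top hC₀, ENNReal.mul_ne_top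
      (ENNReal.rpow_ne_top_of_nonneg (by linarith) (by simp))
      (ENNReal.rpow_ne_top_of_nonneg hmb0 hct)⟩
  intro R hR hR1 I Ω hI hI8 f D hf hD hfI hftc V Λ hV0 hVt hΛ0 hΛt hfb hDk
  set H : Vec n → ℝ≥0∞ := fun y => (∫⁻ t, (f (t, y) ^ (m - 1) * D (t, y)) ^ (1 / E)) ^ E with hH
  have hHm : Measurable H := by
    refine Measurable.pow_const ?_ _
    exact Measurable.lintegral_prod_left'
      (f := fun z : ℝ × Vec n => (f z ^ (m - 1) * D z) ^ (1 / E)) (by fun_prop)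
  set Bt : Vec n → ℝ≥0∞ := fun y => ∫⁻ t, f (t, y) ^ b with hBt
  have hBm : Measurable Bt :=
    Measurable.lintegral_prod_left' (f := fun z : ℝ × Vec n => f z ^ b) (by fun_prop)
  set Ft : Vec n → ℝ≥0∞ := fun y => ∫⁻ t, D (t, y) ^ (2 : ℝ) with hFt
  have hFm : Measurable Ft :=
    Measurable.lintegral_prod_left' (f := fun z : ℝ × Vec n => D z ^ (2 : ℝ)) (by fun_prop)
  set U : Vec n → ℝ≥0∞ := fun y => (∫⁻ t, (f (t, y) ^ m) ^ (1 / E)) ^ E with hU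
  have hHb : ∀ y, H y ≤ Bt y ^ ((m - 1) / b) * Ft y ^ (1 / 2 : ℝ) := by
    intro y
    have := lintegral_mul_two_rpow_le (μ := volume) (f := fun t => f (t, y) ^ b)
      (g := fun t => D (t, y) ^ (2 : ℝ)) (by fun_prop) (by fun_prop) hmb.le (t := 1 / 2)
      (by norm_num) (by positivity)
    have h2 : (2 : ℝ) * (1 / 2) = 1 := by norm_num
    simp only [← ENNReal.rpow_mul, mul_div_cancel₀ _ hb0.ne', h2, ENNReal.rpow_one] at this
    exact this
  have hM : ∫⁻ y, H y ^ (1 / θ) ≤ (V * Λ ^ (m - 1)) ^ (1 / θ) := by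
    have := lintegral_mul_two_rpow_le (μ := volume) (f := Bt)
      (g := fun y => Ft y ^ (κ / 2)) (by fun_prop) (by fun_prop) hmb.le (t := 1 / κ)
      (by positivity) (by positivity)
    have h3 : κ / 2 * (1 / κ) = 1 / 2 := by field_simp
    simp only [← ENNReal.rpow_mul, h3] at this
    rw [one_div, ENNReal.le_rpow_inv_iff hθ0, ← one_div]
    calc (∫⁻ y, H y ^ (1 / θ)) ^ θ ≤
          (∫⁻ y, (Bt y ^ ((m - 1) / b) * Ft y ^ (1 / 2 : ℝ)) ^ (1 / θ)) ^ θ := by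
          gcongr with y
          exact hHb y
      _ ≤ _ := this
      _ ≤ (Λ ^ b) ^ ((m - 1) / b) * (V ^ κ) ^ (1 / κ) := by gcongr
      _ = V * Λ ^ (m - 1) := by
          rw [← ENNReal.rpow_mul, ← ENNReal.rpow_mul, mul_div_cancel₀ _ hb0.ne',
            mul_one_div_cancel hκ0.ne', ENNReal.rpow_one, mul_comm]
  have hM0 : V * Λ ^ (m - 1) ≠ 0 := mul_ne_zero hV0 (by simp [hΛ0, hΛt])
  have hMt : V * Λ ^ (m - 1) ≠ ⊤ :=
    ENNReal.mul_ne_top hVt (ENNReal.rpow_ne_top_of_nonneg (by linarith) hΛt)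
  obtain ⟨J, hJm, hJ1, hJ⟩ := hpot R hR hR1 H hHm _ hM0 hMt hM
  refine ⟨J, hJm, hJ1, fun y hy => ?_⟩
  have hUm : Measurable U := by
    refine Measurable.pow_const ?_ _
    exact Measurable.lintegral_prod_left'
      (f := fun z : ℝ × Vec n => (f z ^ m) ^ (1 / E)) (by fun_prop)
  have hUB : ∀ y, U y ≤ 8 ^ (E - m / b) * Bt y ^ (m / b) := by
    intro y
    have h1 : ∫⁻ t, (f (t, y) ^ m) ^ (1 / E) = ∫⁻ t in I, (f (t, y) ^ b) ^ (m / b * (1 / E)) := by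
      rw [← lintegral_indicator hI]
      congr 1; ext t
      by_cases ht : t ∈ I
      · rw [indicator_of_mem ht, ← ENNReal.rpow_mul, ← ENNReal.rpow_mul]
        congr 1; field_simp
      · rw [indicator_of_notMem ht, hfI t ht, ENNReal.zero_rpow_of_pos (by linarith),
          ENNReal.zero_rpow_of_pos (by positivity)]
    have hle : m / b * (1 / E) ≤ 1 := by rw [mul_one_div, div_le_one hE0]; exact hmE
    have h2 := lintegral_rpow_le_rpow_lintegral (volume.restrict I) (f := fun t => f (t, y) ^ b)
      (by fun_prop) (s := m / b * (1 / E)) (by positivity) hle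
    simp only [U]
    rw [h1]
    calc _ ≤ ((Bt y) ^ (m / b * (1 / E)) * 8 ^ (1 - m / b * (1 / E))) ^ E := by
          refine ENNReal.rpow_le_rpow (h2.trans ?_) hE0.le
          rw [Measure.restrict_apply_univ]
          gcongr
          exact setLIntegral_le_lintegral _ _
      _ = _ := by
          rw [ENNReal.mul_rpow_of_nonneg _ _ hE0.le, ← ENNReal.rpow_mul, ← ENNReal.rpow_mul,
            mul_comm]
          congr 2 <;> field_simp
  have hrR : (1 : ℝ) ≤ R ^ (-(n : ℝ)) :=
    Real.one_le_rpow_of_pos_of_le_one_of_nonpos hR hR1 (by simp)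
  have hUavg : ∫⁻ ξ, U (y + R • ξ) ∂(ballAvg n) ≤
      8 ^ (E - m / b) * c ^ (m / b) * (ENNReal.ofReal (R ^ (-(n : ℝ))) * Λ ^ m) := by
    calc _ ≤ ∫⁻ ξ, 8 ^ (E - m / b) * Bt (y + R • ξ) ^ (m / b) ∂(ballAvg n) :=
          lintegral_mono fun ξ => hUB _
      _ = 8 ^ (E - m / b) * ∫⁻ ξ, Bt (y + R • ξ) ^ (m / b) ∂(ballAvg n) :=
          lintegral_const_mul _ (by fun_prop)
      _ ≤ 8 ^ (E - m / b) * (c * (ENNReal.ofReal (R ^ (-(n : ℝ))) * Λ ^ b)) ^ (m / b) := by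
          gcongr
          refine (lintegral_rpow_le_rpow_lintegral (ballAvg n) (by fun_prop) hmb0 hmb1).trans ?_
          rw [measure_univ, ENNReal.one_rpow, mul_one]
          gcongr
          exact (lintegral_ballAvg_le hBm hR y).trans (by gcongr)
      _ ≤ _ := by
          rw [ENNReal.mul_rpow_of_nonneg _ _ hmb0, ENNReal.mul_rpow_of_nonneg _ _ hmb0,
            ← ENNReal.rpow_mul, mul_div_cancel₀ _ hb0.ne', mul_assoc]
          gcongr
          calc _ ≤ ENNReal.ofReal (R ^ (-(n : ℝ))) ^ (1 : ℝ) :=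
                ENNReal.rpow_le_rpow_of_exponent_le (by simpa using hrR) hmb1
            _ = _ := ENNReal.rpow_one _
  have hmain : U y ≤ ∫⁻ ξ, U (y + R • ξ) ∂(ballAvg n) +
      ENNReal.ofReal m * ∫⁻ r in Ioc 0 R, ∫⁻ ξ, H (y + r • ξ) ∂(ballAvg n) := by
    have hpt : ∀ t, f (t, y) ^ m ≤ ∫⁻ ξ, f (t, y + R • ξ) ^ m ∂(ballAvg n) +
        ∫⁻ r in Ioc 0 R, ∫⁻ ξ, ENNReal.ofReal m *
          (f (t, y + r • ξ) ^ (m - 1) * D (t, y + r • ξ)) ∂(ballAvg n) := by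
      intro t
      rw [lintegral_lintegral_swap (by fun_prop), ← lintegral_add_left (by fun_prop)]
      calc f (t, y) ^ m = ∫⁻ ξ, f (t, y) ^ m ∂(ballAvg n) := by simp
        _ ≤ _ := lintegral_mono_ae ((ballAvg_ae_mem n).mono fun ξ hξ => hftc t y hy ξ hξ)
    have e1 : (1 / E)⁻¹ = E := by simp
    have e2 : 1 / (1 / E) = E := by simp
    have hadd := ENNReal.lintegral_Lp_add_le (μ := volume)
      (f := fun t => ∫⁻ ξ, f (t, y + R • ξ) ^ m ∂(ballAvg n))
      (g := fun t => ∫⁻ r in Ioc 0 R, ∫⁻ ξ, ENNReal.ofReal m *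
          (f (t, y + r • ξ) ^ (m - 1) * D (t, y + r • ξ)) ∂(ballAvg n))
      (by
        apply Measurable.aemeasurable
        exact Measurable.lintegral_prod_right' (f := fun z : ℝ × Vec n => f (z.1, y + R • z.2) ^ m)
          (by fun_prop))
      (by
        apply Measurable.aemeasurable
        refine Measurable.lintegral_prod_right' (f := fun z : ℝ × ℝ => ∫⁻ ξ, ENNReal.ofReal m *
          (f (z.1, y + z.2 • ξ) ^ (m - 1) * D (z.1, y + z.2 • ξ)) ∂(ballAvg n)) ?_
        exact Measurable.lintegral_prod_right' (f := fun z : (ℝ × ℝ) × Vec n => ENNReal.ofReal m *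
          (f (z.1.1, y + z.1.2 • z.2) ^ (m - 1) * D (z.1.1, y + z.1.2 • z.2))) (by fun_prop))
      hp1
    rw [e2] at hadd
    have hmk1 := lintegral_minkowski (μ := volume) (ν := ballAvg n)
      (f := fun t ξ => f (t, y + R • ξ) ^ m) (by fun_prop) hp1
    rw [e2] at hmk1
    have hmk2 := lintegral_minkowski (μ := volume) (ν := volume.restrict (Ioc 0 R))
      (f := fun t r => ∫⁻ ξ, ENNReal.ofReal m *
          (f (t, y + r • ξ) ^ (m - 1) * D (t, y + r • ξ)) ∂(ballAvg n)) (by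
        exact Measurable.lintegral_prod_right' (f := fun z : (ℝ × ℝ) × Vec n => ENNReal.ofReal m *
          (f (z.1.1, y + z.1.2 • z.2) ^ (m - 1) * D (z.1.1, y + z.1.2 • z.2))) (by fun_prop)) hp1
    rw [e2] at hmk2
    calc U y ≤ _ := ENNReal.rpow_le_rpow (lintegral_mono fun t =>
            ENNReal.rpow_le_rpow (hpt t) (by positivity)) hE0.le
      _ ≤ _ := hadd
      _ ≤ _ := add_le_add hmk1 (hmk2.trans ?_)
    rw [← lintegral_const_mul]
    swap
    · exact Measurable.lintegral_prod_right' (f := fun z : ℝ × Vec n => H (y + z.1 • z.2))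
        (by fun_prop)
    apply lintegral_mono
    intro r
    have hmk3 := lintegral_minkowski (μ := volume) (ν := ballAvg n)
      (f := fun t ξ => ENNReal.ofReal m *
          (f (t, y + r • ξ) ^ (m - 1) * D (t, y + r • ξ))) (by fun_prop) hp1
    rw [e2] at hmk3
    refine hmk3.trans ?_
    simp only
    rw [← lintegral_const_mul _ (by fun_prop)]
    apply lintegral_mono
    intro ξ
    simp only [H]
    have : ∀ t, (ENNReal.ofReal m * (f (t, y + r • ξ) ^ (m - 1) * D (t, y + r • ξ))) ^ (1 / E) =
        ENNReal.ofReal m ^ (1 / E) * (f (t, y + r • ξ) ^ (m - 1) * D (t, y + r • ξ)) ^ (1 / E) :=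
      fun t => ENNReal.mul_rpow_of_nonneg _ _ (by positivity)
    simp only [this]
    rw [lintegral_const_mul _ (by fun_prop), ENNReal.mul_rpow_of_nonneg _ _ hE0.le,
      ← ENNReal.rpow_mul, one_div_mul_cancel hE0.ne', ENNReal.rpow_one]
  have hJ1' : J y ^ ω ≤ (1 + J y) ^ ω := by gcongr; exact le_add_self
  have h1J : 1 ≤ (1 + J y) ^ ω := by
    simpa using ENNReal.rpow_le_rpow (le_self_add : 1 ≤ 1 + J y) hω0
  have hrR' : 1 ≤ ENNReal.ofReal (R ^ (-(n : ℝ))) := by simpa using hrR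
  set X := ENNReal.ofReal (R ^ (-(n : ℝ)))
  set Y := (1 + J y) ^ ω
  calc U y ≤ _ := hmain
    _ ≤ 8 ^ (E - m / b) * c ^ (m / b) * (X * Λ ^ m) +
        ENNReal.ofReal m * (C₀ * (V * Λ ^ (m - 1)) * J y ^ ω) := by
        gcongr
        exact hJ y
    _ ≤ 8 ^ (E - m / b) * c ^ (m / b) * (X * (V * Λ ^ (m - 1) + Λ ^ m)) * Y +
        ENNReal.ofReal m * (C₀ * (X * (V * Λ ^ (m - 1) + Λ ^ m)) * Y) := by
        have h1 : X * Λ ^ m ≤ X * (V * Λ ^ (m - 1) + Λ ^ m) * Y :=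
          (mul_le_mul_right le_add_self X).trans (le_mul_of_one_le_right' h1J)
        have h2 : V * Λ ^ (m - 1) ≤ X * (V * Λ ^ (m - 1) + Λ ^ m) :=
          le_self_add.trans (le_mul_of_one_le_left' hrR')
        rw [mul_assoc (8 ^ (E - m / b) * c ^ (m / b))]
        gcongr
    _ = _ := by ring

theorem lintegral_mul_three_rpow_le {α : Type*} [MeasurableSpace α] {μ : Measure α}
    {f g h : α → ℝ≥0∞} (hf : AEMeasurable f μ) (hg : AEMeasurable g μ) (hh : AEMeasurable h μ)
    {p q r : ℝ} (hp : 0 ≤ p) (hq : 0 ≤ q) (hr : 0 ≤ r) (hpqr : p + q + r ≤ 1) :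
    ∫⁻ a, f a ^ p * g a ^ q * h a ^ r ∂μ ≤
      (∫⁻ a, f a ∂μ) ^ p * (∫⁻ a, g a ∂μ) ^ q * (∫⁻ a, h a ∂μ) ^ r * μ univ ^ (1 - p - q - r) := by
  have := ENNReal.lintegral_prod_norm_pow_le (μ := μ) (Finset.univ : Finset (Fin 4))
    (f := ![f, g, h, fun _ => 1]) (p := ![p, q, r, 1 - p - q - r])
    (by
      intro i _
      fin_cases i
      exacts [hf, hg, hh, aemeasurable_const])
    (by simp [Fin.sum_univ_four])
    (by
      intro i _
      fin_cases i
      exacts [hp, hq, hr, by simp; linarith])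
  simpa [Fin.prod_univ_four] using this

/-- Exponents for the estimate of `g f²` on a slice, where `g ∈ L^{1/A}` in space with values in
`L^{1/B}` in time. -/
structure HolderExponents (b m ω A B l : ℝ) : Prop where
  A_pos : 0 < A
  B_pos : 0 < B
  l_nonneg : 0 ≤ l
  l_le_one : l ≤ 1
  l_mul_le : l * m ≤ 1
  time : B + 2 * l * ((m - 1) / b + 1 / 2) + 2 * (1 - l * m) / b = 1
  space : A + 2 * l * ω + 2 * (1 - l * m) / b ≤ 1

/-- The estimate of `g f²` on a slice with constant `C`, for functions `f` whose power `m` is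
controlled along segments by `D`. -/
def SliceBound (n : ℕ) (κ b m A B l : ℝ) (C : ℝ≥0∞) : Prop :=
  ∀ R : ℝ, 0 < R → R ≤ 1 →
    ∀ (I : Set ℝ) (Ω : Set (Vec n)), MeasurableSet I → volume I ≤ 8 →
    MeasurableSet Ω → Ω ⊆ Metric.closedBall 0 2 →
    ∀ f D g : ℝ × Vec n → ℝ≥0∞, Measurable f → Measurable D → Measurable g →
    (∀ t ∉ I, ∀ y, f (t, y) = 0) →
    (∀ t, ∀ y ∈ Ω, ∀ ξ ∈ Metric.ball (0 : Vec n) 1, f (t, y) ^ m ≤ f (t, y + R • ξ) ^ m +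
      ∫⁻ r in Ioc 0 R, ENNReal.ofReal m * (f (t, y + r • ξ) ^ (m - 1) * D (t, y + r • ξ))) →
    ∀ V Λ K : ℝ≥0∞, V ≠ 0 → V ≠ ⊤ → Λ ≠ 0 → Λ ≠ ⊤ →
    ∫⁻ y, ∫⁻ t, f (t, y) ^ b ≤ Λ ^ b →
    ∫⁻ y, (∫⁻ t, D (t, y) ^ (2 : ℝ)) ^ (κ / 2) ≤ V ^ κ →
    ∫⁻ y, (∫⁻ t, g (t, y) ^ (1 / B)) ^ (B / A) ≤ K ^ (1 / A) →
    ∫⁻ y in Ω, ∫⁻ t, g (t, y) * f (t, y) ^ (2 : ℝ) ≤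
      C * ENNReal.ofReal (R ^ (-(2 * n : ℝ))) * K *
        (V ^ (2 * l) * Λ ^ (2 * (1 - l)) + Λ ^ (2 : ℝ))

theorem slice_estimate {n : ℕ} {κ b m ω A B l : ℝ} (h : SliceExponents n κ b m ω)
    (h' : HolderExponents b m ω A B l) :
    ∃ C : ℝ≥0∞, C ≠ ⊤ ∧ SliceBound n κ b m A B l C := by
  obtain ⟨C₀, hC₀, hU⟩ := slice_power_bound h
  obtain ⟨hκ1, hκ2, hb, hm, hθ1, hω0, hωθ, hsub⟩ := h
  obtain ⟨hA, hB, hl, hl1, hlm, htime, hspace⟩ := h'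
  have hb0 : 0 < b := by linarith
  have hmb : 0 < (m - 1) / b := div_pos (by linarith) hb0
  set E := (m - 1) / b + 1 / 2 with hE
  have hE0 : 0 < E := by positivity
  set ν := 2 * (1 - l * m) / b with hν
  have hν0 : 0 ≤ ν := div_nonneg (by linarith) hb0.le
  set vB := volume (Metric.closedBall (0 : Vec n) 2) with hvB
  have hvBt : vB ≠ ⊤ := (isCompact_closedBall _ _).measure_lt_top.ne
  set C₁ := (vB + 1) ^ (2 * l * ω) * vB ^ (1 - A - 2 * l * ω - ν) with hC₁
  have h2l : 0 ≤ 2 * l := by positivity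
  refine ⟨(2 * C₀) ^ (2 * l) * C₁, ?_, ?_⟩
  · refine ENNReal.mul_ne_top (ENNReal.rpow_ne_top_of_nonneg h2l (ENNReal.mul_ne_top (by simp) hC₀))
      (ENNReal.mul_ne_top (ENNReal.rpow_ne_top_of_nonneg (by positivity) (by simp [hvBt]))
      (ENNReal.rpow_ne_top_of_nonneg (by linarith) hvBt))
  intro R hR hR1 I Ω hI hI8 hΩm hΩ f D g hf hD hg hfI hftc V Λ K hV0 hVt hΛ0 hΛt hfb hDk hgK
  obtain ⟨J, hJm, hJ1, hJ⟩ := hU R hR hR1 I Ω hI hI8 f D hf hD hfI hftc V Λ hV0 hVt hΛ0 hΛt hfb hDk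
  set X := ENNReal.ofReal (R ^ (-(n : ℝ))) with hX
  set Z := V * Λ ^ (m - 1) + Λ ^ m with hZ
  have hgm : Measurable fun y => ∫⁻ t, g (t, y) ^ (1 / B) :=
    Measurable.lintegral_prod_left' (f := fun z : ℝ × Vec n => g z ^ (1 / B)) (by fun_prop)
  have hBm : Measurable fun y => ∫⁻ t, f (t, y) ^ b :=
    Measurable.lintegral_prod_left' (f := fun z : ℝ × Vec n => f z ^ b) (by fun_prop)
  have hpt : ∀ y ∈ Ω, ∫⁻ t, g (t, y) * f (t, y) ^ (2 : ℝ) ≤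
      (C₀ * X * Z) ^ (2 * l) * (((∫⁻ t, g (t, y) ^ (1 / B)) ^ (B / A)) ^ A *
        (1 + J y) ^ (2 * l * ω) * (∫⁻ t, f (t, y) ^ b) ^ ν) := by
    intro y hy
    have h1 := lintegral_mul_three_rpow_le (μ := volume) (f := fun t => g (t, y) ^ (1 / B))
      (g := fun t => (f (t, y) ^ m) ^ (1 / E)) (h := fun t => f (t, y) ^ b) (by fun_prop)
      (by fun_prop) (by fun_prop) hB.le (q := 2 * l * E) (by positivity) hν0 htime.le
    have h0 : 1 - B - 2 * l * E - ν = 0 := by linarith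
    rw [h0, ENNReal.rpow_zero, mul_one] at h1
    have e1 : ∀ t, (g (t, y) ^ (1 / B)) ^ B * ((f (t, y) ^ m) ^ (1 / E)) ^ (2 * l * E) *
        (f (t, y) ^ b) ^ ν = g (t, y) * f (t, y) ^ (2 : ℝ) := by
      intro t
      rw [← ENNReal.rpow_mul, one_div_mul_cancel hB.ne', ENNReal.rpow_one, ← ENNReal.rpow_mul,
        ← ENNReal.rpow_mul, ← ENNReal.rpow_mul, mul_assoc,
        ← ENNReal.rpow_add_of_nonneg _ _ (by positivity) (by positivity)]
      congr 2
      rw [hν]; field_simp; ring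
    simp only [e1] at h1
    refine h1.trans ?_
    have h2 : (∫⁻ t, (f (t, y) ^ m) ^ (1 / E)) ^ (2 * l * E) ≤
        (C₀ * X * Z) ^ (2 * l) * (1 + J y) ^ (2 * l * ω) := by
      rw [mul_comm (2 * l) E, mul_comm (2 * l) ω, ENNReal.rpow_mul _ E, ENNReal.rpow_mul _ ω,
        ← ENNReal.mul_rpow_of_nonneg _ _ h2l]
      exact ENNReal.rpow_le_rpow (hJ y hy) h2l
    rw [← ENNReal.rpow_mul _ (B / A), div_mul_cancel₀ _ hA.ne']
    calc _ ≤ (∫⁻ t, g (t, y) ^ (1 / B)) ^ B *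
          ((C₀ * X * Z) ^ (2 * l) * (1 + J y) ^ (2 * l * ω)) * (∫⁻ t, f (t, y) ^ b) ^ ν := by
          gcongr
      _ = _ := by ring
  have hJ2 : ∫⁻ y in Ω, (1 + J y) ≤ vB + 1 := by
    rw [lintegral_add_left measurable_const]
    refine add_le_add ?_ ((setLIntegral_le_lintegral _ _).trans hJ1)
    simpa using measure_mono hΩ
  have hK : (∫⁻ y in Ω, (∫⁻ t, g (t, y) ^ (1 / B)) ^ (B / A)) ^ A ≤ K := by
    calc _ ≤ (K ^ (1 / A)) ^ A :=
          ENNReal.rpow_le_rpow ((setLIntegral_le_lintegral _ _).trans hgK) hA.le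
      _ = K := by rw [← ENNReal.rpow_mul, one_div_mul_cancel hA.ne', ENNReal.rpow_one]
  have hX1 : 1 ≤ X := by
    simpa [hX] using Real.one_le_rpow_of_pos_of_le_one_of_nonpos hR hR1 (z := -(n : ℝ)) (by simp)
  have hX2 : X ^ (2 * l) ≤ ENNReal.ofReal (R ^ (-(2 * n : ℝ))) := by
    calc X ^ (2 * l) ≤ X ^ (2 : ℝ) := ENNReal.rpow_le_rpow_of_exponent_le hX1 (by linarith)
      _ = _ := by
        rw [hX, ENNReal.ofReal_rpow_of_pos (by positivity), ← Real.rpow_mul hR.le]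
        congr 2; ring
  have hZ2 : Z ^ (2 * l) * Λ ^ (2 * (1 - l * m)) ≤
      2 ^ (2 * l) * (V ^ (2 * l) * Λ ^ (2 * (1 - l)) + Λ ^ (2 : ℝ)) := by
    have e1 : (V * Λ ^ (m - 1)) ^ (2 * l) * Λ ^ (2 * (1 - l * m)) =
        V ^ (2 * l) * Λ ^ (2 * (1 - l)) := by
      rw [ENNReal.mul_rpow_of_nonneg _ _ h2l, ← ENNReal.rpow_mul, mul_assoc,
        ← ENNReal.rpow_add _ _ hΛ0 hΛt]
      congr 2; ring
    have e2 : (Λ ^ m) ^ (2 * l) * Λ ^ (2 * (1 - l * m)) = Λ ^ (2 : ℝ) := by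
      rw [← ENNReal.rpow_mul, ← ENNReal.rpow_add _ _ hΛ0 hΛt]
      congr 1; ring
    rw [← e1, ← e2, ← add_mul, ← mul_assoc]
    gcongr
    calc Z ^ (2 * l) ≤ (2 * max (V * Λ ^ (m - 1)) (Λ ^ m)) ^ (2 * l) := by
          gcongr
          rw [two_mul]; exact add_le_add (le_max_left _ _) (le_max_right _ _)
      _ = 2 ^ (2 * l) * max (V * Λ ^ (m - 1)) (Λ ^ m) ^ (2 * l) :=
          ENNReal.mul_rpow_of_nonneg _ _ h2l
      _ ≤ _ := by
          gcongr
          rcases max_choice (V * Λ ^ (m - 1)) (Λ ^ m) with h | h <;> rw [h]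
          · exact le_self_add
          · exact le_add_self
  have hΛν : (∫⁻ y in Ω, ∫⁻ t, f (t, y) ^ b) ^ ν ≤ Λ ^ (2 * (1 - l * m)) := by
    calc _ ≤ (Λ ^ b) ^ ν := ENNReal.rpow_le_rpow ((setLIntegral_le_lintegral _ _).trans hfb) hν0
      _ = _ := by rw [← ENNReal.rpow_mul, hν, mul_div_cancel₀ _ hb0.ne']
  calc _ ≤ ∫⁻ y in Ω, (C₀ * X * Z) ^ (2 * l) * (((∫⁻ t, g (t, y) ^ (1 / B)) ^ (B / A)) ^ A *
        (1 + J y) ^ (2 * l * ω) * (∫⁻ t, f (t, y) ^ b) ^ ν) := setLIntegral_mono' hΩm hpt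
    _ = (C₀ * X * Z) ^ (2 * l) * ∫⁻ y in Ω, (((∫⁻ t, g (t, y) ^ (1 / B)) ^ (B / A)) ^ A *
        (1 + J y) ^ (2 * l * ω) * (∫⁻ t, f (t, y) ^ b) ^ ν) :=
        lintegral_const_mul _ (by fun_prop)
    _ ≤ (C₀ * X * Z) ^ (2 * l) * (K * (vB + 1) ^ (2 * l * ω) * Λ ^ (2 * (1 - l * m)) *
          vB ^ (1 - A - 2 * l * ω - ν)) := by
        gcongr
        refine (lintegral_mul_three_rpow_le (μ := volume.restrict Ω) (by fun_prop)
          (by fun_prop) (by fun_prop) hA.le (by positivity) hν0 hspace).trans ?_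
        gcongr
        · linarith
        · rw [Measure.restrict_apply_univ]
          exact measure_mono hΩ
    _ = C₀ ^ (2 * l) * X ^ (2 * l) * K * C₁ * (Z ^ (2 * l) * Λ ^ (2 * (1 - l * m))) := by
        rw [ENNReal.mul_rpow_of_nonneg _ _ h2l, ENNReal.mul_rpow_of_nonneg _ _ h2l, hC₁]
        ring
    _ ≤ C₀ ^ (2 * l) * ENNReal.ofReal (R ^ (-(2 * n : ℝ))) * K * C₁ *
          (2 ^ (2 * l) * (V ^ (2 * l) * Λ ^ (2 * (1 - l)) + Λ ^ (2 : ℝ))) := by gcongr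
    _ = _ := by
        rw [ENNReal.mul_rpow_of_nonneg _ _ h2l]; ring

instance (d : ℕ) : (volume : Measure (ℝ × Vec d)).IsAddHaarMeasure := by
  rw [Measure.volume_eq_prod]; infer_instance

theorem HasWeakSpatialGradOn.congr {d : ℕ} {U : Set (ℝ × Vec d)} {w w' : ℝ × Vec d → ℝ}
    {Dw Dw' : ℝ × Vec d → Vec d} (h : HasWeakSpatialGradOn U w Dw) (hU : MeasurableSet U)
    (hw : w =ᵐ[volume.restrict U] w') (hD : Dw =ᵐ[volume.restrict U] Dw') :
    HasWeakSpatialGradOn U w' Dw' := by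
  obtain ⟨h1, h2, h3⟩ := h
  refine ⟨h1.congr hw, h2.congr hD, fun φ hφ hφc hφU v => ?_⟩
  have e1 : ∫ z, w' z * fderiv ℝ φ z (0, v) = ∫ z, w z * fderiv ℝ φ z (0, v) := by
    apply integral_congr_ae
    filter_upwards [(ae_restrict_iff' hU).1 hw] with z hz
    by_cases hzU : z ∈ U
    · rw [hz hzU]
    · have : fderiv ℝ φ z = 0 := by
        by_contra hne
        exact hzU (hφU (support_fderiv_subset ℝ (Function.mem_support.2 hne)))
      simp [this]
  have e2 : ∫ z, inner ℝ (Dw' z) v * φ z = ∫ z, inner ℝ (Dw z) v * φ z := by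
    apply integral_congr_ae
    filter_upwards [(ae_restrict_iff' hU).1 hD] with z hz
    by_cases hzU : z ∈ U
    · rw [hz hzU]
    · rw [image_eq_zero_of_notMem_tsupport (fun h => hzU (hφU h))]; simp
  rw [e1, e2]
  exact h3 φ hφ hφc hφU v

/-- The probability measure with density a normalized bump function. -/
noncomputable def bumpMeasure {E : Type*} [NormedAddCommGroup E] [NormedSpace ℝ E]
    [HasContDiffBump E] [MeasureSpace E] {c : E} (φ : ContDiffBump c) : Measure E :=
  volume.withDensity fun z => ENNReal.ofReal (φ.normed volume z)

instance {d : ℕ} {c : ℝ × Vec d} (φ : ContDiffBump c) : IsProbabilityMeasure (bumpMeasure φ) := by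
  constructor
  rw [bumpMeasure, withDensity_apply _ MeasurableSet.univ, Measure.restrict_univ,
    ← ofReal_integral_eq_lintegral_ofReal φ.integrable_normed
      (Filter.Eventually.of_forall φ.nonneg_normed), φ.integral_normed, ENNReal.ofReal_one]

/-- Mollification by a normalized bump function. -/
noncomputable def mollify {d : ℕ} (φ : ContDiffBump (0 : ℝ × Vec d)) (w : ℝ × Vec d → ℝ) :
    ℝ × Vec d → ℝ :=
  convolution (φ.normed volume) w (ContinuousLinearMap.lsmul ℝ ℝ) volume

theorem contDiff_mollify {d : ℕ} (φ : ContDiffBump (0 : ℝ × Vec d)) {w : ℝ × Vec d → ℝ}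
    (hw : LocallyIntegrable w volume) : ContDiff ℝ 1 (mollify φ w) :=
  φ.hasCompactSupport_normed.contDiff_convolution_left _ (φ.contDiff_normed (n := 1)) hw

theorem lintegral_bumpMeasure {d : ℕ} (φ : ContDiffBump (0 : ℝ × Vec d)) {f : ℝ × Vec d → ℝ≥0∞}
    (hf : Measurable f) :
    ∫⁻ s, f s ∂(bumpMeasure φ) = ∫⁻ s, ENNReal.ofReal (φ.normed volume s) * f s := by
  rw [bumpMeasure, lintegral_withDensity_eq_lintegral_mul _ _ hf]
  · rfl
  · exact (φ.continuous_normed.measurable).ennreal_ofReal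

theorem enorm_mollify_le {d : ℕ} (φ : ContDiffBump (0 : ℝ × Vec d)) {w : ℝ × Vec d → ℝ}
    (hw : Measurable w) (z : ℝ × Vec d) :
    ‖mollify φ w z‖ₑ ≤ ∫⁻ s, ‖w (z.1 - s.1, z.2 - s.2)‖ₑ ∂(bumpMeasure φ) := by
  rw [lintegral_bumpMeasure φ (by fun_prop), mollify, convolution_def]
  refine (enorm_integral_le_lintegral_enorm _).trans (lintegral_mono fun s => ?_)
  simp only [ContinuousLinearMap.lsmul_apply, smul_eq_mul, enorm_mul]
  rw [Real.enorm_of_nonneg (φ.nonneg_normed s)]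
  exact le_rfl

theorem enorm_fderiv_mollify_le {d : ℕ} (φ : ContDiffBump (0 : ℝ × Vec d)) {U : Set (ℝ × Vec d)}
    {w : ℝ × Vec d → ℝ} {Dw : ℝ × Vec d → Vec d} (h : HasWeakSpatialGradOn U w Dw)
    (hw : LocallyIntegrable w volume) (hD : Measurable Dw) {z : ℝ × Vec d}
    (hz : Metric.closedBall z φ.rOut ⊆ U) (v : Vec d) :
    ‖fderiv ℝ (mollify φ w) z (0, v)‖ₑ ≤
      (∫⁻ s, ‖Dw (z.1 - s.1, z.2 - s.2)‖ₑ ∂(bumpMeasure φ)) * ‖v‖ₑ := by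
  set ψ := φ.normed (volume : Measure (ℝ × Vec d)) with hψ
  have hψd : ContDiff ℝ (⊤ : ℕ∞) ψ := φ.contDiff_normed
  have hψ1 : ContDiff ℝ 1 ψ := φ.contDiff_normed (n := 1)
  have hfd := HasCompactSupport.hasFDerivAt_convolution_left (ContinuousLinearMap.lsmul ℝ ℝ)
    φ.hasCompactSupport_normed hψ1 hw z
  have hIntg := (φ.hasCompactSupport_normed (μ := volume)).fderiv (𝕜 := ℝ)
    |>.convolutionExists_left (ContinuousLinearMap.precompL (ℝ × Vec d)
      (ContinuousLinearMap.lsmul ℝ ℝ)) (hψ1.continuous_fderiv (by simp)) hw z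
  have e1 : fderiv ℝ (mollify φ w) z (0, v) = ∫ s, fderiv ℝ ψ s (0, v) * w (z - s) := by
    rw [mollify, hfd.fderiv, convolution_def, ContinuousLinearMap.integral_apply hIntg]
    rfl
  set χ : ℝ × Vec d → ℝ := fun y => ψ (z - y) with hχ
  have hχd : ContDiff ℝ (⊤ : ℕ∞) χ := hψd.comp (contDiff_const.sub contDiff_id)
  have hχs : tsupport χ ⊆ Metric.closedBall z φ.rOut := by
    apply closure_minimal _ Metric.isClosed_closedBall
    intro y hy
    have : z - y ∈ tsupport ψ := subset_tsupport _ hy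
    rw [φ.tsupport_normed_eq, mem_closedBall_zero_iff] at this
    rwa [Metric.mem_closedBall, dist_comm, dist_eq_norm]
  have hχc : HasCompactSupport χ := (isCompact_closedBall z φ.rOut).of_isClosed_subset
    (isClosed_tsupport _) hχs
  have hχf : ∀ y, fderiv ℝ χ y (0, v) = -fderiv ℝ ψ (z - y) (0, v) := by
    intro y
    have h1 : HasFDerivAt (fun y : ℝ × Vec d => z - y)
        (-ContinuousLinearMap.id ℝ (ℝ × Vec d)) y := (hasFDerivAt_id y).const_sub z
    have h2 := ((hψ1.differentiable (by simp)) (z - y)).hasFDerivAt.comp y h1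
    have : fderiv ℝ χ y = _ := h2.fderiv
    rw [this]
    simp [-Prod.neg_mk]
  have e2 := h.2.2 χ hχd hχc (hχs.trans hz) v
  have e3 : fderiv ℝ (mollify φ w) z (0, v) = ∫ y, inner ℝ (Dw y) v * χ y := by
    have : ∫ s, fderiv ℝ ψ s (0, v) * w (z - s) = ∫ y, fderiv ℝ ψ (z - y) (0, v) * w y := by
      rw [← integral_sub_left_eq_self _ volume z]
      simp
    rw [e1, this, ← neg_inj, ← e2, ← integral_neg]
    congr 1; ext y
    rw [hχf]; ring
  rw [e3, lintegral_bumpMeasure φ (by fun_prop)]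
  refine (enorm_integral_le_lintegral_enorm _).trans ?_
  rw [← lintegral_sub_left_eq_self _ z, ← lintegral_mul_const _ (by
    have := φ.continuous_normed (μ := (volume : Measure (ℝ × Vec d)))
    fun_prop)]
  refine lintegral_mono fun s => ?_
  simp only [enorm_mul, hχ, sub_sub_cancel]
  rw [Real.enorm_of_nonneg (φ.nonneg_normed s), mul_comm]
  have : ‖inner ℝ (Dw (z - s)) v‖ₑ ≤ ‖Dw (z - s)‖ₑ * ‖v‖ₑ := by
    rw [← enorm_norm (Dw (z - s)), ← enorm_norm v, ← enorm_mul]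
    exact enorm_le_iff_norm_le.2 (by simpa using norm_inner_le_norm (𝕜 := ℝ) (Dw (z - s)) v)
  rw [mul_assoc]
  gcongr
  exact this

theorem exists_bump_sequence (E : Type*) [NormedAddCommGroup E] [NormedSpace ℝ E] :
    ∃ φ : ℕ → ContDiffBump (0 : E), (∀ j, (φ j).rOut = 2 / (j + 1)) ∧
      (∀ j, (φ j).rOut ≤ 2 * (φ j).rIn) ∧
      Filter.Tendsto (fun j => (φ j).rOut) Filter.atTop (nhds 0) := by
  refine ⟨fun j => ⟨1 / (j + 1), 2 / (j + 1), by positivity, by gcongr; norm_num⟩, fun j => rfl,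
    fun j => by simp; rw [div_eq_mul_inv], ?_⟩
  have := (tendsto_one_div_add_atTop_nhds_zero_nat (𝕜 := ℝ)).const_mul 2
  simpa only [mul_one_div, mul_zero] using this

theorem power_le_add_lintegral_of_path {u : ℝ → ℝ} {m R : ℝ} (hm : 1 < m) (hR : 0 ≤ R)
    (hu : ContDiff ℝ 1 u) {D : ℝ → ℝ≥0∞} (hD : ∀ r ∈ Ioc 0 R, ‖deriv u r‖ₑ ≤ D r) :
    ‖u 0‖ₑ ^ m ≤ ‖u R‖ₑ ^ m +
      ∫⁻ r in Ioc 0 R, ENNReal.ofReal m * (‖u r‖ₑ ^ (m - 1) * D r) := by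
  have hm0 : 0 ≤ m := by linarith
  set U : ℝ → ℝ := fun r => ‖u r‖ ^ m with hU
  have hUd : ContDiff ℝ 1 U := hu.norm_rpow hm
  have hIntg : IntervalIntegrable (deriv U) volume 0 R :=
    (hUd.continuous_deriv le_rfl).intervalIntegrable _ _
  have hftc := intervalIntegral.integral_deriv_eq_sub
    (fun x _ => (hUd.differentiable (by simp)) x) hIntg
  have e : ∀ r, ‖U r‖ₑ = ‖u r‖ₑ ^ m := fun r => by
    rw [hU, Real.enorm_rpow_of_nonneg (norm_nonneg _) hm0, enorm_norm]
  have hle : ‖U 0‖ₑ ≤ ‖U R‖ₑ + ‖U R - U 0‖ₑ := by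
    calc ‖U 0‖ₑ = ‖U R - (U R - U 0)‖ₑ := by congr 1; ring
      _ ≤ _ := enorm_sub_le
  rw [← e, ← e]
  refine hle.trans ?_
  gcongr
  rw [← hftc, intervalIntegral.integral_of_le hR]
  refine (enorm_integral_le_lintegral_enorm _).trans (setLIntegral_mono' measurableSet_Ioc ?_)
  intro r hr
  have h1 : ‖fderiv ℝ U r‖ₑ ≤ ENNReal.ofReal m * ‖u r‖ₑ ^ (m - 1) * ‖fderiv ℝ u r‖ₑ := by
    have := enorm_fderiv_norm_rpow_le (hu.differentiable (by simp)) (x := r) (p := m.toNNReal)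
      (by simpa using hm)
    rwa [Real.coe_toNNReal _ hm0] at this
  have h2 : ‖deriv U r‖ₑ = ‖fderiv ℝ U r‖ₑ := by
    rw [← enorm_norm, norm_deriv_eq_norm_fderiv, enorm_norm]
  have h3 : ‖deriv u r‖ₑ = ‖fderiv ℝ u r‖ₑ := by
    rw [← enorm_norm, norm_deriv_eq_norm_fderiv, enorm_norm]
  rw [h2]
  refine h1.trans ?_
  rw [← h3, mul_assoc]
  gcongr
  exact hD r hr

theorem exists_slice_coordinates {n : ℕ} (e : Vec (n + 1)) (he : ‖e‖ = 1) :
    ∃ ι : Vec n →ₗᵢ[ℝ] Vec (n + 1), (∀ y, inner ℝ e (ι y) = 0) ∧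
      MeasurePreserving (fun p : ℝ × Vec n => p.1 • e + ι p.2) volume volume := by
  have hon : Orthonormal ℝ (({0} : Set (Fin (n + 1))).domRestrict fun _ => e) := by
    constructor
    · intro i; simpa using he
    · intro i j hij
      exact (hij (Subsingleton.elim i j)).elim
  obtain ⟨b, hb⟩ := hon.exists_orthonormalBasis_extension_of_card_eq (by simp)
  have hb0 : b 0 = e := hb 0 rfl
  let κ₀ : Vec n →ₗ[ℝ] Vec (n + 1) :=
    { toFun := fun y => WithLp.toLp 2 (Fin.cons 0 y.ofLp)
      map_add' := fun x y => by
        ext i; refine Fin.cases ?_ (fun j => ?_) i <;> simp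
      map_smul' := fun c x => by
        ext i; refine Fin.cases ?_ (fun j => ?_) i <;> simp }
  let κ : Vec n →ₗᵢ[ℝ] Vec (n + 1) :=
    { toLinearMap := κ₀
      norm_map' := fun y => by
        simp [κ₀, EuclideanSpace.norm_eq, Fin.sum_univ_succ] }
  refine ⟨b.repr.symm.toLinearIsometry.comp κ, fun y => ?_, ?_⟩
  · have : inner ℝ (b.repr.symm (b.repr e)) (b.repr.symm (κ y)) = inner ℝ (b.repr e) (κ y) :=
      LinearIsometryEquiv.inner_map_map _ _ _
    rw [LinearIsometryEquiv.symm_apply_apply] at this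
    change inner ℝ e (b.repr.symm (κ y)) = 0
    rw [this, ← hb0, b.repr_self]
    simp [EuclideanSpace.inner_single_left, κ, κ₀]
  · have h1 : MeasurePreserving (b.repr.symm) volume volume := b.repr.symm.measurePreserving
    have h2 := EuclideanSpace.volume_preserving_symm_measurableEquiv_toLp (Fin n)
    have h3 := (EuclideanSpace.volume_preserving_symm_measurableEquiv_toLp (Fin (n + 1))).symm
    have h4 := (volume_preserving_piFinSuccAbove (fun _ : Fin (n + 1) => ℝ) 0).symm
    have h5 := (MeasurePreserving.id (volume : Measure ℝ)).prod h2
    have h6 := (h1.comp (h3.comp h4)).comp h5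
    convert! h6 using 1
    ext1 p
    have : p.1 • e = b.repr.symm (p.1 • EuclideanSpace.single 0 1) := by
      rw [map_smul, b.repr_symm_single, hb0]
    change p.1 • e + b.repr.symm (κ p.2) = _
    rw [this, ← map_add]
    simp only [Function.comp_apply]
    congr 1
    ext i
    refine Fin.cases ?_ (fun j => ?_) i
    · simp [κ, κ₀, MeasurableEquiv.piFinSuccAbove, Fin.insertNthEquiv]
    · simp [κ, κ₀, MeasurableEquiv.piFinSuccAbove, Fin.insertNthEquiv]

theorem exists_direction_net {d : ℕ} (hd : 0 < d) {M : ℕ} (hM : d < M) :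
    ∃ e : (Fin d → Fin (2 * M + 1)) → Vec d, (∀ k, ‖e k‖ = 1) ∧
      ∀ x : Vec d, ∃ k, (1 - 2 * d / M) * ‖x‖ ≤ inner ℝ (e k) x := by
  classical
  have : Nonempty (Fin d) := ⟨⟨0, hd⟩⟩
  let z : (Fin d → Fin (2 * M + 1)) → Vec d := fun k =>
    WithLp.toLp 2 fun i => ((k i : ℕ) : ℝ) - M
  let e : (Fin d → Fin (2 * M + 1)) → Vec d := fun k =>
    if z k = 0 then EuclideanSpace.single ⟨0, hd⟩ 1 else ‖z k‖⁻¹ • z k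
  have hMpos : (0 : ℝ) < M := by
    have : 0 < M := by omega
    exact_mod_cast this
  have hdM : (d : ℝ) < M := by exact_mod_cast hM
  have hd1 : (1 : ℝ) ≤ d := by exact_mod_cast hd
  have he1 : ∀ k, ‖e k‖ = 1 := by
    intro k
    by_cases h : z k = 0
    · simp [e, h]
    · simp only [e, if_neg h, norm_smul, norm_inv, norm_norm]
      exact inv_mul_cancel₀ (norm_ne_zero_iff.2 h)
  have hunit : ∀ x : Vec d, ‖x‖ = 1 → ∃ k, (1 - 2 * d / M : ℝ) ≤ inner ℝ (e k) x := by
    intro x hx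
    have hxi : ∀ i, |x i| ≤ 1 := fun i => by
      have := PiLp.norm_apply_le x i
      rwa [hx, Real.norm_eq_abs] at this
    have hf1 : ∀ i, -(M : ℤ) ≤ ⌊M * x i⌋ := fun i => by
      rw [Int.le_floor]; push_cast; nlinarith [(abs_le.1 (hxi i)).1]
    have hf2 : ∀ i, ⌊M * x i⌋ ≤ (M : ℤ) := fun i => by
      have h1 : (⌊M * x i⌋ : ℝ) ≤ M := (Int.floor_le _).trans (by
        nlinarith [(abs_le.1 (hxi i)).2])
      exact_mod_cast h1
    let k : Fin d → Fin (2 * M + 1) := fun i => ⟨(⌊M * x i⌋ + M).toNat, by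
      have := hf1 i; have := hf2 i; omega⟩
    have hzk : ∀ i, z k i = (⌊M * x i⌋ : ℝ) := fun i => by
      have h0 : 0 ≤ ⌊M * x i⌋ + M := by have := hf1 i; omega
      have : (((⌊M * x i⌋ + M).toNat : ℕ) : ℝ) = ((⌊M * x i⌋ + M : ℤ) : ℝ) := by
        exact_mod_cast Int.toNat_of_nonneg h0
      simp only [z, k, this]
      push_cast; ring
    have hdist : ‖z k - (M : ℝ) • x‖ ≤ d := by
      rw [EuclideanSpace.norm_eq]
      apply Real.sqrt_le_iff.2 ⟨by positivity, ?_⟩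
      calc _ ≤ ∑ _i : Fin d, (1 : ℝ) := by
            apply Finset.sum_le_sum
            intro i _
            simp only [PiLp.sub_apply, PiLp.smul_apply, hzk, smul_eq_mul, Real.norm_eq_abs, sq_abs]
            have h1 := Int.floor_le (M * x i)
            have h2 := Int.lt_floor_add_one (M * x i)
            nlinarith
        _ = d := by simp
        _ ≤ _ := by nlinarith
    have hin : (M : ℝ) - d ≤ inner ℝ (z k) x := by
      have h1 : inner ℝ (z k) x = inner ℝ (z k - (M : ℝ) • x) x + M := by
        rw [inner_sub_left, inner_smul_left, real_inner_self_eq_norm_sq, hx]; simp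
      have h2 := (abs_le.1 (abs_real_inner_le_norm (z k - (M : ℝ) • x) x)).1
      rw [hx, mul_one] at h2
      linarith
    have hnorm : ‖z k‖ ≤ M + d := by
      have h1 : ‖z k‖ ≤ ‖z k - (M : ℝ) • x‖ + ‖(M : ℝ) • x‖ := by
        simpa using norm_add_le (z k - (M : ℝ) • x) ((M : ℝ) • x)
      rw [norm_smul, hx, Real.norm_of_nonneg hMpos.le] at h1
      linarith
    have hz0 : z k ≠ 0 := by
      intro h
      rw [h, inner_zero_left] at hin
      linarith
    refine ⟨k, ?_⟩
    simp only [e, if_neg hz0, inner_smul_left]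
    have hzpos : 0 < ‖z k‖ := norm_pos_iff.2 hz0
    simp only [conj_trivial]
    rw [inv_mul_eq_div, le_div_iff₀ hzpos]
    by_cases hneg : (1 - 2 * d / M : ℝ) ≤ 0
    · nlinarith
    · calc (1 - 2 * d / M : ℝ) * ‖z k‖ ≤ (1 - 2 * d / M) * (M + d) := by
            push Not at hneg; gcongr
        _ = M - d - 2 * d ^ 2 / M := by field_simp; ring
        _ ≤ M - d := by
            have : 0 ≤ 2 * (d : ℝ) ^ 2 / M := by positivity
            linarith
        _ ≤ _ := hin
  refine ⟨e, he1, fun x => ?_⟩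
  by_cases hx : x = 0
  · exact ⟨fun _ => 0, by simp [hx]⟩
  have hxp : 0 < ‖x‖ := norm_pos_iff.2 hx
  obtain ⟨k, hk⟩ := hunit (‖x‖⁻¹ • x) (by
    rw [norm_smul, norm_inv, norm_norm, inv_mul_cancel₀ hxp.ne'])
  refine ⟨k, ?_⟩
  rw [inner_smul_right, inv_mul_eq_div, le_div_iff₀ hxp] at hk
  exact hk

theorem exists_profile {a c : ℝ} (hac : a < c) {S : Set ℝ} (hS : MeasurableSet S)
    (hSv : ENNReal.ofReal ((c - a) / 2) ≤ volume (S ∩ Ioo a c)) {h₁ h₂ : ℝ → ℝ≥0∞}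
    (hm₁ : Measurable h₁) (hm₂ : Measurable h₂) (hi₁ : ∫⁻ ρ in Ioo a c, h₁ ρ ≠ ⊤)
    (hi₂ : ∫⁻ ρ in Ioo a c, h₂ ρ ≠ ⊤) {H₁ H₂ : ℝ≥0∞} (hH₁ : ∀ ρ ∈ S, h₁ ρ ≤ H₁)
    (hH₂ : ∀ ρ ∈ S, h₂ ρ ≤ H₂) {err : ℝ≥0∞} (herr : err ≠ 0) :
    ∃ ψ : ℝ → ℝ, ContDiff ℝ 1 ψ ∧ (∀ ρ, ψ ρ ∈ Icc (0 : ℝ) 1) ∧ (∀ ρ ≤ a, ψ ρ = 1) ∧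
      (∀ ρ, c ≤ ρ → ψ ρ = 0) ∧ (∀ ρ, |deriv ψ ρ| ≤ 4 / (c - a)) ∧
      ∫⁻ ρ, ‖deriv ψ ρ‖ₑ ^ 2 * h₁ ρ ≤
        ENNReal.ofReal (4 / (c - a)) ^ 2 * (H₁ * ENNReal.ofReal (c - a) + err) ∧
      ∫⁻ ρ, ‖deriv ψ ρ‖ₑ * h₂ ρ ≤
        ENNReal.ofReal (4 / (c - a)) * (H₂ * ENNReal.ofReal (c - a) + err) := by
  have hL : 0 < c - a := sub_pos.2 hac
  obtain ⟨K, hKS, hKc, hKv⟩ : ∃ K ⊆ S ∩ Ioo a c, IsCompact K ∧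
      ENNReal.ofReal ((c - a) / 4) < volume K := by
    have hlt : ENNReal.ofReal ((c - a) / 4) < volume (S ∩ Ioo a c) :=
      lt_of_lt_of_le ((ENNReal.ofReal_lt_ofReal_iff (by linarith)).2 (by linarith)) hSv
    exact (hS.inter measurableSet_Ioo).exists_lt_isCompact hlt
  set ν : Measure ℝ := (volume.restrict (Ioo a c)).withDensity (fun ρ => h₁ ρ + h₂ ρ) with hν
  have hνfin : IsFiniteMeasure ν := by
    apply isFiniteMeasure_withDensity
    rw [lintegral_add_left hm₁]
    exact ENNReal.add_ne_top.2 ⟨hi₁, hi₂⟩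
  obtain ⟨O, hKO, hOo, hOν⟩ : ∃ O ⊇ K, IsOpen O ∧ ν O < ν K + err :=
    K.exists_isOpen_lt_add (measure_ne_top ν K) herr
  set G := O ∩ Ioo a c with hG
  have hGo : IsOpen G := hOo.inter isOpen_Ioo
  have hKG : K ⊆ G := subset_inter hKO (hKS.trans inter_subset_right)
  have hGν : ν (G \ K) ≤ err := by
    have hGK : ν G ≤ ν K + err := (measure_mono inter_subset_left).trans hOν.le
    rw [measure_sdiff hKG hKc.measurableSet.nullMeasurableSet (measure_ne_top _ _)]
    exact tsub_le_iff_left.2 hGK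
  obtain ⟨φ, hφ0, hφ1, hφI⟩ := exists_continuous_zero_one_of_isClosed hGo.isClosed_compl
    hKc.isClosed (disjoint_left.2 fun x hx hxK => hx (hKG hxK))
  have hφG : ∀ ρ, ρ ∉ G → φ ρ = 0 := fun ρ hρ => hφ0 hρ
  have hφint : ∀ x y, IntervalIntegrable φ volume x y := fun x y =>
    φ.continuous.intervalIntegrable x y
  set m := ∫ ρ in a..c, φ ρ with hm
  have hmpos : (c - a) / 4 ≤ m := by
    rw [hm, intervalIntegral.integral_of_le hac.le]
    have hKreal : (c - a) / 4 ≤ volume.real K := by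
      rw [Measure.real, ← ENNReal.ofReal_le_iff_le_toReal hKc.measure_lt_top.ne]
      exact hKv.le
    have hKI : K ⊆ Ioc a c := (hKS.trans inter_subset_right).trans Ioo_subset_Ioc_self
    calc (c - a) / 4 ≤ volume.real K := hKreal
      _ = ∫ ρ in K, (1 : ℝ) := by simp
      _ = ∫ ρ in K, φ ρ := setIntegral_congr_fun hKc.measurableSet fun x hx => (hφ1 hx).symm
      _ ≤ ∫ ρ in Ioc a c, φ ρ := by
          apply setIntegral_mono_set
          · exact (intervalIntegrable_iff_integrableOn_Ioc_of_le hac.le).1 (hφint a c)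
          · exact Filter.Eventually.of_forall fun x => (hφI x).1
          · exact hKI.eventuallyLE
  have hm0 : 0 < m := by linarith
  set ψ : ℝ → ℝ := fun ρ => 1 - m⁻¹ * ∫ s in a..ρ, φ s with hψ
  have hderiv : ∀ ρ, HasDerivAt ψ (-(m⁻¹ * φ ρ)) ρ := by
    intro ρ
    have := (intervalIntegral.integral_hasDerivAt_right (hφint a ρ)
      (φ.continuous.stronglyMeasurableAtFilter _ _) φ.continuous.continuousAt)
    simpa using ((this.const_mul m⁻¹).const_sub 1)
  have hd : deriv ψ = fun ρ => -(m⁻¹ * φ ρ) := funext fun ρ => (hderiv ρ).deriv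
  have hψ1 : ∀ ρ ≤ a, ψ ρ = 1 := by
    intro ρ hρ
    have : ∫ s in a..ρ, φ s = 0 := by
      rw [intervalIntegral.integral_congr (g := fun _ => 0)]
      · simp
      · intro s hs
        rw [uIcc_of_ge hρ] at hs
        exact hφG s fun h => absurd h.2.1 (not_lt.2 hs.2)
    simp [hψ, this]
  have hψ0 : ∀ ρ, c ≤ ρ → ψ ρ = 0 := by
    intro ρ hρ
    have h1 : ∫ s in c..ρ, φ s = 0 := by
      rw [intervalIntegral.integral_congr (g := fun _ => 0)]
      · simp
      · intro s hs
        rw [uIcc_of_le hρ] at hs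
        exact hφG s fun h => absurd h.2.2 (not_lt.2 hs.1)
    have h2 := intervalIntegral.integral_add_adjacent_intervals (hφint a c) (hφint c ρ)
    rw [h1, add_zero] at h2
    simp [hψ, ← h2, ← hm, hm0.ne']
  have hanti : Antitone ψ := antitone_of_deriv_nonpos (fun ρ => (hderiv ρ).differentiableAt)
    fun ρ => by
      rw [hd]; have := (hφI ρ).1
      simp only [Left.neg_nonpos_iff]; positivity
  have hmi : m⁻¹ ≤ 4 / (c - a) := by
    rw [inv_le_comm₀ hm0 (by positivity)]
    simpa using hmpos
  have hdb : ∀ ρ, |deriv ψ ρ| ≤ 4 / (c - a) := by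
    intro ρ
    rw [hd]; simp only [abs_neg, abs_mul, abs_of_pos (inv_pos.2 hm0), abs_of_nonneg (hφI ρ).1]
    calc m⁻¹ * φ ρ ≤ m⁻¹ * 1 := by
          have := (hφI ρ).2
          gcongr
      _ ≤ _ := by simpa using hmi
  have hde : ∀ ρ, ‖deriv ψ ρ‖ₑ ≤ G.indicator (fun _ => ENNReal.ofReal (4 / (c - a))) ρ := by
    intro ρ
    by_cases hρ : ρ ∈ G
    · rw [indicator_of_mem hρ, Real.enorm_eq_ofReal_abs]
      exact ENNReal.ofReal_le_ofReal (hdb ρ)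
    · rw [hd]; simp [hφG ρ hρ]
  have hbound : ∀ h : ℝ → ℝ≥0∞, Measurable h → (∀ ρ, h ρ ≤ h₁ ρ + h₂ ρ) → ∀ H : ℝ≥0∞,
      (∀ ρ ∈ S, h ρ ≤ H) → ∫⁻ ρ in G, h ρ ≤ H * ENNReal.ofReal (c - a) + err := by
    intro h hhm hle H hH
    have hGsub : G ⊆ Ioo a c := inter_subset_right
    rw [← sdiff_union_of_subset hKG, lintegral_union hKc.measurableSet disjoint_sdiff_left, add_comm]
    refine add_le_add ?_ ?_
    · calc ∫⁻ ρ in K, h ρ ≤ ∫⁻ ρ in K, H :=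
            setLIntegral_mono' hKc.measurableSet fun ρ hρ => hH ρ (hKS hρ).1
        _ = H * volume K := by simp
        _ ≤ H * volume (Ioo a c) := by gcongr; exact hKS.trans inter_subset_right
        _ = _ := by rw [Real.volume_Ioo]
    · refine le_trans ?_ hGν
      have hGKm : MeasurableSet (G \ K) := hGo.measurableSet.diff hKc.measurableSet
      rw [hν, withDensity_apply _ hGKm, Measure.restrict_restrict hGKm,
        inter_eq_left.2 (sdiff_subset.trans hGsub)]
      exact lintegral_mono hle
  refine ⟨ψ, ?_, fun ρ => ⟨?_, ?_⟩, hψ1, hψ0, hdb, ?_, ?_⟩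
  · rw [contDiff_one_iff_deriv]
    refine ⟨fun ρ => (hderiv ρ).differentiableAt, ?_⟩
    rw [hd]; fun_prop
  · rw [← hψ0 (max ρ c) (le_max_right _ _)]; exact hanti (le_max_left _ _)
  · rw [← hψ1 (min ρ a) (min_le_right _ _)]; exact hanti (min_le_left _ _)
  · calc _ ≤ ∫⁻ ρ, G.indicator (fun ρ => ENNReal.ofReal (4 / (c - a)) ^ 2 * h₁ ρ) ρ := by
          apply lintegral_mono
          intro ρ
          have := hde ρ
          by_cases hρ : ρ ∈ G
          · simp only [indicator_of_mem hρ] at this ⊢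
            gcongr
          · simp only [indicator_of_notMem hρ, nonpos_iff_eq_zero] at this ⊢
            simp [this]
      _ = ENNReal.ofReal (4 / (c - a)) ^ 2 * ∫⁻ ρ in G, h₁ ρ := by
          rw [lintegral_indicator hGo.measurableSet, lintegral_const_mul _ hm₁]
      _ ≤ _ := by gcongr; exact hbound h₁ hm₁ (fun _ => le_self_add) H₁ hH₁
  · calc _ ≤ ∫⁻ ρ, G.indicator (fun ρ => ENNReal.ofReal (4 / (c - a)) * h₂ ρ) ρ := by
          apply lintegral_mono
          intro ρ
          have := hde ρ
          by_cases hρ : ρ ∈ G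
          · simp only [indicator_of_mem hρ] at this ⊢
            gcongr
          · simp only [indicator_of_notMem hρ, nonpos_iff_eq_zero] at this ⊢
            simp [this]
      _ = ENNReal.ofReal (4 / (c - a)) * ∫⁻ ρ in G, h₂ ρ := by
          rw [lintegral_indicator hGo.measurableSet, lintegral_const_mul _ hm₂]
      _ ≤ _ := by gcongr; exact hbound h₂ hm₂ (fun _ => le_add_self) H₂ hH₂

theorem exists_time_cutoff {τ₁ τ₂ : ℝ} (h1 : 1 ≤ τ₁) (h12 : τ₁ < τ₂) :
    ∃ η : ℝ → ℝ, ContDiff ℝ 1 η ∧ (∀ t, η t ∈ Icc (0 : ℝ) 1) ∧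
      tsupport η ⊆ Icc (-τ₂ ^ 2) (τ₂ ^ 2) ∧ (∀ t ∈ Icc (-τ₁ ^ 2) (τ₁ ^ 2), η t = 1) ∧
      ∀ t, |deriv η t| ≤ 4 * (τ₂ - τ₁)⁻¹ := by
  have hgap : 2 * (τ₂ - τ₁) ≤ τ₂ ^ 2 - τ₁ ^ 2 := by nlinarith
  have hδ : 0 < τ₂ - τ₁ := sub_pos.2 h12
  obtain ⟨ψ, hψ, hψI, hψ1, hψ0, hψd, -, -⟩ := exists_profile (a := τ₁ ^ 2) (c := τ₂ ^ 2)
    (by linarith) (S := univ) MeasurableSet.univ (by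
      rw [univ_inter, Real.volume_Ioo]; exact ENNReal.ofReal_le_ofReal (by linarith))
    (h₁ := 0) (h₂ := 0) measurable_zero measurable_zero (by simp) (by simp) (H₁ := 0) (H₂ := 0)
    (by simp) (by simp) one_ne_zero
  refine ⟨fun t => ψ t * ψ (-t), hψ.mul (hψ.comp contDiff_neg), fun t => ?_, ?_, ?_, ?_⟩
  · exact ⟨mul_nonneg (hψI t).1 (hψI _).1, mul_le_one₀ (hψI t).2 (hψI _).1 (hψI _).2⟩
  · apply closure_minimal _ isClosed_Icc
    intro t ht
    constructor
    · by_contra hlt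
      exact ht (by simp [hψ0 (-t) (by push Not at hlt; linarith)])
    · by_contra hlt
      exact ht (by simp [hψ0 t (by push Not at hlt; linarith)])
  · intro t ht
    simp [hψ1 t ht.2, hψ1 (-t) (by linarith [ht.1])]
  · intro t
    have hd : ∀ s, HasDerivAt ψ (deriv ψ s) s := fun s =>
      (hψ.differentiable (by simp) s).hasDerivAt
    have hneg : HasDerivAt (fun s => ψ (-s)) (-deriv ψ (-t)) t := by
      have := (hd (-t)).comp t (hasDerivAt_neg t)
      rw [mul_neg_one] at this
      exact this
    have hp : deriv (fun t => ψ t * ψ (-t)) t = deriv ψ t * ψ (-t) + ψ t * -deriv ψ (-t) :=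
      ((hd t).mul hneg).deriv
    have hb : ∀ s, |deriv ψ s| ≤ 2 * (τ₂ - τ₁)⁻¹ := fun s => by
      refine (hψd s).trans ?_
      rw [← div_eq_mul_inv, div_le_div_iff₀ (by linarith) hδ]
      linarith
    have habs : ∀ s, |ψ s| ≤ 1 := fun s => abs_le.2 ⟨by linarith [(hψI s).1], (hψI s).2⟩
    rw [hp]
    calc _ ≤ |deriv ψ t| * |ψ (-t)| + |ψ t| * |deriv ψ (-t)| := by
          refine (abs_add_le _ _).trans ?_
          rw [abs_mul, abs_mul, abs_neg]
      _ ≤ |deriv ψ t| * 1 + 1 * |deriv ψ (-t)| := by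
          gcongr <;> exact habs _
      _ ≤ _ := by linarith [hb t, hb (-t)]

theorem exists_polytope_cutoff {d : ℕ} {ι : Type*} [Fintype ι] {e : ι → Vec d}
    (he : ∀ k, ‖e k‖ = 1) {τ₁ c τa τ₂ : ℝ} (hτ : τa < τ₂)
    (hnet : ∀ x : Vec d, τa ≤ ‖x‖ → ∃ k, c ≤ inner ℝ (e k) x) {ψ : ι → ℝ → ℝ}
    (hψ : ∀ k, ContDiff ℝ 1 (ψ k)) (hψI : ∀ k ρ, ψ k ρ ∈ Icc (0 : ℝ) 1)
    (hψ1 : ∀ k, ∀ ρ ≤ τ₁, ψ k ρ = 1) (hψ0 : ∀ k ρ, c ≤ ρ → ψ k ρ = 0) :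
    ∃ η : Vec d → ℝ, ContDiff ℝ 1 η ∧ (∀ x, η x ∈ Icc (0 : ℝ) 1) ∧ HasCompactSupport η ∧
      tsupport η ⊆ Metric.ball 0 τ₂ ∧ (∀ x ∈ Metric.ball (0 : Vec d) τ₁, η x = 1) ∧
      (∀ x, ‖fderiv ℝ η x‖ ≤ ∑ k, |deriv (ψ k) (inner ℝ (e k) x)|) ∧
      ∀ x, τa < ‖x‖ → fderiv ℝ η x = 0 := by
  classical
  set η : Vec d → ℝ := fun x => ∏ k, ψ k (inner ℝ (e k) x) with hη
  have hη0 : ∀ x : Vec d, τa ≤ ‖x‖ → η x = 0 := fun x hx => by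
    obtain ⟨k, hk⟩ := hnet x hx
    exact Finset.prod_eq_zero (Finset.mem_univ k) (hψ0 k _ hk)
  have hsupp : tsupport η ⊆ Metric.closedBall 0 τa := by
    apply closure_minimal _ Metric.isClosed_closedBall
    intro x hx
    rw [mem_closedBall_zero_iff]
    by_contra h
    exact hx (hη0 x (not_le.1 h).le)
  have habs : ∀ k ρ, |ψ k ρ| ≤ 1 := fun k s =>
    abs_le.2 ⟨by linarith [(hψI k s).1], (hψI k s).2⟩
  refine ⟨η, ?_, fun x => ⟨?_, ?_⟩, ?_, ?_, ?_, ?_, ?_⟩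
  · exact contDiff_prod fun k _ => (hψ k).comp (contDiff_const.inner ℝ contDiff_id)
  · exact Finset.prod_nonneg fun k _ => (hψI k _).1
  · exact Finset.prod_le_one (fun k _ => (hψI k _).1) fun k _ => (hψI k _).2
  · exact (isCompact_closedBall _ _).of_isClosed_subset (isClosed_tsupport _) hsupp
  · exact hsupp.trans (Metric.closedBall_subset_ball hτ)
  · intro x hx
    refine Finset.prod_eq_one fun k _ => hψ1 k _ ?_
    have := real_inner_le_norm (e k) x
    rw [he, one_mul] at this
    exact this.trans (mem_ball_zero_iff.1 hx).le
  · intro x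
    have hk : ∀ k, HasFDerivAt (fun x => ψ k (inner ℝ (e k) x))
        (deriv (ψ k) (inner ℝ (e k) x) • innerSL ℝ (e k)) x := fun k =>
      ((hψ k).differentiable (by simp) _).hasDerivAt.comp_hasFDerivAt x
        (innerSL ℝ (e k)).hasFDerivAt
    have hprod := HasFDerivAt.finsetProd (u := Finset.univ) fun k _ => hk k
    have : fderiv ℝ η x = _ := hprod.fderiv
    rw [this]
    refine (norm_sum_le _ _).trans (Finset.sum_le_sum fun k _ => ?_)
    rw [norm_smul, norm_smul, innerSL_apply_norm, he, mul_one, Real.norm_eq_abs, Real.norm_eq_abs]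
    refine mul_le_of_le_one_left (abs_nonneg _) ?_
    rw [Finset.abs_prod]
    exact Finset.prod_le_one (fun _ _ => abs_nonneg _) fun j _ => habs j _
  · intro x hx
    have : η =ᶠ[nhds x] fun _ => 0 := by
      filter_upwards [(isOpen_lt continuous_const continuous_norm).mem_nhds hx] with y hy
      exact hη0 y (le_of_lt hy)
    rw [this.fderiv_eq]; simp
open Filter

theorem ae_slices {n : ℕ} {Φ : ℝ × Vec n → Vec (n + 1)} (hΦ : MeasurePreserving Φ volume volume)
    {P : ℝ × Vec (n + 1) → Prop} (hP : ∀ᵐ z, P z) :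
    ∀ᵐ ρ : ℝ, ∀ᵐ y : Vec n, ∀ᵐ t : ℝ, P (t, Φ (ρ, y)) := by
  have h1 : ∀ᵐ q : Vec (n + 1) × ℝ, P q.swap :=
    (Measure.measurePreserving_swap (μ := (volume : Measure (Vec (n + 1))))
      (ν := (volume : Measure ℝ))).quasiMeasurePreserving.ae hP
  have h2 : ∀ᵐ x : Vec (n + 1), ∀ᵐ t : ℝ, P (t, x) := Measure.ae_ae_of_ae_prod h1
  exact Measure.ae_ae_of_ae_prod (hΦ.quasiMeasurePreserving.ae h2)

theorem lintegral_slices {n : ℕ} {Φ : ℝ × Vec n → Vec (n + 1)}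
    (hΦ : MeasurePreserving Φ volume volume) {F : Vec (n + 1) → ℝ≥0∞} (hF : Measurable F) :
    ∫⁻ ρ, ∫⁻ y, F (Φ (ρ, y)) = ∫⁻ x, F x := by
  rw [← hΦ.lintegral_comp hF, Measure.volume_eq_prod]
  exact (lintegral_prod _ (hF.comp hΦ.measurable).aemeasurable).symm

theorem mollify_power_le_of_segment {d : ℕ} (φ : ContDiffBump (0 : ℝ × Vec d))
    {U : Set (ℝ × Vec d)} {W : ℝ × Vec d → ℝ} {D : ℝ × Vec d → Vec d}
    (hWD : HasWeakSpatialGradOn U W D) (hWi : LocallyIntegrable W volume) (hDm : Measurable D)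
    {m R : ℝ} (hm : 1 < m) (hR : 0 ≤ R) {t : ℝ} {x ζ : Vec d} (hζ : ‖ζ‖ ≤ 1)
    (hseg : ∀ r ∈ Icc 0 R, Metric.closedBall (t, x + r • ζ) φ.rOut ⊆ U) :
    ‖mollify φ W (t, x)‖ₑ ^ m ≤ ‖mollify φ W (t, x + R • ζ)‖ₑ ^ m +
      ∫⁻ r in Ioc 0 R, ENNReal.ofReal m * (‖mollify φ W (t, x + r • ζ)‖ₑ ^ (m - 1) *
        ∫⁻ s, ‖D (t - s.1, x + r • ζ - s.2)‖ₑ ∂(bumpMeasure φ)) := by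
  have hwd : ContDiff ℝ 1 (mollify φ W) := contDiff_mollify φ hWi
  have hpath : ∀ r : ℝ, HasDerivAt (fun r : ℝ => ((t, x + r • ζ) : ℝ × Vec d)) (0, ζ) r :=
    fun r => by
      have h2 : HasDerivAt (fun r : ℝ => x + r • ζ) ζ r := by
        simpa using ((hasDerivAt_id r).smul_const ζ).const_add x
      exact (hasDerivAt_const r t).prodMk h2
  have hu : ContDiff ℝ 1 fun r : ℝ => mollify φ W (t, x + r • ζ) :=
    hwd.comp (contDiff_const.prodMk (contDiff_const.add (contDiff_id.smul contDiff_const)))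
  have hmain := power_le_add_lintegral_of_path hm hR hu
    (D := fun r => ∫⁻ s, ‖D (t - s.1, x + r • ζ - s.2)‖ₑ ∂(bumpMeasure φ)) (fun r hr => by
      have hd : deriv (fun r : ℝ => mollify φ W (t, x + r • ζ)) r =
          fderiv ℝ (mollify φ W) (t, x + r • ζ) (0, ζ) :=
        ((hwd.differentiable (by simp) _).hasFDerivAt.comp_hasDerivAt r (hpath r)).deriv
      rw [hd]
      refine (enorm_fderiv_mollify_le φ hWD hWi hDm (hseg r ⟨hr.1.le, hr.2⟩) ζ).trans ?_
      refine mul_le_of_le_one_right' ?_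
      rw [← ofReal_norm]
      exact ENNReal.ofReal_le_one.2 hζ)
  simpa using hmain

theorem ENNReal.mul_le_liminf_mul {a b : ℝ≥0∞} {u : ℕ → ℝ≥0∞} (hu : Tendsto u atTop (nhds b)) :
    a * b ≤ liminf (fun j => a * u j) atTop := by
  by_cases ha : a = ⊤
  · by_cases hb : b = 0
    · simp [hb]
    · refine le_liminf_of_le (by isBoundedDefault) ?_
      filter_upwards [hu.eventually_ne hb] with j hj
      rw [ha, ENNReal.top_mul hj]
      exact le_top
  · rw [ENNReal.liminf_const_mul_of_ne_top ha, hu.liminf_eq]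

set_option maxHeartbeats 600000 in
theorem exists_slice_gauge {n : ℕ} {κ b τa R τ₂ : ℝ} (hκ : 1 ≤ κ) (hb : 1 ≤ b) (hR : 0 < R)
    (hR1 : R ≤ 1) (hτ : τa + R < τ₂) (hτ0 : 0 ≤ τ₂) (hτ2 : τ₂ ≤ 2) {W : ℝ × Vec (n + 1) → ℝ}
    {D : ℝ × Vec (n + 1) → Vec (n + 1)} (hWm : Measurable W) (hDm : Measurable D)
    (hWi : LocallyIntegrable W volume)
    (hW0 : ∀ z ∉ Ioo (-τ₂ ^ 2) (τ₂ ^ 2) ×ˢ Metric.ball (0 : Vec (n + 1)) τ₂, W z = 0)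
    (hWD : HasWeakSpatialGradOn (Ioo (-τ₂ ^ 2) (τ₂ ^ 2) ×ˢ Metric.ball (0 : Vec (n + 1)) τ₂) W D)
    {V Λ : ℝ≥0∞} (hV0 : V ≠ 0) (hVt : V ≠ ⊤) (hΛ0 : Λ ≠ 0) (hΛt : Λ ≠ ⊤)
    (hV : ∫⁻ x, (∫⁻ t, ‖D (t, x)‖ₑ ^ (2 : ℝ)) ^ (κ / 2) ≤ V ^ κ)
    (hΛ : ∫⁻ x, ∫⁻ t, ‖W (t, x)‖ₑ ^ b ≤ Λ ^ b) {e : Vec (n + 1)} {ι : Vec n →ₗᵢ[ℝ] Vec (n + 1)}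
    (hι : ∀ y, inner ℝ e (ι y) = 0)
    (hΦ : MeasurePreserving (fun p : ℝ × Vec n => p.1 • e + ι p.2) volume volume) :
    ∃ N : ℝ → ℝ≥0∞, Measurable N ∧ ∫⁻ ρ, N ρ ≤ 2 ∧ ∀ᵐ ρ, ∀ T : ℝ≥0∞, T ≠ ⊤ → N ρ < T →
      ∀ (m A B l : ℝ) (C : ℝ≥0∞), 1 < m → SliceBound n κ b m A B l C →
      ∀ (g : ℝ × Vec (n + 1) → ℝ≥0∞) (K : ℝ≥0∞), Measurable g →
      ∫⁻ y, (∫⁻ t, g (t, ρ • e + ι y) ^ (1 / B)) ^ (B / A) ≤ K ^ (1 / A) →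
      ∫⁻ y in {y | ‖ρ • e + ι y‖ ≤ τa}, ∫⁻ t,
          g (t, ρ • e + ι y) * ‖W (t, ρ • e + ι y)‖ₑ ^ (2 : ℝ) ≤
        C * ENNReal.ofReal (R ^ (-(2 * n : ℝ))) * K *
          ((V * T ^ (1 / κ)) ^ (2 * l) * (Λ * T ^ (1 / b)) ^ (2 * (1 - l)) +
            (Λ * T ^ (1 / b)) ^ (2 : ℝ)) := by
  have hκ0 : 0 < κ := by linarith
  have hb0 : 0 < b := by linarith
  set U := Ioo (-τ₂ ^ 2) (τ₂ ^ 2) ×ˢ Metric.ball (0 : Vec (n + 1)) τ₂ with hU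
  set Φ : ℝ × Vec n → Vec (n + 1) := fun p => p.1 • e + ι p.2 with hΦdef
  have hΦm : Measurable Φ := hΦ.measurable
  obtain ⟨φ, hφr, hφ2, hφ0⟩ := exists_bump_sequence (ℝ × Vec (n + 1))
  set w : ℕ → ℝ × Vec (n + 1) → ℝ := fun j => mollify (φ j) W with hw
  have hwd : ∀ j, ContDiff ℝ 1 (w j) := fun j => contDiff_mollify (φ j) hWi
  have hwm : ∀ j, Measurable (w j) := fun j => (hwd j).continuous.measurable
  set I : ℕ → Set ℝ := fun j => Ioo (-τ₂ ^ 2 + (φ j).rOut) (τ₂ ^ 2 - (φ j).rOut) with hI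
  set X : Set (Vec (n + 1)) := Metric.closedBall 0 (τa + R) with hX
  set f : ℕ → ℝ × Vec (n + 1) → ℝ≥0∞ := fun j => (I j ×ˢ X).indicator fun z => ‖w j z‖ₑ with hf
  have hfmem : ∀ j t x, t ∈ I j → x ∈ X → f j (t, x) = ‖w j (t, x)‖ₑ := fun j t x h1 h2 =>
    indicator_of_mem (mk_mem_prod h1 h2) _
  have hfnot : ∀ j t x, t ∉ I j → f j (t, x) = 0 := fun j t x h1 =>
    indicator_of_notMem (fun h => h1 (mem_prod.1 h).1) _
  have hfm : ∀ j, Measurable (f j) := fun j =>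
    (hwm j).enorm.indicator (measurableSet_Ioo.prod Metric.isClosed_closedBall.measurableSet)
  set G : ℕ → ℝ × Vec (n + 1) → ℝ≥0∞ := fun j z =>
    ∫⁻ s, ‖D (z.1 - s.1, z.2 - s.2)‖ₑ ∂(bumpMeasure (φ j)) with hG
  have hGm : ∀ j, Measurable (G j) := fun j =>
    Measurable.lintegral_prod_right' (f := fun q : (ℝ × Vec (n + 1)) × (ℝ × Vec (n + 1)) =>
      ‖D (q.1.1 - q.2.1, q.1.2 - q.2.2)‖ₑ) (by fun_prop)
  have hGV : ∀ j, ∫⁻ x, (∫⁻ t, G j (t, x) ^ (2 : ℝ)) ^ (κ / 2) ≤ V ^ κ := fun j =>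
    (mixed_average_le volume volume (bumpMeasure (φ j)) (f := fun z => ‖D z‖ₑ) (by fun_prop)
      (by norm_num) hκ).trans hV
  have hfΛ : ∀ j, ∫⁻ x, ∫⁻ t, f j (t, x) ^ b ≤ Λ ^ b := fun j => by
    have h := mixed_average_le volume volume (bumpMeasure (φ j)) (f := fun z => ‖W z‖ₑ)
      (by fun_prop) hb hb
    simp only [div_self hb0.ne', ENNReal.rpow_one] at h
    refine le_trans (lintegral_mono fun x => lintegral_mono fun t => ?_) (h.trans hΛ)
    refine ENNReal.rpow_le_rpow ?_ hb0.le
    exact (indicator_le_self' (fun _ _ => zero_le) _).trans (enorm_mollify_le (φ j) hWm (t, x))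
  have hmV : ∀ j, Measurable fun x => (∫⁻ t, G j (t, x) ^ (2 : ℝ)) ^ (κ / 2) := fun j =>
    (Measurable.lintegral_prod_left' (f := fun z : ℝ × Vec (n + 1) => G j z ^ (2 : ℝ))
      ((hGm j).pow_const _)).pow_const _
  have hmΛ : ∀ j, Measurable fun x => ∫⁻ t, f j (t, x) ^ b := fun j =>
    Measurable.lintegral_prod_left' (f := fun z : ℝ × Vec (n + 1) => f j z ^ b)
      ((hfm j).pow_const _)
  set NV : ℕ → ℝ → ℝ≥0∞ := fun j ρ => ∫⁻ y, (∫⁻ t, G j (t, Φ (ρ, y)) ^ (2 : ℝ)) ^ (κ / 2) with hNV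
  set NΛ : ℕ → ℝ → ℝ≥0∞ := fun j ρ => ∫⁻ y, ∫⁻ t, f j (t, Φ (ρ, y)) ^ b with hNΛ
  have hNVm : ∀ j, Measurable (NV j) := fun j =>
    Measurable.lintegral_prod_right' ((hmV j).comp hΦm)
  have hNΛm : ∀ j, Measurable (NΛ j) := fun j =>
    Measurable.lintegral_prod_right' ((hmΛ j).comp hΦm)
  have hVκ0 : V ^ κ ≠ 0 := by simp [hV0, hVt]
  have hVκt : V ^ κ ≠ ⊤ := ENNReal.rpow_ne_top_of_nonneg hκ0.le hVt
  have hΛb0 : Λ ^ b ≠ 0 := by simp [hΛ0, hΛt]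
  have hΛbt : Λ ^ b ≠ ⊤ := ENNReal.rpow_ne_top_of_nonneg hb0.le hΛt
  set Nj : ℕ → ℝ → ℝ≥0∞ := fun j ρ => NV j ρ / V ^ κ + NΛ j ρ / Λ ^ b with hNj
  have hNjm : ∀ j, Measurable (Nj j) := fun j =>
    ((hNVm j).div_const _).add ((hNΛm j).div_const _)
  have hNj2 : ∀ j, ∫⁻ ρ, Nj j ρ ≤ 2 := fun j => by
    simp only [hNj, div_eq_mul_inv]
    rw [lintegral_add_left ((hNVm j).mul_const _), lintegral_mul_const _ (hNVm j),
      lintegral_mul_const _ (hNΛm j)]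
    have e1 : ∫⁻ ρ, NV j ρ ≤ V ^ κ := (lintegral_slices hΦ (hmV j)).le.trans (hGV j)
    have e2 : ∫⁻ ρ, NΛ j ρ ≤ Λ ^ b := (lintegral_slices hΦ (hmΛ j)).le.trans (hfΛ j)
    calc _ ≤ V ^ κ * (V ^ κ)⁻¹ + Λ ^ b * (Λ ^ b)⁻¹ := by gcongr
      _ = 2 := by
        rw [ENNReal.mul_inv_cancel hVκ0 hVκt, ENNReal.mul_inv_cancel hΛb0 hΛbt]; norm_num
  have hconv : ∀ᵐ z, Tendsto (fun j => w j z) atTop (nhds (W z)) :=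
    ContDiffBump.ae_convolution_tendsto_right_of_locallyIntegrable (K := 2) hφ0
      (Eventually.of_forall hφ2) hWi
  refine ⟨fun ρ => liminf (fun j => Nj j ρ) atTop, Measurable.liminf hNjm, ?_, ?_⟩
  · refine (lintegral_liminf_le hNjm).trans ?_
    calc _ ≤ liminf (fun _ : ℕ => (2 : ℝ≥0∞)) atTop := liminf_le_liminf (Eventually.of_forall hNj2)
      _ = 2 := liminf_const _
  filter_upwards [ae_slices hΦ hconv] with ρ hρ T hTt hNT m A B l C hm hC g K hg hgK
  have hm0 : 0 < m := by linarith
  have hT0 : T ≠ 0 := (zero_le.trans_lt hNT).ne'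
  set Ω : Set (Vec n) := {y | ‖ρ • e + ι y‖ ≤ τa} with hΩ
  have hcont : Continuous fun y : Vec n => ρ • e + ι y :=
    continuous_const.add ι.continuous
  have hΩm : MeasurableSet Ω := (isClosed_le hcont.norm continuous_const).measurableSet
  have hΩ2 : Ω ⊆ Metric.closedBall 0 2 := by
    intro y hy
    rw [mem_closedBall_zero_iff]
    have hort : inner ℝ (ρ • e) (ι y) = 0 := by rw [inner_smul_left, hι]; simp
    have hp := norm_add_sq_eq_norm_sq_add_norm_sq_of_inner_eq_zero _ _ hort
    rw [ι.norm_map] at hp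
    have hy' : ‖ρ • e + ι y‖ ≤ τa := hy
    have : ‖y‖ ≤ ‖ρ • e + ι y‖ := by
      apply le_of_sq_le_sq _ (norm_nonneg _)
      nlinarith [sq_nonneg ‖ρ • e‖]
    linarith
  have hsm : Measurable fun q : ℝ × Vec n => (q.1, ρ • e + ι q.2) :=
    measurable_fst.prodMk (hcont.measurable.comp measurable_snd)
  set Bd := C * ENNReal.ofReal (R ^ (-(2 * n : ℝ))) * K *
          ((V * T ^ (1 / κ)) ^ (2 * l) * (Λ * T ^ (1 / b)) ^ (2 * (1 - l)) +
            (Λ * T ^ (1 / b)) ^ (2 : ℝ)) with hBd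
  have hTκt : T ^ (1 / κ) ≠ ⊤ := ENNReal.rpow_ne_top_of_nonneg (by positivity) hTt
  have hTbt : T ^ (1 / b) ≠ ⊤ := ENNReal.rpow_ne_top_of_nonneg (by positivity) hTt
  have hTκ0 : T ^ (1 / κ) ≠ 0 := by simp [hT0, hTt]
  have hTb0 : T ^ (1 / b) ≠ 0 := by simp [hT0, hTt]
  have hstep : ∀ j, (φ j).rOut < τ₂ - τa - R → Nj j ρ < T →
      ∫⁻ y in Ω, ∫⁻ t, g (t, ρ • e + ι y) * f j (t, ρ • e + ι y) ^ (2 : ℝ) ≤ Bd := by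
    intro j hj hNjT
    have hr0 : 0 < (φ j).rOut := (φ j).rOut_pos
    refine hC R hR hR1 (I j) Ω measurableSet_Ioo ?_ hΩm hΩ2
      (fun q => f j (q.1, ρ • e + ι q.2)) (fun q => G j (q.1, ρ • e + ι q.2))
      (fun q => g (q.1, ρ • e + ι q.2)) ((hfm j).comp hsm) ((hGm j).comp hsm) (hg.comp hsm)
      ?_ ?_ _ _ K (mul_ne_zero hV0 hTκ0) (ENNReal.mul_ne_top hVt hTκt) (mul_ne_zero hΛ0 hTb0)
      (ENNReal.mul_ne_top hΛt hTbt) ?_ ?_ hgK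
    · rw [Real.volume_Ioo]
      rw [show (8 : ℝ≥0∞) = ENNReal.ofReal 8 by norm_num]
      exact ENNReal.ofReal_le_ofReal (by nlinarith)
    · intro t ht y
      exact hfnot j _ _ ht
    · intro t y hy ξ hξ
      by_cases ht : t ∈ I j
      swap
      · have : f j (t, ρ • e + ι y) = 0 := hfnot j _ _ ht
        simp only [this, ENNReal.zero_rpow_of_pos hm0]
        exact zero_le
      have hξ1 : ‖ι ξ‖ ≤ 1 := by rw [ι.norm_map]; exact (mem_ball_zero_iff.1 hξ).le
      have hy' : ‖ρ • e + ι y‖ ≤ τa := hy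
      have hpt : ∀ r : ℝ, ρ • e + ι (y + r • ξ) = (ρ • e + ι y) + r • ι ξ := fun r => by
        rw [map_add, map_smul, add_assoc]
      have hmem : ∀ r ∈ Icc 0 R, (ρ • e + ι y) + r • ι ξ ∈ X := fun r hr => by
        rw [hX, mem_closedBall_zero_iff]
        refine (norm_add_le _ _).trans (add_le_add hy' ?_)
        rw [norm_smul, Real.norm_of_nonneg hr.1]
        nlinarith [hr.1, hr.2, norm_nonneg (ι ξ)]
      have hfe : ∀ r ∈ Icc 0 R, f j (t, ρ • e + ι (y + r • ξ)) =
          ‖w j (t, (ρ • e + ι y) + r • ι ξ)‖ₑ := fun r hr => by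
        rw [hpt]
        exact hfmem j _ _ ht (hmem r hr)
      have hmain := mollify_power_le_of_segment (φ j) hWD hWi hDm hm hR.le (t := t)
        (x := ρ • e + ι y) hξ1 (fun r hr => by
          rintro ⟨s, x⟩ hsx
          rw [← closedBall_prod_same] at hsx
          have hs : |s - t| ≤ (φ j).rOut := hsx.1
          have hx : ‖x - ((ρ • e + ι y) + r • ι ξ)‖ ≤ (φ j).rOut := by
            rw [← dist_eq_norm]; exact hsx.2
          have hx2 := hmem r hr
          rw [hX, mem_closedBall_zero_iff] at hx2
          rw [abs_le] at hs
          refine ⟨⟨by linarith [ht.1], by linarith [ht.2]⟩, ?_⟩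
          rw [mem_ball_zero_iff]
          have := norm_add_le (x - ((ρ • e + ι y) + r • ι ξ)) ((ρ • e + ι y) + r • ι ξ)
          rw [sub_add_cancel] at this
          linarith)
      have h0 := hfe 0 ⟨le_rfl, hR.le⟩
      rw [zero_smul, add_zero, zero_smul, add_zero] at h0
      simp only
      rw [h0, hfe R ⟨hR.le, le_rfl⟩]
      refine hmain.trans (add_le_add le_rfl (setLIntegral_mono' measurableSet_Ioc fun r hr => ?_))
      rw [hfe r ⟨hr.1.le, hr.2⟩, hpt r]
    · have : NΛ j ρ / Λ ^ b ≤ T := le_add_self.trans hNjT.le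
      rw [ENNReal.div_le_iff hΛb0 hΛbt] at this
      refine this.trans_eq ?_
      rw [ENNReal.mul_rpow_of_nonneg _ _ hb0.le, ← ENNReal.rpow_mul, one_div_mul_cancel hb0.ne',
        ENNReal.rpow_one, mul_comm]
    · have : NV j ρ / V ^ κ ≤ T := le_self_add.trans hNjT.le
      rw [ENNReal.div_le_iff hVκ0 hVκt] at this
      refine this.trans_eq ?_
      rw [ENNReal.mul_rpow_of_nonneg _ _ hκ0.le, ← ENNReal.rpow_mul, one_div_mul_cancel hκ0.ne',
        ENNReal.rpow_one, mul_comm]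
  have hfreq : ∃ᶠ j in atTop,
      ∫⁻ y in Ω, ∫⁻ t, g (t, ρ • e + ι y) * f j (t, ρ • e + ι y) ^ (2 : ℝ) ≤ Bd := by
    have h1 : ∃ᶠ j in atTop, Nj j ρ < T := frequently_lt_of_liminf_lt (by isBoundedDefault) hNT
    have h2 : ∀ᶠ j in atTop, (φ j).rOut < τ₂ - τa - R :=
      hφ0.eventually_lt_const (by linarith)
    exact (h1.and_eventually h2).mono fun j hj => hstep j hj.2 hj.1
  have hgm' : ∀ j, Measurable fun q : ℝ × Vec n =>
      g (q.1, ρ • e + ι q.2) * f j (q.1, ρ • e + ι q.2) ^ (2 : ℝ) := fun j =>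
    (hg.comp hsm).mul (((hfm j).comp hsm).pow_const _)
  calc _ ≤ ∫⁻ y in Ω, ∫⁻ t, liminf (fun j =>
        g (t, ρ • e + ι y) * f j (t, ρ • e + ι y) ^ (2 : ℝ)) atTop := by
        refine lintegral_mono_ae ?_
        filter_upwards [ae_restrict_of_ae hρ, ae_restrict_mem hΩm] with y hy hyΩ
        refine lintegral_mono_ae ?_
        filter_upwards [hy] with t ht
        by_cases hzU : (t, ρ • e + ι y) ∈ U
        · have hev : ∀ᶠ j in atTop, f j (t, ρ • e + ι y) = ‖w j (t, ρ • e + ι y)‖ₑ := by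
            have hlt : 0 < min (t + τ₂ ^ 2) (τ₂ ^ 2 - t) :=
              lt_min (by linarith [hzU.1.1]) (by linarith [hzU.1.2])
            filter_upwards [hφ0.eventually_lt_const hlt] with j hj
            have hyX : ρ • e + ι y ∈ X := by
              rw [hX, mem_closedBall_zero_iff]
              have : ‖ρ • e + ι y‖ ≤ τa := hyΩ
              linarith
            refine hfmem j _ _ ⟨?_, ?_⟩ hyX
            · linarith [lt_min_iff.1 hj |>.1]
            · linarith [lt_min_iff.1 hj |>.2]
          have ht2 : Tendsto (fun j => ‖w j (t, ρ • e + ι y)‖ₑ ^ (2 : ℝ)) atTop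
              (nhds (‖W (t, ρ • e + ι y)‖ₑ ^ (2 : ℝ))) :=
            (ENNReal.continuous_rpow_const.tendsto _).comp ht.enorm
          have ht3 : Tendsto (fun j => f j (t, ρ • e + ι y) ^ (2 : ℝ)) atTop
              (nhds (‖W (t, ρ • e + ι y)‖ₑ ^ (2 : ℝ))) :=
            ht2.congr' (hev.mono fun j hj => by simp only [hj])
          exact ENNReal.mul_le_liminf_mul ht3
        · rw [hW0 _ hzU]
          simp
    _ ≤ ∫⁻ y in Ω, liminf (fun j => ∫⁻ t,
        g (t, ρ • e + ι y) * f j (t, ρ • e + ι y) ^ (2 : ℝ)) atTop := by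
        refine lintegral_mono fun y => lintegral_liminf_le fun j => ?_
        exact (hgm' j).comp (measurable_id.prodMk measurable_const)
    _ ≤ liminf (fun j => ∫⁻ y in Ω, ∫⁻ t,
        g (t, ρ • e + ι y) * f j (t, ρ • e + ι y) ^ (2 : ℝ)) atTop :=
        lintegral_liminf_le fun j => Measurable.lintegral_prod_left' (hgm' j)
    _ ≤ Bd := liminf_le_of_frequently_le hfreq (by isBoundedDefault)

theorem exists_slice_exponents {n : ℕ} (hn : 1 ≤ n) {s β A B : ℝ} (hs0 : 0 ≤ s)
    (hs : s < 2 / ((n : ℝ) + 1)) (hβ0 : 0 < β) (hβ1 : β < 1) (hB : 0 < B) (hBA : B ≤ A)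
    (hA : A ≤ 1)
    (hAB : A / (2 / n - s) + (1 / β - 1 / (2 / n - s)) * B < 1) :
    ∃ m ω l : ℝ, l < 1 ∧ SliceExponents n (2 / (s + 1)) (2 / (1 - β)) m ω ∧
      HolderExponents (2 / (1 - β)) m ω A B l := by
  have hn0 : (0 : ℝ) < n := by exact_mod_cast hn
  have hn1 : (1 : ℝ) ≤ n := by exact_mod_cast hn
  have hs1 : s < 1 := hs.trans_le (by rw [div_le_one (by linarith)]; linarith)
  have hsn : s < 2 / n := hs.trans_le (by gcongr; linarith)
  set α := 2 / (n : ℝ) - s with hα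
  have hα0 : 0 < α := by linarith
  set b := 2 / (1 - β) with hb
  have h1β : 0 < 1 - β := by linarith
  have hb2 : 2 ≤ b := by rw [hb, le_div_iff₀ h1β]; linarith
  have hb0 : 0 < b := by linarith
  have hbinv : 1 / b = (1 - β) / 2 := by rw [hb]; field_simp
  set κ := 2 / (s + 1) with hκ
  have hκinv : 1 / κ = (s + 1) / 2 := by rw [hκ]; field_simp
  have hκ1 : 1 ≤ κ := by rw [hκ, le_div_iff₀ (by linarith)]; linarith
  have hκ2 : κ ≤ 2 := by rw [hκ, div_le_iff₀ (by linarith)]; linarith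
  have hAB' : A + α / β * B - B < α := by
    have := mul_lt_mul_of_pos_right hAB hα0
    have e : (A / α + (1 / β - 1 / α) * B) * α = A + α / β * B - B := by field_simp; ring
    linarith
  have hBβ : B < β := by
    have h1 : α / β * B < α := by linarith
    rw [div_mul_eq_mul_div, div_lt_iff₀ hβ0] at h1
    exact lt_of_mul_lt_mul_left h1 hα0.le
  set l := 1 - B / β with hl
  have hl0 : 0 < l := by rw [hl, sub_pos, div_lt_one hβ0]; exact hBβ
  have hl1 : l < 1 := by rw [hl]; have := div_pos hB hβ0; linarith
  have hlβ : (1 - l) * β = B := by rw [hl]; field_simp; ring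
  have hAl : A < l * α + (1 - l) * β := by
    have : l * α = α - α / β * B := by rw [hl]; ring
    linarith
  set ms := 1 + b * (1 - 1 / κ) with hms
  have hms1 : 1 < ms := by
    rw [hms, hκinv]
    have : 0 < b * (1 - (s + 1) / 2) := mul_pos hb0 (by linarith)
    linarith
  have hl1' : 1 < 1 / l := by rw [lt_div_iff₀ hl0]; linarith
  set m := min ms (1 / l) with hm
  have hm1 : 1 < m := lt_min hms1 hl1'
  have hlm : l * m ≤ 1 := by
    calc l * m ≤ l * (1 / l) := by gcongr; exact min_le_right _ _
      _ = 1 := by field_simp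
  set θ := (m - 1) / b + 1 / κ with hθ
  have hθ1 : θ ≤ 1 := by
    have : (m - 1) / b ≤ 1 - 1 / κ := by
      rw [div_le_iff₀ hb0]
      have := min_le_left ms (1 / l)
      rw [← hm, hms] at this
      linarith
    linarith
  have hmb : 0 < (m - 1) / b := div_pos (by linarith) hb0
  have hθκ : 1 / 2 ≤ θ := by rw [hθ, hκinv]; linarith
  have htime : B + 2 * l * ((m - 1) / b + 1 / 2) + 2 * (1 - l * m) / b = 1 := by
    rw [← hlβ]
    have : β = 1 - 2 * (1 / b) := by rw [hbinv]; ring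
    rw [this]; field_simp; ring
  have hsum : 2 * l * (θ - 1 / n) + 2 * (1 - l * m) / b = l * (1 - α) + (1 - l) * (1 - β) := by
    have e1 : 2 * l * (θ - 1 / n) + 2 * (1 - l * m) / b =
        2 * l * (1 / κ - 1 / n) + (1 - l) * (2 * (1 / b)) := by rw [hθ]; ring
    rw [e1, hκinv, hbinv, hα]; ring
  by_cases hcase : θ - 1 / n < 0
  · have hn2 : n = 1 := by
      by_contra hne
      have h2 : (2 : ℝ) ≤ n := by exact_mod_cast (by omega : 2 ≤ n)
      have : 1 / (n : ℝ) ≤ 1 / 2 := by gcongr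
      linarith
    have hnc : (n : ℝ) = 1 := by exact_mod_cast hn2
    have hθlt : θ < 1 := by rw [hnc] at hcase; linarith
    have hml : m = 1 / l := by
      rcases min_choice ms (1 / l) with h | h
      · exfalso
        rw [← hm] at h
        have : θ = 1 := by rw [hθ, h, hms]; field_simp; ring
        linarith
      · exact h
    have hlm1 : l * m = 1 := by rw [hml]; field_simp
    refine ⟨m, 0, l, hl1, ⟨hκ1, hκ2, hb2, hm1, hθ1, le_rfl, by linarith, ?_⟩,
      ⟨by linarith, hB, hl0.le, hl1.le, hlm, htime, ?_⟩⟩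
    · rw [hnc]; linarith
    · rw [hlm1]; simpa using hA
  · push Not at hcase
    set σ := l * α + (1 - l) * β - A with hσ
    have hσ0 : 0 < σ := by linarith
    set t := min (1 / (n : ℝ)) (σ / 2) with ht
    have ht0 : 0 < t := lt_min (by positivity) (by linarith)
    have ht1 : t ≤ 1 / n := min_le_left _ _
    have ht2 : t ≤ σ / 2 := min_le_right _ _
    refine ⟨m, θ - 1 / n + t, l, hl1, ⟨hκ1, hκ2, hb2, hm1, hθ1, by linarith, ?_, ?_⟩,
      ⟨by linarith, hB, hl0.le, hl1.le, hlm, htime, ?_⟩⟩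
    · linarith
    · have e : (n : ℝ) * (θ - (θ - 1 / n + t)) = 1 - n * t := by field_simp; ring
      have : 0 < n * t := by positivity
      linarith
    · have h1 : 2 * l * t ≤ σ := by
        have : l * t ≤ 1 * t := mul_le_mul_of_nonneg_right hl1.le ht0.le
        linarith
      have h2 : 2 * l * (θ - 1 / n + t) = 2 * l * (θ - 1 / n) + 2 * l * t := by ring
      have h3 : l * (1 - α) + (1 - l) * (1 - β) = 1 - (l * α + (1 - l) * β) := by ring
      linarith

theorem exists_perturbed_exponents {α₁ α₂ a₁ a₃ b₃ : ℝ} (hα₂ : 0 < α₂) (hα : 0 < α₁)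
    (ha₁ : a₁ ∈ Icc (0 : ℝ) 1) (ha₃ : a₃ ∈ Icc (0 : ℝ) 1) (hb₃0 : 0 ≤ b₃) (hb₃ : b₃ ≤ a₃)
    (h₁ : a₁ < α₁) (h₃ : a₃ / α₁ + (1 + 1 / α₂ - 1 / α₁) * b₃ < 1) :
    ∃ β A₁ B₁ A₃ B₃ : ℝ, 0 < β ∧ β < 1 ∧ β * (1 + α₂) < α₂ ∧
      (0 < B₁ ∧ B₁ ≤ A₁ ∧ A₁ ≤ 1 ∧ a₁ ≤ A₁ ∧ A₁ / α₁ + (1 / β - 1 / α₁) * B₁ < 1) ∧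
      (0 < B₃ ∧ B₃ ≤ A₃ ∧ A₃ ≤ 1 ∧ a₃ ≤ A₃ ∧ b₃ ≤ B₃ ∧
        A₃ / α₁ + (1 / β - 1 / α₁) * B₃ < 1) := by
  set βs := α₂ / (1 + α₂) with hβs
  have hβs0 : 0 < βs := by positivity
  have hβs1 : βs < 1 := by rw [hβs, div_lt_one (by positivity)]; linarith
  have hβsi : 1 / βs = 1 + 1 / α₂ := by rw [hβs]; field_simp; ring
  have c1 : ContinuousAt (fun s : ℝ => max a₁ s / α₁ + (1 / (βs - s) - 1 / α₁) * s) 0 := by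
    have : ContinuousAt (fun s : ℝ => 1 / (βs - s)) 0 :=
      continuousAt_const.div (by fun_prop) (by simpa using hβs0.ne')
    fun_prop
  have c3 : ContinuousAt
      (fun s : ℝ => max a₃ s / α₁ + (1 / (βs - s) - 1 / α₁) * max b₃ s) 0 := by
    have : ContinuousAt (fun s : ℝ => 1 / (βs - s)) 0 :=
      continuousAt_const.div (by fun_prop) (by simpa using hβs0.ne')
    fun_prop
  have e1 : ∀ᶠ s in nhds (0 : ℝ), max a₁ s / α₁ + (1 / (βs - s) - 1 / α₁) * s < 1 := by
    refine c1.eventually_lt_const ?_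
    simp only [max_eq_left ha₁.1, mul_zero, add_zero]
    rwa [div_lt_one hα]
  have e3 : ∀ᶠ s in nhds (0 : ℝ),
      max a₃ s / α₁ + (1 / (βs - s) - 1 / α₁) * max b₃ s < 1 := by
    refine c3.eventually_lt_const ?_
    simp only [max_eq_left ha₃.1, max_eq_left hb₃0, sub_zero]
    rwa [hβsi]
  have e4 : ∀ᶠ s in nhds (0 : ℝ), s < βs := eventually_lt_nhds hβs0
  obtain ⟨s, ⟨h1, h3, h4⟩, hs⟩ :=
    (((e1.and (e3.and e4)).filter_mono nhdsWithin_le_nhds).and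
      (self_mem_nhdsWithin : Ioi (0 : ℝ) ∈ nhdsWithin 0 (Ioi 0))).exists
  have hs0 : 0 < s := hs
  refine ⟨βs - s, max a₁ s, s, max a₃ s, max b₃ s, by linarith, by linarith, ?_,
    ⟨hs0, le_max_right _ _, max_le ha₁.2 (by linarith), le_max_left _ _, h1⟩,
    ⟨lt_max_of_lt_right hs0, max_le_max hb₃ le_rfl, max_le ha₃.2 (by linarith), le_max_left _ _,
      le_max_left _ _, h3⟩⟩
  calc (βs - s) * (1 + α₂) < βs * (1 + α₂) := by gcongr; linarith
    _ = α₂ := by rw [hβs]; field_simp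

theorem slice_quantity_le {κ b l A : ℝ} (hκ : 1 ≤ κ) (hb : 1 ≤ b) (hl0 : 0 ≤ l) (hl1 : l ≤ 1)
    (hA1 : A ≤ 1) {T V Λ K C : ℝ≥0∞} (hT : 1 ≤ T) :
    C * (K * T ^ A) * ((V * T ^ (1 / κ)) ^ (2 * l) * (Λ * T ^ (1 / b)) ^ (2 * (1 - l)) +
      (Λ * T ^ (1 / b)) ^ (2 : ℝ)) ≤
      C * T ^ 3 * (K * (V ^ (2 * l) * Λ ^ (2 * (1 - l)) + Λ ^ (2 : ℝ))) := by
  have hle : ∀ x : ℝ, x ≤ 1 → T ^ x ≤ T := fun x hx => by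
    simpa using ENNReal.rpow_le_rpow_of_exponent_le hT hx
  have hκ' : T ^ (1 / κ) ≤ T := hle _ (by rw [div_le_one (by linarith)]; exact hκ)
  have hb' : T ^ (1 / b) ≤ T := hle _ (by rw [div_le_one (by linarith)]; exact hb)
  have h1l : 0 ≤ 2 * (1 - l) := by linarith
  have h2l : 0 ≤ 2 * l := by linarith
  have hTT : T ^ (2 * l) * T ^ (2 * (1 - l)) = T ^ (2 : ℝ) := by
    rw [← ENNReal.rpow_add_of_nonneg _ _ h2l h1l]; congr 1; ring
  calc _ ≤ C * (K * T) * ((V * T) ^ (2 * l) * (Λ * T) ^ (2 * (1 - l)) + (Λ * T) ^ (2 : ℝ)) := by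
        gcongr; exact hle A hA1
    _ = C * (K * T) * (V ^ (2 * l) * Λ ^ (2 * (1 - l)) * (T ^ (2 * l) * T ^ (2 * (1 - l))) +
          Λ ^ (2 : ℝ) * T ^ (2 : ℝ)) := by
        rw [ENNReal.mul_rpow_of_nonneg _ _ h2l, ENNReal.mul_rpow_of_nonneg _ _ h1l,
          ENNReal.mul_rpow_of_nonneg _ _ zero_le_two]
        ring
    _ = _ := by
        rw [hTT, ENNReal.rpow_two]; ring

theorem measure_inter_Ioo_ge {a c : ℝ} {S : Set ℝ} (hS : MeasurableSet S)
    (h : volume Sᶜ ≤ ENNReal.ofReal ((c - a) / 2)) :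
    ENNReal.ofReal ((c - a) / 2) ≤ volume (S ∩ Ioo a c) := by
  have h1 : volume (Ioo a c) ≤ volume (S ∩ Ioo a c) + volume Sᶜ := by
    rw [← measure_inter_add_sdiff (Ioo a c) hS, inter_comm]
    gcongr
    exact fun x hx => hx.2
  by_contra hlt
  push Not at hlt
  rcases le_or_gt c a with hca | hac
  · rw [ENNReal.ofReal_of_nonpos (by linarith)] at hlt; exact absurd hlt (by simp)
  have h2 := h1.trans_lt (ENNReal.add_lt_add_of_lt_of_le
    (ne_top_of_le_ne_top ENNReal.ofReal_ne_top h) hlt h)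
  rw [Real.volume_Ioo, ← ENNReal.ofReal_add (by linarith) (by linarith)] at h2
  simp at h2

theorem volume_level_le {G : ℝ → ℝ≥0∞} (hG : Measurable G) {I T : ℝ≥0∞} (hT0 : T ≠ 0)
    (hTt : T ≠ ⊤) (hI0 : I ≠ 0) (hIt : I ≠ ⊤) (h : ∫⁻ ρ, G ρ ≤ I) :
    volume {ρ | T * I ≤ G ρ} ≤ T⁻¹ := by
  have h1 := (mul_meas_ge_le_lintegral hG (T * I) (μ := volume)).trans h
  have h2 : I * (T * volume {ρ | T * I ≤ G ρ}) ≤ I * 1 := by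
    calc _ = T * I * volume {ρ | T * I ≤ G ρ} := by ring
      _ ≤ I * 1 := by rw [mul_one]; exact h1
  have h3 := (ENNReal.mul_le_mul_iff_right hI0 hIt).1 h2
  rw [mul_comm] at h3
  rw [← one_div]
  exact ENNReal.le_div_iff_mul_le (Or.inl hT0) (Or.inl hTt) |>.2 h3

/-- A function `W` with weak spatial gradient `D` in the cylinder of radius `τ₂`, vanishing outside
of it, with the mixed norms of `D` and `W` bounded by `V` and `Λ`. -/
structure EnergyBound (d : ℕ) (κ b τ₂ : ℝ) (W : ℝ × Vec d → ℝ) (D : ℝ × Vec d → Vec d)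
    (V Λ : ℝ≥0∞) : Prop where
  measurable_W : Measurable W
  measurable_D : Measurable D
  locallyIntegrable : LocallyIntegrable W volume
  eq_zero : ∀ z ∉ Ioo (-τ₂ ^ 2) (τ₂ ^ 2) ×ˢ Metric.ball (0 : Vec d) τ₂, W z = 0
  weakGrad : HasWeakSpatialGradOn (Ioo (-τ₂ ^ 2) (τ₂ ^ 2) ×ˢ Metric.ball (0 : Vec d) τ₂) W D
  V_ne_zero : V ≠ 0
  V_ne_top : V ≠ ⊤
  Λ_ne_zero : Λ ≠ 0
  Λ_ne_top : Λ ≠ ⊤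
  gradient_le : ∫⁻ x, (∫⁻ t, ‖D (t, x)‖ₑ ^ (2 : ℝ)) ^ (κ / 2) ≤ V ^ κ
  function_le : ∫⁻ x, ∫⁻ t, ‖W (t, x)‖ₑ ^ b ≤ Λ ^ b

/-- A weight whose mixed norm, with exponent `1/A` in space and `1/B` in time, is at most `K`. -/
structure WeightBound (d : ℕ) (A B : ℝ) (g : ℝ × Vec d → ℝ≥0∞) (K : ℝ≥0∞) : Prop where
  measurable : Measurable g
  ne_zero : K ≠ 0
  ne_top : K ≠ ⊤
  norm_le : ∫⁻ x, (∫⁻ t, g (t, x) ^ (1 / B)) ^ (B / A) ≤ K ^ (1 / A)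

/-- Exponents together with a constant for which the slice estimate holds. -/
structure SliceData (n : ℕ) (κ b m A B l : ℝ) (C : ℝ≥0∞) : Prop where
  one_lt_m : 1 < m
  A_pos : 0 < A
  A_le_one : A ≤ 1
  l_nonneg : 0 ≤ l
  l_le_one : l ≤ 1
  bound : SliceBound n κ b m A B l C

/-- The weighted spatial density `x ↦ ∫ g W² dt`. -/
noncomputable def density {d : ℕ} (g : ℝ × Vec d → ℝ≥0∞) (W : ℝ × Vec d → ℝ) (x : Vec d) : ℝ≥0∞ :=
  ∫⁻ t, g (t, x) * ‖W (t, x)‖ₑ ^ (2 : ℝ)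

theorem measurable_density {d : ℕ} {g : ℝ × Vec d → ℝ≥0∞} {W : ℝ × Vec d → ℝ} (hg : Measurable g)
    (hW : Measurable W) : Measurable (density g W) :=
  Measurable.lintegral_prod_left' (f := fun z : ℝ × Vec d => g z * ‖W z‖ₑ ^ (2 : ℝ)) (by fun_prop)

theorem lintegral_profile_eq {n : ℕ} {e : Vec (n + 1)} (he : ‖e‖ = 1)
    {ι : Vec n →ₗᵢ[ℝ] Vec (n + 1)} (hι : ∀ y, inner ℝ e (ι y) = 0)
    (hΦ : MeasurePreserving (fun p : ℝ × Vec n => p.1 • e + ι p.2) volume volume)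
    {P : Vec (n + 1) → ℝ≥0∞} (hP : Measurable P) {τ : ℝ} {q : ℝ → ℝ≥0∞} (hq : Measurable q) :
    ∫⁻ x in Metric.closedBall 0 τ, q (inner ℝ e x) * P x =
      ∫⁻ ρ, q ρ * ∫⁻ y in {y | ‖ρ • e + ι y‖ ≤ τ}, P (ρ • e + ι y) := by
  have hb : MeasurableSet (Metric.closedBall (0 : Vec (n + 1)) τ) :=
    Metric.isClosed_closedBall.measurableSet
  have hin : Measurable fun x : Vec (n + 1) => (inner ℝ e x : ℝ) :=
    (continuous_const.inner continuous_id).measurable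
  rw [← lintegral_indicator hb, ← lintegral_slices hΦ (Measurable.indicator (by fun_prop) hb)]
  congr 1; ext ρ
  have hcont : Continuous fun y : Vec n => ρ • e + ι y := continuous_const.add ι.continuous
  have hΩm : MeasurableSet {y : Vec n | ‖ρ • e + ι y‖ ≤ τ} :=
    (isClosed_le hcont.norm continuous_const).measurableSet
  have hPm : Measurable fun y => P (ρ • e + ι y) := hP.comp hcont.measurable
  rw [← lintegral_indicator hΩm, ← lintegral_const_mul _ (hPm.indicator hΩm)]
  congr 1; ext y
  have hinner : inner ℝ e (ρ • e + ι y) = ρ := by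
    rw [inner_add_right, hι, inner_smul_right, real_inner_self_eq_norm_sq, he]; simp
  by_cases hy : ‖ρ • e + ι y‖ ≤ τ
  · rw [indicator_of_mem (show y ∈ {y : Vec n | ‖ρ • e + ι y‖ ≤ τ} from hy),
      indicator_of_mem (mem_closedBall_zero_iff.2 hy), hinner]
  · rw [indicator_of_notMem (show y ∉ {y : Vec n | ‖ρ • e + ι y‖ ≤ τ} from hy),
      indicator_of_notMem (fun h => hy (mem_closedBall_zero_iff.1 h)), mul_zero]

theorem exists_direction_profile {n : ℕ} {κ b τ₁ τ₂ : ℝ} (hκ : 1 ≤ κ) (hb : 1 ≤ b) (h1 : 1 ≤ τ₁)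
    (h12 : τ₁ < τ₂) (h2 : τ₂ ≤ 2) {W : ℝ × Vec (n + 1) → ℝ} {D : ℝ × Vec (n + 1) → Vec (n + 1)}
    {V Λ : ℝ≥0∞} (hE : EnergyBound (n + 1) κ b τ₂ W D V Λ) {m₁ A₁ B₁ l₁ m₂ A₂ B₂ l₂ : ℝ}
    {C₁ C₂ K₁ K₂ : ℝ≥0∞} (hS₁ : SliceData n κ b m₁ A₁ B₁ l₁ C₁)
    (hS₂ : SliceData n κ b m₂ A₂ B₂ l₂ C₂) {g₁ g₂ : ℝ × Vec (n + 1) → ℝ≥0∞}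
    (hG₁ : WeightBound (n + 1) A₁ B₁ g₁ K₁) (hG₂ : WeightBound (n + 1) A₂ B₂ g₂ K₂)
    (hi₁ : ∫⁻ x, density g₁ W x ≠ ⊤) (hi₂ : ∫⁻ x, density g₂ W x ≠ ⊤)
    {e : Vec (n + 1)} (he : ‖e‖ = 1) {err : ℝ≥0∞} (herr : err ≠ 0) :
    ∃ ψ : ℝ → ℝ, ContDiff ℝ 1 ψ ∧ (∀ ρ, ψ ρ ∈ Icc (0 : ℝ) 1) ∧ (∀ ρ ≤ τ₁, ψ ρ = 1) ∧
      (∀ ρ, τ₁ + (τ₂ - τ₁) / 2 ≤ ρ → ψ ρ = 0) ∧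
      ∫⁻ x in Metric.closedBall 0 (τ₁ + 3 / 4 * (τ₂ - τ₁)),
          ‖deriv ψ (inner ℝ e x)‖ₑ ^ 2 * density g₁ W x ≤
        (8 * ENNReal.ofReal (τ₂ - τ₁)⁻¹) ^ 2 *
          (C₁ * (8 * ENNReal.ofReal (τ₂ - τ₁)⁻¹) ^ (2 * n) *
            (32 * ENNReal.ofReal (τ₂ - τ₁)⁻¹) ^ 3 *
            (K₁ * (V ^ (2 * l₁) * Λ ^ (2 * (1 - l₁)) + Λ ^ (2 : ℝ))) + err) ∧
      ∫⁻ x in Metric.closedBall 0 (τ₁ + 3 / 4 * (τ₂ - τ₁)),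
          ‖deriv ψ (inner ℝ e x)‖ₑ * density g₂ W x ≤
        (8 * ENNReal.ofReal (τ₂ - τ₁)⁻¹) ^ 2 *
          (C₂ * (8 * ENNReal.ofReal (τ₂ - τ₁)⁻¹) ^ (2 * n) *
            (32 * ENNReal.ofReal (τ₂ - τ₁)⁻¹) ^ 3 *
            (K₂ * (V ^ (2 * l₂) * Λ ^ (2 * (1 - l₂)) + Λ ^ (2 : ℝ))) + err) := by
  set δ := τ₂ - τ₁ with hδ
  have hδ0 : 0 < δ := sub_pos.2 h12
  have hδ1 : δ ≤ 1 := by linarith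
  set X := ENNReal.ofReal δ⁻¹ with hX
  have hX1 : 1 ≤ X := by simpa [hX] using (one_le_inv₀ hδ0).2 hδ1
  have hX0 : X ≠ 0 := (zero_lt_one.trans_le hX1).ne'
  have hXt : X ≠ ⊤ := ENNReal.ofReal_ne_top
  set T' := 16 * X with hT'
  have hT'0 : T' ≠ 0 := mul_ne_zero (by simp) hX0
  have hT't : T' ≠ ⊤ := ENNReal.mul_ne_top (by simp) hXt
  set T := 32 * X with hT
  have hTt : T ≠ ⊤ := ENNReal.mul_ne_top (by simp) hXt
  have hT2 : T = T' * 2 := by rw [hT, hT']; ring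
  have hT1 : 1 ≤ T := by
    calc (1 : ℝ≥0∞) = 1 * 1 := (mul_one _).symm
      _ ≤ 32 * X := mul_le_mul' (by norm_num) hX1
  obtain ⟨ι, hι, hΦ⟩ := exists_slice_coordinates e he
  set τa := τ₁ + 3 / 4 * δ with hτa
  obtain ⟨N, hNm, hN2, hN⟩ := exists_slice_gauge (τa := τa) (R := δ / 8) hκ hb (by positivity)
    (by linarith) (by rw [hτa]; linarith) (by linarith) h2 hE.measurable_W hE.measurable_D
    hE.locallyIntegrable hE.eq_zero hE.weakGrad hE.V_ne_zero hE.V_ne_top hE.Λ_ne_zero hE.Λ_ne_top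
    hE.gradient_le hE.function_le hι hΦ
  have hRX : ENNReal.ofReal ((δ / 8) ^ (-(2 * n : ℝ))) = (8 * X) ^ (2 * n) := by
    rw [Real.rpow_neg (by positivity), ← Real.inv_rpow (by positivity)]
    have : (2 * n : ℝ) = ((2 * n : ℕ) : ℝ) := by push_cast; ring
    rw [this, Real.rpow_natCast, ENNReal.ofReal_pow (by positivity), hX]
    congr 1
    rw [inv_div, div_eq_mul_inv, ENNReal.ofReal_mul (by norm_num)]
    norm_num
  have hWm := hE.measurable_W
  let h : (ℝ × Vec (n + 1) → ℝ≥0∞) → ℝ → ℝ≥0∞ := fun g ρ =>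
    ∫⁻ y in {y | ‖ρ • e + ι y‖ ≤ τa}, density g W (ρ • e + ι y)
  have hΦm := hΦ.measurable
  have hhm : ∀ g, Measurable g → Measurable (h g) := by
    intro g hg
    have hset : MeasurableSet {p : ℝ × Vec n | ‖p.1 • e + ι p.2‖ ≤ τa} :=
      measurableSet_le hΦm.norm measurable_const
    have := (((measurable_density hg hWm).comp hΦm).indicator hset).lintegral_prod_right'
      (ν := (volume : Measure (Vec n)))
    have heq : h g = fun ρ => ∫⁻ y, ({p : ℝ × Vec n | ‖p.1 • e + ι p.2‖ ≤ τa}.indicator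
        (density g W ∘ fun p : ℝ × Vec n => p.1 • e + ι p.2)) (ρ, y) := by
      ext ρ
      change ∫⁻ y in {y | ‖ρ • e + ι y‖ ≤ τa}, _ = _
      have hcont : Continuous fun y : Vec n => ρ • e + ι y := continuous_const.add ι.continuous
      rw [← lintegral_indicator (isClosed_le hcont.norm continuous_const).measurableSet]
      rfl
    rw [heq]
    exact this
  have hhi : ∀ g, Measurable g → ∫⁻ ρ, h g ρ ≤ ∫⁻ x, density g W x := by
    intro g hg
    have := lintegral_profile_eq he hι hΦ (measurable_density hg hWm) (τ := τa)
      (q := fun _ => 1) measurable_const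
    simp only [one_mul] at this
    rw [← this]
    exact setLIntegral_le_lintegral _ _
  let G : ℝ → ℝ → (ℝ × Vec (n + 1) → ℝ≥0∞) → ℝ → ℝ≥0∞ := fun A B g ρ =>
    ∫⁻ y, (∫⁻ t, g (t, ρ • e + ι y) ^ (1 / B)) ^ (B / A)
  have hGF : ∀ (A B : ℝ) (g : ℝ × Vec (n + 1) → ℝ≥0∞), Measurable g →
      Measurable fun x => (∫⁻ t, g (t, x) ^ (1 / B)) ^ (B / A) := fun A B g hg =>
    (Measurable.lintegral_prod_left' (f := fun z : ℝ × Vec (n + 1) => g z ^ (1 / B))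
      (hg.pow_const _)).pow_const _
  have hGm : ∀ A B g, Measurable g → Measurable (G A B g) := fun A B g hg =>
    Measurable.lintegral_prod_right' ((hGF A B g hg).comp hΦm)
  have hGi : ∀ A B g, Measurable g → ∫⁻ ρ, G A B g ρ =
      ∫⁻ x, (∫⁻ t, g (t, x) ^ (1 / B)) ^ (B / A) := fun A B g hg =>
    lintegral_slices hΦ (hGF A B g hg)
  have hlev : ∀ {m A B l : ℝ} {C K : ℝ≥0∞} {g : ℝ × Vec (n + 1) → ℝ≥0∞},
      SliceData n κ b m A B l C → WeightBound (n + 1) A B g K →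
      volume {ρ | T' * K ^ (1 / A) ≤ G A B g ρ} ≤ T'⁻¹ := by
    intro m A B l C K g hS hG
    refine volume_level_le (hGm A B g hG.measurable) hT'0 hT't ?_ ?_
      ((hGi A B g hG.measurable).trans_le hG.norm_le)
    · simp [hG.ne_zero, hG.ne_top]
    · exact ENNReal.rpow_ne_top_of_nonneg (one_div_nonneg.2 hS.A_pos.le) hG.ne_top
  have hbd : ∀ {m A B l : ℝ} {C K : ℝ≥0∞} {g : ℝ × Vec (n + 1) → ℝ≥0∞},
      SliceData n κ b m A B l C → WeightBound (n + 1) A B g K →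
      ∀ᵐ ρ, N ρ < T → G A B g ρ < T' * K ^ (1 / A) → h g ρ ≤ C * (8 * X) ^ (2 * n) * T ^ 3 *
        (K * (V ^ (2 * l) * Λ ^ (2 * (1 - l)) + Λ ^ (2 : ℝ))) := by
    intro m A B l C K g hS hG
    filter_upwards [hN] with ρ hρ hNρ hGρ
    have hA := hS.A_pos
    have := hρ T hTt hNρ m A B l C hS.one_lt_m hS.bound g (K * T ^ A) hG.measurable (by
      refine hGρ.le.trans ?_
      rw [ENNReal.mul_rpow_of_nonneg _ _ (by positivity), ← ENNReal.rpow_mul,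
        mul_one_div_cancel hA.ne', ENNReal.rpow_one, mul_comm]
      gcongr
      rw [hT2]
      exact le_mul_of_one_le_right' (by norm_num))
    refine this.trans ?_
    rw [hRX]
    exact slice_quantity_le hκ hb hS.l_nonneg hS.l_le_one hS.A_le_one hT1
  obtain ⟨E, hEsub, hEm, hE0⟩ := exists_measurable_superset_of_null
    (ae_iff.1 ((hbd hS₁ hG₁).and (hbd hS₂ hG₂)))
  set S : Set ℝ := ({ρ | T ≤ N ρ} ∪ {ρ | T' * K₁ ^ (1 / A₁) ≤ G A₁ B₁ g₁ ρ} ∪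
    {ρ | T' * K₂ ^ (1 / A₂) ≤ G A₂ B₂ g₂ ρ} ∪ E)ᶜ with hSdef
  have hSm : MeasurableSet S :=
    ((((measurableSet_le measurable_const hNm).union
      (measurableSet_le measurable_const (hGm _ _ _ hG₁.measurable))).union
      (measurableSet_le measurable_const (hGm _ _ _ hG₂.measurable))).union hEm).compl
  have hNlev : volume {ρ | T ≤ N ρ} ≤ T'⁻¹ := by
    rw [hT2]
    exact volume_level_le hNm hT'0 hT't (by simp) (by simp) hN2
  have hSv : volume Sᶜ ≤ ENNReal.ofReal ((τ₁ + δ / 2 - τ₁) / 2) := by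
    rw [hSdef, compl_compl]
    calc _ ≤ T'⁻¹ + T'⁻¹ + T'⁻¹ + 0 := by
          refine (measure_union_le _ _).trans (add_le_add ((measure_union_le _ _).trans
            (add_le_add ((measure_union_le _ _).trans (add_le_add hNlev ?_)) ?_)) hE0.le)
          · exact hlev hS₁ hG₁
          · exact hlev hS₂ hG₂
      _ = 3 * T'⁻¹ := by ring
      _ = ENNReal.ofReal (3 * (δ / 16)) := by
          rw [ENNReal.ofReal_mul (by norm_num), hT', hX, ← ENNReal.ofReal_ofNat 16,
            ← ENNReal.ofReal_mul (by norm_num), ← ENNReal.ofReal_inv_of_pos (by positivity)]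
          congr 1
          · norm_num
          · congr 1; field_simp
      _ ≤ _ := ENNReal.ofReal_le_ofReal (by linarith)
  have hSpt : ∀ ρ ∈ S, N ρ < T ∧ G A₁ B₁ g₁ ρ < T' * K₁ ^ (1 / A₁) ∧
      G A₂ B₂ g₂ ρ < T' * K₂ ^ (1 / A₂) ∧ ρ ∉ E := by
    intro ρ hρ
    simp only [hSdef, mem_compl_iff, mem_union, mem_ofPred_eq, not_or, not_le] at hρ
    exact ⟨hρ.1.1.1, hρ.1.1.2, hρ.1.2, hρ.2⟩
  have hgood : ∀ ρ ∉ E, _ := fun ρ hρ => not_not.1 fun hn => hρ (hEsub hn)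
  obtain ⟨ψ, hψ, hψI, hψ1, hψ0, -, hb1, hb2⟩ := exists_profile (a := τ₁) (c := τ₁ + δ / 2)
    (by linarith) hSm (measure_inter_Ioo_ge hSm hSv) (hhm g₁ hG₁.measurable)
    (hhm g₂ hG₂.measurable)
    (ne_top_of_le_ne_top hi₁ ((setLIntegral_le_lintegral _ _).trans (hhi g₁ hG₁.measurable)))
    (ne_top_of_le_ne_top hi₂ ((setLIntegral_le_lintegral _ _).trans (hhi g₂ hG₂.measurable)))
    (fun ρ hρ => (hgood ρ (hSpt ρ hρ).2.2.2).1 (hSpt ρ hρ).1 (hSpt ρ hρ).2.1)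
    (fun ρ hρ => (hgood ρ (hSpt ρ hρ).2.2.2).2 (hSpt ρ hρ).1 (hSpt ρ hρ).2.2.1) herr
  have hψdm : Measurable fun ρ => ‖deriv ψ ρ‖ₑ := (measurable_deriv ψ).enorm
  have h8 : ENNReal.ofReal (4 / (τ₁ + δ / 2 - τ₁)) = 8 * X := by
    rw [hX, ← ENNReal.ofReal_ofNat 8, ← ENNReal.ofReal_mul (by norm_num)]
    congr 1; rw [add_sub_cancel_left]; field_simp; norm_num
  have h8X : 1 ≤ 8 * X := by
    calc (1 : ℝ≥0∞) = 1 * 1 := (mul_one _).symm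
      _ ≤ 8 * X := mul_le_mul' (by norm_num) hX1
  have hLle : ENNReal.ofReal (τ₁ + δ / 2 - τ₁) ≤ 1 := ENNReal.ofReal_le_one.2 (by linarith)
  rw [h8] at hb1 hb2
  refine ⟨ψ, hψ, hψI, hψ1, hψ0, ?_, ?_⟩
  · rw [lintegral_profile_eq he hι hΦ (measurable_density hG₁.measurable hWm)
      (q := fun ρ => ‖deriv ψ ρ‖ₑ ^ 2) (hψdm.pow_const _)]
    refine hb1.trans ?_
    exact mul_le_mul' le_rfl (add_le_add (mul_le_of_le_one_right' hLle) le_rfl)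
  · rw [lintegral_profile_eq he hι hΦ (measurable_density hG₂.measurable hWm)
      (q := fun ρ => ‖deriv ψ ρ‖ₑ) hψdm]
    refine hb2.trans ?_
    refine mul_le_mul' ?_ (add_le_add (mul_le_of_le_one_right' hLle) le_rfl)
    rw [pow_two]
    exact le_mul_of_one_le_right' h8X

theorem gradLen_mul_le {d : ℕ} {ηt : ℝ → ℝ} {ηx : Vec d → ℝ} {η : ℝ × Vec d → ℝ}
    (hη : ∀ z, η z = ηt z.1 * ηx z.2) (ht : ∀ t, ηt t ∈ Icc (0 : ℝ) 1) (hx : ContDiff ℝ 1 ηx)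
    (z : ℝ × Vec d) : ‖gradLen η z‖ₑ ≤ ‖fderiv ℝ ηx z.2‖ₑ := by
  have h : gradLen η z = ‖ηt z.1 • fderiv ℝ ηx z.2‖ := by
    have hf : (fun y : Vec d => η (z.1, y)) = fun y => ηt z.1 * ηx y := by
      ext y; rw [hη]
    rw [gradLen, hf, gradient, LinearIsometryEquiv.norm_map,
      fderiv_const_mul (hx.differentiable one_ne_zero).differentiableAt]
  rw [h, enorm_norm, enorm_smul]
  refine mul_le_of_le_one_left' ?_
  rw [Real.enorm_eq_ofReal (ht _).1]
  exact ENNReal.ofReal_le_one.2 (ht _).2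

theorem lintegral_weight_le {d : ℕ} {g : ℝ × Vec d → ℝ≥0∞} {W : ℝ × Vec d → ℝ} (hg : Measurable g)
    (hW : Measurable W) {τ : ℝ} {q : Vec d → ℝ≥0∞} (hq : Measurable q) {L : ℝ × Vec d → ℝ≥0∞}
    (hL : ∀ z, L z ≤ (Metric.closedBall 0 τ).indicator q z.2) :
    ∫⁻ t, ∫⁻ x, g (t, x) * ‖W (t, x)‖ₑ ^ (2 : ℝ) * L (t, x) ≤
      ∫⁻ x in Metric.closedBall 0 τ, q x * density g W x := by
  have hb : MeasurableSet (Metric.closedBall (0 : Vec d) τ) :=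
    Metric.isClosed_closedBall.measurableSet
  have hqm := hq.indicator hb
  have hgW : Measurable fun z : ℝ × Vec d => g z * ‖W z‖ₑ ^ (2 : ℝ) := by fun_prop
  calc ∫⁻ t, ∫⁻ x, g (t, x) * ‖W (t, x)‖ₑ ^ (2 : ℝ) * L (t, x)
      ≤ ∫⁻ t, ∫⁻ x, g (t, x) * ‖W (t, x)‖ₑ ^ (2 : ℝ) * (Metric.closedBall 0 τ).indicator q x := by
        gcongr with t x
        exact hL (t, x)
    _ = ∫⁻ x, ∫⁻ t, g (t, x) * ‖W (t, x)‖ₑ ^ (2 : ℝ) * (Metric.closedBall 0 τ).indicator q x :=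
        lintegral_lintegral_swap (hgW.mul (hqm.comp measurable_snd)).aemeasurable
    _ = ∫⁻ x, (Metric.closedBall 0 τ).indicator (fun x => q x * density g W x) x := by
        congr 1; ext x
        have hgx : Measurable fun t => g (t, x) * ‖W (t, x)‖ₑ ^ (2 : ℝ) :=
          hgW.comp (by fun_prop : Measurable fun t : ℝ => (t, x))
        rw [lintegral_mul_const _ hgx]
        by_cases hx : x ∈ Metric.closedBall (0 : Vec d) τ
        · rw [indicator_of_mem hx, indicator_of_mem hx, mul_comm]; rfl
        · rw [indicator_of_notMem hx, indicator_of_notMem hx, mul_zero]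
    _ = _ := lintegral_indicator hb _

theorem exists_cutoff (n : ℕ) : ∃ Cc : ℝ≥0∞, Cc ≠ ⊤ ∧ ∀ {κ b τ₁ τ₂ : ℝ}, 1 ≤ κ → 1 ≤ b → 1 ≤ τ₁ →
    τ₁ < τ₂ → τ₂ ≤ 2 → ∀ {W : ℝ × Vec (n + 1) → ℝ} {D : ℝ × Vec (n + 1) → Vec (n + 1)}
    {V Λ : ℝ≥0∞}, EnergyBound (n + 1) κ b τ₂ W D V Λ → ∀ {m₁ A₁ B₁ l₁ m₂ A₂ B₂ l₂ : ℝ}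
    {C₁ C₂ K₁ K₂ : ℝ≥0∞}, SliceData n κ b m₁ A₁ B₁ l₁ C₁ → SliceData n κ b m₂ A₂ B₂ l₂ C₂ →
    ∀ {g₁ g₂ : ℝ × Vec (n + 1) → ℝ≥0∞}, WeightBound (n + 1) A₁ B₁ g₁ K₁ →
    WeightBound (n + 1) A₂ B₂ g₂ K₂ → ∫⁻ x, density g₁ W x ≠ ⊤ → ∫⁻ x, density g₂ W x ≠ ⊤ →
    ∀ {err : ℝ≥0∞}, err ≠ 0 → ∃ η ∈ cutoffClass (n + 1) τ₁ τ₂,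
      (∫⁻ t, ∫⁻ x, g₁ (t, x) * ‖W (t, x)‖ₑ ^ (2 : ℝ) * ‖gradLen η (t, x)‖ₑ ^ 2) +
        (∫⁻ t, ∫⁻ x, g₂ (t, x) * ‖W (t, x)‖ₑ ^ (2 : ℝ) * ‖gradLen η (t, x)‖ₑ) ≤
      Cc * ENNReal.ofReal (τ₂ - τ₁)⁻¹ ^ (4 * n + 7) *
        (C₁ * (K₁ * (V ^ (2 * l₁) * Λ ^ (2 * (1 - l₁)) + Λ ^ (2 : ℝ))) +
          C₂ * (K₂ * (V ^ (2 * l₂) * Λ ^ (2 * (1 - l₂)) + Λ ^ (2 : ℝ)))) + err := by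
  refine ⟨(35 * (n + 1 : ℕ)) ^ (2 * (n + 1)) * 8 ^ (2 * n + 2) * 32 ^ 3, ?_, ?_⟩
  · exact ENNReal.mul_ne_top (ENNReal.mul_ne_top (ENNReal.pow_ne_top
      (ENNReal.mul_ne_top (by simp) (ENNReal.natCast_ne_top _))) (by simp)) (by simp)
  intro κ b τ₁ τ₂ hκ hb h1 h12 h2 W D V Λ hE m₁ A₁ B₁ l₁ m₂ A₂ B₂ l₂ C₁ C₂ K₁ K₂ hS₁ hS₂ g₁ g₂
    hG₁ hG₂ hi₁ hi₂ err herr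
  set δ := τ₂ - τ₁ with hδ
  have hδ0 : 0 < δ := sub_pos.2 h12
  have hδ1 : δ ≤ 1 := by linarith
  set X := ENNReal.ofReal δ⁻¹ with hX
  have hX1 : 1 ≤ X := by simpa [hX] using (one_le_inv₀ hδ0).2 hδ1
  have hX0 : X ≠ 0 := (zero_lt_one.trans_le hX1).ne'
  have hXt : X ≠ ⊤ := ENNReal.ofReal_ne_top
  have hd : (0 : ℝ) < ((n + 1 : ℕ) : ℝ) := by positivity
  have hd1 : (1 : ℝ) ≤ ((n + 1 : ℕ) : ℝ) := by norm_cast; omega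
  set M : ℕ := ⌈16 * ((n + 1 : ℕ) : ℝ) / δ⌉₊ with hM
  have hM1 : 16 * ((n + 1 : ℕ) : ℝ) / δ ≤ M := Nat.le_ceil _
  have hM2 : (M : ℝ) ≤ 16 * ((n + 1 : ℕ) : ℝ) / δ + 1 := (Nat.ceil_lt_add_one (by positivity)).le
  have hdδ : ((n + 1 : ℕ) : ℝ) ≤ ((n + 1 : ℕ) : ℝ) / δ := le_div_self hd.le hδ0 hδ1
  have hMd : n + 1 < M := by
    have : ((n + 1 : ℕ) : ℝ) < M := by
      refine lt_of_lt_of_le ?_ hM1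
      rw [mul_div_assoc]; linarith
    exact_mod_cast this
  have hM0 : (0 : ℝ) < M := by exact_mod_cast (Nat.zero_lt_of_lt hMd)
  obtain ⟨e, he, hnet⟩ := exists_direction_net (Nat.succ_pos n) hMd
  set τa := τ₁ + 3 / 4 * δ with hτa
  have hnet' : ∀ x : Vec (n + 1), τa ≤ ‖x‖ → ∃ k, τ₁ + δ / 2 ≤ inner ℝ (e k) x := by
    intro x hx
    obtain ⟨k, hk⟩ := hnet x
    refine ⟨k, le_trans ?_ hk⟩
    have hq : 2 * ((n + 1 : ℕ) : ℝ) / M ≤ δ / 8 := by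
      rw [div_le_iff₀ hδ0] at hM1
      rw [div_le_iff₀ hM0]
      linarith
    have hq1 : 0 ≤ 1 - 2 * ((n + 1 : ℕ) : ℝ) / M := by linarith
    calc τ₁ + δ / 2 ≤ (1 - δ / 8) * τa := by rw [hτa]; nlinarith
      _ ≤ (1 - 2 * ((n + 1 : ℕ) : ℝ) / M) * τa := by
          refine mul_le_mul_of_nonneg_right (by linarith) (by rw [hτa]; linarith)
      _ ≤ _ := mul_le_mul_of_nonneg_left hx hq1
  set N : ℝ≥0∞ := ((Fintype.card (Fin (n + 1) → Fin (2 * M + 1)) : ℕ) : ℝ≥0∞) with hN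
  have hN1 : 1 ≤ N := by
    rw [hN]
    exact_mod_cast Fintype.card_pos
  have hNt : N ≠ ⊤ := ENNReal.natCast_ne_top _
  have hNle : N ≤ (35 * (n + 1 : ℕ) * X) ^ (n + 1) := by
    rw [hN, Fintype.card_fun, Fintype.card_fin, Fintype.card_fin, Nat.cast_pow]
    refine pow_le_pow_left' ?_ _
    rw [← ENNReal.ofReal_natCast, ← ENNReal.ofReal_natCast, hX, ← ENNReal.ofReal_ofNat 35,
      ← ENNReal.ofReal_mul (by norm_num), ← ENNReal.ofReal_mul (by positivity)]
    refine ENNReal.ofReal_le_ofReal ?_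
    rw [← div_eq_mul_inv, mul_div_assoc]
    rw [mul_div_assoc] at hM2
    push_cast at *
    linarith
  set F : ℝ≥0∞ := N * N * (8 * X) ^ 2 * 2 with hF
  have hF0 : F ≠ 0 := by
    refine mul_ne_zero (mul_ne_zero (mul_ne_zero ?_ ?_) ?_) (by simp)
    · exact (zero_lt_one.trans_le hN1).ne'
    · exact (zero_lt_one.trans_le hN1).ne'
    · exact pow_ne_zero _ (mul_ne_zero (by simp) hX0)
  have hFt : F ≠ ⊤ := ENNReal.mul_ne_top (ENNReal.mul_ne_top (ENNReal.mul_ne_top hNt hNt)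
    (ENNReal.pow_ne_top (ENNReal.mul_ne_top (by simp) hXt))) (by simp)
  have herr' : err / F ≠ 0 := ENNReal.div_ne_zero.2 ⟨herr, hFt⟩
  choose ψ hψ hψI hψ1 hψ0 hψb1 hψb2 using fun k =>
    exists_direction_profile hκ hb h1 h12 h2 hE hS₁ hS₂ hG₁ hG₂ hi₁ hi₂ (he k) herr'
  obtain ⟨ηt, ht, htI, hts, ht1, htd⟩ := exists_time_cutoff h1 h12
  obtain ⟨ηx, hx, hxI, hxc, hxs, hx1, hxd, hxz⟩ := exists_polytope_cutoff he
    (by rw [hτa]; linarith : τa < τ₂) hnet' hψ hψI hψ1 hψ0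
  have hWm := hE.measurable_W
  have hin : ∀ k, Measurable fun x : Vec (n + 1) => ‖deriv (ψ k) (inner ℝ (e k) x)‖ₑ := fun k =>
    (measurable_deriv (ψ k)).enorm.comp (continuous_const.inner continuous_id).measurable
  have hgrad : ∀ z, ‖gradLen (fun z : ℝ × Vec (n + 1) => ηt z.1 * ηx z.2) z‖ₑ ≤
      (Metric.closedBall 0 τa).indicator (fun x => ∑ k, ‖deriv (ψ k) (inner ℝ (e k) x)‖ₑ) z.2 := by
    intro z
    refine (gradLen_mul_le (fun _ => rfl) htI hx z).trans ?_
    by_cases hz : z.2 ∈ Metric.closedBall (0 : Vec (n + 1)) τa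
    · rw [indicator_of_mem hz, ← ofReal_norm]
      refine (ENNReal.ofReal_le_ofReal (hxd z.2)).trans ?_
      rw [ENNReal.ofReal_sum_of_nonneg fun _ _ => abs_nonneg _]
      simp [Real.enorm_eq_ofReal_abs]
    · rw [hxz z.2 (by simpa using hz), ← ofReal_norm, norm_zero, ENNReal.ofReal_zero]
      exact zero_le
  set Z₁ := C₁ * (8 * X) ^ (2 * n) * (32 * X) ^ 3 *
    (K₁ * (V ^ (2 * l₁) * Λ ^ (2 * (1 - l₁)) + Λ ^ (2 : ℝ))) with hZ₁
  set Z₂ := C₂ * (8 * X) ^ (2 * n) * (32 * X) ^ 3 *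
    (K₂ * (V ^ (2 * l₂) * Λ ^ (2 * (1 - l₂)) + Λ ^ (2 : ℝ))) with hZ₂
  refine ⟨fun z => ηt z.1 * ηx z.2,
    ⟨ηt, ηx, fun _ => rfl, ht, htI, hts, ht1, htd, hx, hxI, hxc, hxs, hx1⟩, ?_⟩
  have hfirst : ∫⁻ t, ∫⁻ x, g₁ (t, x) * ‖W (t, x)‖ₑ ^ (2 : ℝ) *
      ‖gradLen (fun z : ℝ × Vec (n + 1) => ηt z.1 * ηx z.2) (t, x)‖ₑ ^ 2 ≤
      N * N * ((8 * X) ^ 2 * (Z₁ + err / F)) := by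
    refine (lintegral_weight_le (L := fun z => ‖gradLen (fun z : ℝ × Vec (n + 1) =>
      ηt z.1 * ηx z.2) z‖ₑ ^ 2) hG₁.measurable hWm (τ := τa)
      (q := fun x => N * ∑ k, ‖deriv (ψ k) (inner ℝ (e k) x)‖ₑ ^ 2)
      ((Finset.measurable_fun_sum _ fun k _ => (hin k).pow_const _).const_mul _) ?_).trans ?_
    · intro z
      refine (pow_le_pow_left' (hgrad z) 2).trans ?_
      by_cases hz : z.2 ∈ Metric.closedBall (0 : Vec (n + 1)) τa
      · rw [indicator_of_mem hz, indicator_of_mem hz]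
        have := ENNReal.rpow_sum_le_const_mul_sum_rpow Finset.univ
          (fun k => ‖deriv (ψ k) (inner ℝ (e k) z.2)‖ₑ) (p := 2) (by norm_num)
        norm_num at this
        simpa [hN] using this
      · rw [indicator_of_notMem hz, indicator_of_notMem hz]; simp
    · simp_rw [mul_assoc N, Finset.sum_mul]
      have hm : ∀ k ∈ (Finset.univ : Finset (Fin (n + 1) → Fin (2 * M + 1))),
          Measurable fun x : Vec (n + 1) =>
            ‖deriv (ψ k) (inner ℝ (e k) x)‖ₑ ^ 2 * density g₁ W x := fun k _ =>
        ((hin k).pow_const _).mul (measurable_density hG₁.measurable hWm)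
      rw [lintegral_const_mul _ (Finset.measurable_fun_sum _ hm), lintegral_finsetSum _ hm]
      refine mul_le_mul' le_rfl ((Finset.sum_le_sum fun k _ => hψb1 k).trans ?_)
      rw [Finset.sum_const, Finset.card_univ, nsmul_eq_mul]
  have hsecond : ∫⁻ t, ∫⁻ x, g₂ (t, x) * ‖W (t, x)‖ₑ ^ (2 : ℝ) *
      ‖gradLen (fun z : ℝ × Vec (n + 1) => ηt z.1 * ηx z.2) (t, x)‖ₑ ≤
      N * N * ((8 * X) ^ 2 * (Z₂ + err / F)) := by
    refine (lintegral_weight_le hG₂.measurable hWm (Finset.measurable_fun_sum _ fun k _ => hin k)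
      hgrad).trans ?_
    simp_rw [Finset.sum_mul]
    have hm : ∀ k ∈ (Finset.univ : Finset (Fin (n + 1) → Fin (2 * M + 1))),
        Measurable fun x : Vec (n + 1) =>
          ‖deriv (ψ k) (inner ℝ (e k) x)‖ₑ * density g₂ W x := fun k _ =>
      (hin k).mul (measurable_density hG₂.measurable hWm)
    rw [lintegral_finsetSum _ hm]
    refine (Finset.sum_le_sum fun k _ => hψb2 k).trans ?_
    rw [Finset.sum_const, Finset.card_univ, nsmul_eq_mul]
    exact mul_le_mul' (le_mul_of_one_le_left' hN1) le_rfl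
  refine (add_le_add hfirst hsecond).trans ?_
  calc N * N * ((8 * X) ^ 2 * (Z₁ + err / F)) + N * N * ((8 * X) ^ 2 * (Z₂ + err / F))
      = N * N * (8 * X) ^ 2 * (Z₁ + Z₂) + F * (err / F) := by rw [hF]; ring
    _ ≤ (35 * (n + 1 : ℕ) * X) ^ (n + 1) * (35 * (n + 1 : ℕ) * X) ^ (n + 1) * (8 * X) ^ 2 *
        (Z₁ + Z₂) + err := by
        rw [ENNReal.mul_div_cancel hF0 hFt]
        gcongr
    _ = _ := by
        rw [hZ₁, hZ₂]; ring

theorem ae_ae_swap {d : ℕ} {p : ℝ × Vec d → Prop} (h : ∀ᵐ z, p z) :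
    ∀ᵐ x : Vec d, ∀ᵐ t : ℝ, p (t, x) := by
  have hs : ∀ᵐ z ∂((volume : Measure (Vec d)).prod (volume : Measure ℝ)), p z.swap :=
    Measure.measurePreserving_swap.quasiMeasurePreserving.ae h
  exact Measure.ae_ae_of_ae_prod hs

theorem normTX_congr {d : ℕ} {F : Type*} [NormedAddCommGroup F] {q p : ℝ≥0∞}
    {f f' : ℝ × Vec d → F} (h : f =ᵐ[volume] f') : normTX q p f = normTX q p f' :=
  eLpNorm_congr_ae ((Measure.ae_ae_of_ae_prod (p := fun z => f z = f' z) h).mono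
    fun _ ht => eLpNorm_congr_ae ht)

theorem normXT_congr {d : ℕ} {F : Type*} [NormedAddCommGroup F] {q p : ℝ≥0∞}
    {f f' : ℝ × Vec d → F} (h : f =ᵐ[volume] f') : normXT q p f = normXT q p f' :=
  eLpNorm_congr_ae ((ae_ae_swap (p := fun z => f z = f' z) h).mono
    fun _ ht => eLpNorm_congr_ae ht)

theorem eLpNorm_rpow_eq_lintegral {α E : Type*} [MeasurableSpace α] {μ : Measure α} [ENorm E]
    {p : ℝ} (hp : 0 < p) (f : α → E) :
    eLpNorm f (ENNReal.ofReal p) μ ^ p = ∫⁻ x, ‖f x‖ₑ ^ p ∂μ := by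
  rw [eLpNorm_eq_lintegral_rpow_enorm_toReal (by simpa using hp) ENNReal.ofReal_ne_top,
    ENNReal.toReal_ofReal hp.le, ← ENNReal.rpow_mul, one_div_mul_cancel hp.ne', ENNReal.rpow_one]

theorem normXT_rpow_eq_lintegral {d : ℕ} {F : Type*} [NormedAddCommGroup F] {p q : ℝ} (hp : 0 < p)
    (hq : 0 < q) (f : ℝ × Vec d → F) :
    normXT (ENNReal.ofReal p) (ENNReal.ofReal q) f ^ p =
      ∫⁻ x, (∫⁻ t, ‖f (t, x)‖ₑ ^ q) ^ (p / q) := by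
  rw [normXT, eLpNorm_rpow_eq_lintegral hp]
  congr 1; ext x
  rw [enorm_eq_self, ← eLpNorm_rpow_eq_lintegral hq, ← ENNReal.rpow_mul,
    mul_div_cancel₀ _ hq.ne']

theorem normTX_rpow_eq_lintegral {d : ℕ} {F : Type*} [NormedAddCommGroup F] {p : ℝ} (hp : 0 < p)
    (f : ℝ × Vec d → F) :
    normTX (ENNReal.ofReal p) (ENNReal.ofReal p) f ^ p = ∫⁻ t, ∫⁻ x, ‖f (t, x)‖ₑ ^ p := by
  rw [normTX, eLpNorm_rpow_eq_lintegral hp]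
  congr 1; ext x
  rw [enorm_eq_self, ← eLpNorm_rpow_eq_lintegral hp]

theorem normTX_one_one {d : ℕ} (f : ℝ × Vec d → ℝ) :
    normTX 1 1 f = ∫⁻ t, ∫⁻ x, ‖f (t, x)‖ₑ := by
  simp [normTX, eLpNorm_one_eq_lintegral_enorm]

theorem ofReal_one_div_le {q : ℝ≥0∞} (hq0 : q ≠ 0) {B : ℝ} (hB : 0 < B) (h : recip q ≤ B) :
    ENNReal.ofReal (1 / B) ≤ q := by
  rw [one_div, ENNReal.ofReal_inv_of_pos hB, ENNReal.inv_le_iff_inv_le]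
  exact (ENNReal.le_ofReal_iff_toReal_le (ENNReal.inv_ne_top.2 hq0) hB.le).2 h

theorem eLpNorm_le_of_support_subset {α E : Type*} [MeasurableSpace α] {μ : Measure α}
    [TopologicalSpace E] [ENormedAddMonoid E] {f : α → E} (hf : AEStronglyMeasurable f μ)
    {S : Set α} (hS : Function.support f ⊆ S) {q : ℝ≥0∞} (hq0 : q ≠ 0) {B : ℝ} (hB : 0 < B)
    (h : recip q ≤ B) :
    eLpNorm f (ENNReal.ofReal (1 / B)) μ ≤ eLpNorm f q μ * μ S ^ (B - recip q) := by
  have := eLpNorm_le_eLpNorm_mul_rpow_measure_univ (μ := μ.restrict S)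
    (ofReal_one_div_le hq0 hB h) hf.restrict
  rw [eLpNorm_restrict_eq_of_support_subset hS, eLpNorm_restrict_eq_of_support_subset hS,
    ENNReal.toReal_ofReal (by positivity), one_div_one_div, Measure.restrict_apply_univ] at this
  rwa [recip, ENNReal.toReal_inv, ← one_div]

theorem normXT_le_of_eq_zero {d : ℕ} {f : ℝ × Vec d → ℝ} (hf : Measurable f)
    (h0 : ∀ z ∉ Icc (-4 : ℝ) 4 ×ˢ Metric.ball (0 : Vec d) 2, f z = 0) {p q : ℝ≥0∞} (hp0 : p ≠ 0)
    (hq0 : q ≠ 0) {A B : ℝ} (hA : 0 < A) (hB : 0 < B) (hp : recip p ≤ A) (hq : recip q ≤ B) :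
    normXT (ENNReal.ofReal (1 / A)) (ENNReal.ofReal (1 / B)) f ≤
      volume (Icc (-4 : ℝ) 4) ^ (B - recip q) *
        volume (Metric.ball (0 : Vec d) 2) ^ (A - recip p) * normXT p q f := by
  set c := volume (Icc (-4 : ℝ) 4) ^ (B - recip q) with hc
  have hct : c ≠ ⊤ := ENNReal.rpow_ne_top_of_nonneg (sub_nonneg.2 hq) (by simp)
  have hin : ∀ x, eLpNorm (fun t => f (t, x)) (ENNReal.ofReal (1 / B)) volume ≤
      c * eLpNorm (fun t => f (t, x)) q volume := by
    intro x
    rw [mul_comm]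
    refine eLpNorm_le_of_support_subset ?_ ?_ hq0 hB hq
    · exact (hf.comp (by fun_prop : Measurable fun t : ℝ => (t, x))).aestronglyMeasurable
    · intro t ht
      by_contra hn
      exact ht (h0 _ fun h => hn h.1)
  have hmeas : Measurable fun x => eLpNorm (fun t => f (t, x)) (ENNReal.ofReal (1 / B)) volume := by
    have hB' : (0 : ℝ) < 1 / B := by positivity
    simp_rw [eLpNorm_eq_lintegral_rpow_enorm_toReal (p := ENNReal.ofReal (1 / B))
      (by simpa using hB) ENNReal.ofReal_ne_top]
    refine Measurable.pow_const ?_ _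
    exact Measurable.lintegral_prod_left' (f := fun z : ℝ × Vec d =>
      ‖f z‖ₑ ^ (ENNReal.ofReal (1 / B)).toReal) (by fun_prop)
  calc normXT (ENNReal.ofReal (1 / A)) (ENNReal.ofReal (1 / B)) f
      ≤ eLpNorm (fun x => eLpNorm (fun t => f (t, x)) (ENNReal.ofReal (1 / B)) volume) p volume *
          volume (Metric.ball (0 : Vec d) 2) ^ (A - recip p) := by
        refine eLpNorm_le_of_support_subset hmeas.aestronglyMeasurable ?_ hp0 hA hp
        intro x hx
        by_contra hn
        refine hx ?_
        have : (fun t => f (t, x)) = 0 := by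
          ext t
          exact h0 _ fun h => hn h.2
        simp only [this]
        exact eLpNorm_zero
    _ ≤ (c * normXT p q f) * volume (Metric.ball (0 : Vec d) 2) ^ (A - recip p) := by
        gcongr
        rw [normXT]
        obtain ⟨c', hc'⟩ : ∃ c' : ℝ≥0, (c' : ℝ≥0∞) = c := ⟨c.toNNReal, ENNReal.coe_toNNReal hct⟩
        rw [← hc'] at hin ⊢
        refine eLpNorm_le_nnreal_smul_eLpNorm_of_ae_le_mul' (c := c') ?_ p
        exact Eventually.of_forall fun x => by simpa using hin x
    _ = _ := by ring

theorem interior_cyl (d : ℕ) (r : ℝ) :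
    interior (cyl d r) = Ioo (-r ^ 2) (r ^ 2) ×ˢ Metric.ball 0 r := by
  rw [cyl, interior_prod_eq, interior_Icc, Metric.isOpen_ball.interior_eq]

theorem interior_cyl_ae_eq (d : ℕ) (r : ℝ) :
    (interior (cyl d r) : Set (ℝ × Vec d)) =ᵐ[volume] cyl d r := by
  rw [interior_cyl, cyl]
  exact Measure.set_prod_ae_eq Ioo_ae_eq_Icc (EventuallyEq.refl _ _)

theorem measurableSet_cyl (d : ℕ) (r : ℝ) : MeasurableSet (cyl d r) :=
  measurableSet_Icc.prod Metric.isOpen_ball.measurableSet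

/-- A measurable function vanishing off the open cylinder that represents `f` on the cylinder. -/
theorem exists_measurable_representative {d : ℕ} {F : Type*} [NormedAddCommGroup F]
    [MeasurableSpace F] [BorelSpace F] {f : ℝ × Vec d → F} {r : ℝ}
    (hf : AEStronglyMeasurable f (volume.restrict (interior (cyl d r)))) :
    ∃ f' : ℝ × Vec d → F, Measurable f' ∧ (∀ z ∉ interior (cyl d r), f' z = 0) ∧
      (cyl d r).indicator f =ᵐ[volume] f' := by
  have hU : MeasurableSet (interior (cyl d r)) := isOpen_interior.measurableSet
  refine ⟨(interior (cyl d r)).indicator (hf.mk f), ?_, fun z hz => indicator_of_notMem hz _, ?_⟩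
  · exact hf.stronglyMeasurable_mk.measurable.indicator hU
  · refine (indicator_ae_eq_of_ae_eq_set (interior_cyl_ae_eq d r)).symm.trans ?_
    have := (ae_restrict_iff' hU).1 hf.ae_eq_mk
    filter_upwards [this] with z hz
    by_cases h : z ∈ interior (cyl d r)
    · rw [indicator_of_mem h, indicator_of_mem h, hz h]
    · rw [indicator_of_notMem h, indicator_of_notMem h]

theorem exists_weight {d : ℕ} {p q : ℝ≥0∞} (hp0 : p ≠ 0) (hq0 : q ≠ 0) {A B : ℝ} (hA : 0 < A)
    (hB : 0 < B) (hp : recip p ≤ A) (hq : recip q ≤ B) (K : ℝ≥0) :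
    ∃ K' : ℝ≥0∞, K' ≠ ⊤ ∧ ∀ {r : ℝ}, 0 ≤ r → r ≤ 2 → ∀ {g : ℝ × Vec d → ℝ},
      LocallyIntegrable g volume → normXT p q ((cyl d r).indicator g) ≤ K →
      ∃ g' : ℝ × Vec d → ℝ, Measurable g' ∧ (cyl d r).indicator g =ᵐ[volume] g' ∧
        WeightBound d A B (fun z => ‖g' z‖ₑ) K' := by
  set c := volume (Icc (-4 : ℝ) 4) ^ (B - recip q) *
        volume (Metric.ball (0 : Vec d) 2) ^ (A - recip p) with hc
  have hct : c ≠ ⊤ := ENNReal.mul_ne_top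
    (ENNReal.rpow_ne_top_of_nonneg (sub_nonneg.2 hq) (by simp))
    (ENNReal.rpow_ne_top_of_nonneg (sub_nonneg.2 hp) measure_ball_lt_top.ne)
  have hK : c * K + 1 ≠ ⊤ :=
    ENNReal.add_ne_top.2 ⟨ENNReal.mul_ne_top hct ENNReal.coe_ne_top, by simp⟩
  refine ⟨c * K + 1, hK, fun {r} hr0 hr {g} hg hgK => ?_⟩
  obtain ⟨g', hg'm, hg'0, hg'⟩ := exists_measurable_representative (r := r)
    hg.aestronglyMeasurable.restrict
  refine ⟨g', hg'm, hg', hg'm.enorm, by simp, hK, ?_⟩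
  have := normXT_rpow_eq_lintegral (p := 1 / A) (q := 1 / B) (by positivity) (by positivity) g'
  rw [show 1 / A / (1 / B) = B / A by field_simp] at this
  rw [← this]
  refine ENNReal.rpow_le_rpow ?_ (by positivity)
  refine (normXT_le_of_eq_zero hg'm (fun z hz => hg'0 z fun h => hz ?_) hp0 hq0 hA hB hp hq).trans ?_
  · rw [interior_cyl] at h
    have hr2 : r ^ 2 ≤ 4 := by nlinarith
    exact ⟨⟨by linarith [h.1.1], by linarith [h.1.2]⟩, Metric.ball_subset_ball hr h.2⟩
  · rw [← normXT_congr hg']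
    exact (mul_le_mul' le_rfl hgK).trans le_self_add

theorem exists_energy {d : ℕ} {κ b r : ℝ} (hκ : 0 < κ) (hb : 0 < b)
    {w : ℝ × Vec d → ℝ} {Dw : ℝ × Vec d → Vec d}
    (hw : HasWeakSpatialGradOn (interior (cyl d r)) w Dw) {M : ℝ}
    (hM : ∀ᵐ z ∂(volume.restrict (cyl d r)), |w z| ≤ M) {V Λ : ℝ≥0∞} (hV0 : V ≠ 0)
    (hVt : V ≠ ⊤) (hΛ0 : Λ ≠ 0) (hΛt : Λ ≠ ⊤) (hV : normV κ (cyl d r) w Dw ≤ V)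
    (hΛ : normTX (ENNReal.ofReal b) (ENNReal.ofReal b) ((cyl d r).indicator w) ≤ Λ) :
    ∃ (W : ℝ × Vec d → ℝ) (D : ℝ × Vec d → Vec d), (cyl d r).indicator w =ᵐ[volume] W ∧
      (∀ᵐ z, |W z| ≤ max M 0) ∧ EnergyBound d κ b r W D V Λ := by
  obtain ⟨W, hWm, hW0, hW⟩ := exists_measurable_representative hw.1.aestronglyMeasurable
  obtain ⟨D, hDm, hD0, hD⟩ := exists_measurable_representative hw.2.1.aestronglyMeasurable
  have hU : MeasurableSet (interior (cyl d r)) := isOpen_interior.measurableSet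
  have hfin : volume (interior (cyl d r)) ≠ ⊤ := by
    rw [interior_cyl, Measure.volume_eq_prod, Measure.prod_prod]
    exact ENNReal.mul_ne_top (by simp) measure_ball_lt_top.ne
  have hbd : ∀ᵐ z, |W z| ≤ max M 0 := by
    filter_upwards [hW, (ae_restrict_iff' (measurableSet_cyl d r)).1 hM] with z h1 h2
    rw [← h1]
    by_cases hz : z ∈ cyl d r
    · rw [indicator_of_mem hz]; exact (h2 hz).trans (le_max_left _ _)
    · rw [indicator_of_notMem hz, abs_zero]; exact le_max_right _ _
  have hon : ∀ {F : Type} [NormedAddCommGroup F] {f f' : ℝ × Vec d → F},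
      (cyl d r).indicator f =ᵐ[volume] f' →
      f =ᵐ[volume.restrict (interior (cyl d r))] f' := by
    intro F _ f f' h
    refine (ae_restrict_iff' hU).2 (h.mono fun z hz hzU => ?_)
    rw [← hz, indicator_of_mem (interior_subset hzU)]
  refine ⟨W, D, hW, hbd, hWm, hDm, ?_, ?_, ?_, hV0, hVt, hΛ0, hΛt, ?_, ?_⟩
  · have h1 : IntegrableOn W (interior (cyl d r)) volume :=
      Measure.integrableOn_of_bounded hfin hWm.aestronglyMeasurable (M := max M 0)
        (ae_restrict_of_ae hbd)
    exact (integrableOn_iff_integrable_of_support_subset fun z hz => by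
      by_contra hn; exact hz (hW0 z hn)).1 h1 |>.locallyIntegrable
  · rw [← interior_cyl]; exact hW0
  · rw [← interior_cyl]
    exact hw.congr hU (hon hW) (hon hD)
  · have := normXT_rpow_eq_lintegral (q := 2) hκ two_pos D
    rw [← this]
    refine ENNReal.rpow_le_rpow ?_ hκ.le
    rw [← normXT_congr hD]
    refine le_trans ?_ hV
    rw [normV, ENNReal.ofReal_ofNat]
    exact le_add_self
  · have hswap : ∫⁻ x, ∫⁻ t, ‖W (t, x)‖ₑ ^ b = ∫⁻ t, ∫⁻ x, ‖W (t, x)‖ₑ ^ b :=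
      (lintegral_lintegral_swap (f := fun t x => ‖W (t, x)‖ₑ ^ b)
        (hWm.enorm.pow_const _).aemeasurable).symm
    rw [hswap, ← normTX_rpow_eq_lintegral hb, ← normTX_congr hW]
    exact ENNReal.rpow_le_rpow hΛ hb.le

theorem lintegral_density_ne_top {d : ℕ} {r M : ℝ} {g g' W : ℝ × Vec d → ℝ}
    (hg : LocallyIntegrable g volume) (hg' : (cyl d r).indicator g =ᵐ[volume] g')
    (hg'm : Measurable g') (hW : Measurable W) (hM : ∀ᵐ z, |W z| ≤ M) :
    ∫⁻ x, density (fun z => ‖g' z‖ₑ) W x ≠ ⊤ := by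
  have hIntg : Integrable g' volume := by
    refine Integrable.congr ?_ hg'
    refine (integrable_indicator_iff (measurableSet_cyl d r)).2 ?_
    refine (hg.integrableOn_isCompact (isCompact_Icc.prod
      (isCompact_closedBall (0 : Vec d) r))).mono_set (t := Icc (-r ^ 2) (r ^ 2) ×ˢ
        Metric.closedBall 0 r) ?_
    exact prod_mono le_rfl Metric.ball_subset_closedBall
  have hm : Measurable fun z : ℝ × Vec d => ‖g' z‖ₑ * ‖W z‖ₑ ^ (2 : ℝ) := by fun_prop
  have heq : ∫⁻ x, density (fun z => ‖g' z‖ₑ) W x = ∫⁻ z, ‖g' z‖ₑ * ‖W z‖ₑ ^ (2 : ℝ) :=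
    (lintegral_prod_symm' _ hm).symm
  rw [heq]
  refine ne_top_of_le_ne_top (b := ∫⁻ z, ‖g' z‖ₑ * ENNReal.ofReal M ^ (2 : ℝ)) ?_ ?_
  · rw [lintegral_mul_const _ hg'm.enorm]
    exact ENNReal.mul_ne_top hIntg.2.ne (ENNReal.rpow_ne_top_of_nonneg two_pos.le
      ENNReal.ofReal_ne_top)
  · refine lintegral_mono_ae (hM.mono fun z hz => ?_)
    gcongr
    rw [Real.enorm_eq_ofReal_abs]
    exact ENNReal.ofReal_le_ofReal hz

theorem gradLen_eq_zero_of_notMem {d : ℕ} {τ₁ τ₂ : ℝ} {η : ℝ × Vec d → ℝ}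
    (hη : η ∈ cutoffClass d τ₁ τ₂) {z : ℝ × Vec d} (hz : z ∉ cyl d τ₂) : gradLen η z = 0 := by
  obtain ⟨ηt, ηx, hprod, -, htI, hts, -, -, hx, -, -, hxs, -⟩ := hη
  rw [cyl, mem_prod, not_and_or] at hz
  rcases hz with hz | hz
  · have h0 : ηt z.1 = 0 := image_eq_zero_of_notMem_tsupport fun h => hz (hts h)
    have hf : (fun y : Vec d => η (z.1, y)) = fun _ => 0 := by
      ext y; rw [hprod]; simp [h0]
    rw [gradLen, hf, gradient_fun_const, norm_zero]
  · have h0 : fderiv ℝ ηx z.2 = 0 :=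
      image_eq_zero_of_notMem_tsupport fun h => hz (hxs (tsupport_fderiv_subset ℝ h))
    have := gradLen_mul_le hprod htI hx z
    rw [h0, ← ofReal_norm (0 : Vec d →L[ℝ] ℝ), norm_zero, ENNReal.ofReal_zero] at this
    simpa using this

theorem normTX_weight_eq {d : ℕ} {τ₁ τ₂ : ℝ} {η g g' w W : ℝ × Vec d → ℝ}
    (hη : η ∈ cutoffClass d τ₁ τ₂) (hg : (cyl d τ₂).indicator g =ᵐ[volume] g')
    (hW : (cyl d τ₂).indicator w =ᵐ[volume] W) {j : ℕ} (hj : j ≠ 0) :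
    normTX 1 1 (fun z => g z * w z ^ 2 * gradLen η z ^ j) =
      ∫⁻ t, ∫⁻ x, ‖g' (t, x)‖ₑ * ‖W (t, x)‖ₑ ^ (2 : ℝ) * ‖gradLen η (t, x)‖ₑ ^ j := by
  have : (fun z => g z * w z ^ 2 * gradLen η z ^ j) =ᵐ[volume]
      fun z => g' z * W z ^ 2 * gradLen η z ^ j := by
    filter_upwards [hg, hW] with z h1 h2
    by_cases hz : z ∈ cyl d τ₂
    · rw [← h1, ← h2, indicator_of_mem hz, indicator_of_mem hz]
    · simp [gradLen_eq_zero_of_notMem hη hz, hj]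
  rw [normTX_congr this, normTX_one_one]
  simp [enorm_mul, enorm_pow]

theorem mul_rpow_mul_rpow_le {l : ℝ} (hl0 : 0 ≤ l) (hl1 : l < 1) {ε P V Λ : ℝ≥0∞} (hε0 : ε ≠ 0)
    (hεt : ε ≠ ⊤) :
    P * (V ^ (2 * l) * Λ ^ (2 * (1 - l))) ≤
      ε * V ^ 2 + ε ^ (-(l / (1 - l))) * P ^ (1 / (1 - l)) * Λ ^ 2 := by
  have h1 : 0 < 1 - l := by linarith
  set b := ε ^ (-(l / (1 - l))) * P ^ (1 / (1 - l)) * Λ ^ 2 with hb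
  have hbl : b ^ (1 - l) = ε ^ (-l) * P * Λ ^ (2 * (1 - l)) := by
    rw [hb, ENNReal.mul_rpow_of_nonneg _ _ h1.le, ENNReal.mul_rpow_of_nonneg _ _ h1.le,
      ← ENNReal.rpow_mul, ← ENNReal.rpow_mul, one_div_mul_cancel h1.ne', ENNReal.rpow_one,
      neg_mul, div_mul_cancel₀ _ h1.ne', ← ENNReal.rpow_natCast, ← ENNReal.rpow_mul]
    norm_num
  have hal : (ε * V ^ 2) ^ l = ε ^ l * V ^ (2 * l) := by
    rw [ENNReal.mul_rpow_of_nonneg _ _ hl0, ← ENNReal.rpow_natCast, ← ENNReal.rpow_mul]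
    norm_num
  have hcancel : ε ^ l * ε ^ (-l) = 1 := by
    rw [← ENNReal.rpow_add _ _ hε0 hεt]; simp
  calc P * (V ^ (2 * l) * Λ ^ (2 * (1 - l)))
      = (ε ^ l * ε ^ (-l)) * (P * (V ^ (2 * l) * Λ ^ (2 * (1 - l)))) := by rw [hcancel, one_mul]
    _ = (ε * V ^ 2) ^ l * b ^ (1 - l) := by rw [hbl, hal]; ring
    _ ≤ (ε * V ^ 2 + b) ^ l * (ε * V ^ 2 + b) ^ (1 - l) :=
        mul_le_mul' (ENNReal.rpow_le_rpow le_self_add hl0) (ENNReal.rpow_le_rpow le_add_self h1.le)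
    _ = ε * V ^ 2 + b := by
        rw [← ENNReal.rpow_add_of_nonneg _ _ hl0 h1.le, add_sub_cancel, ENNReal.rpow_one]

/-- Absorption of the interpolated terms, with a power of `δ⁻¹` independent of the constants. -/
theorem exists_absorption (k : ℕ) {ε : ℝ} (hε : 0 < ε) {l : ℝ} (hl0 : 0 ≤ l) (hl1 : l < 1) :
    ∃ γ₀ : ℝ, ∀ γ, γ₀ ≤ γ → ∀ P : ℝ≥0∞, P ≠ ⊤ → ∃ C : ℝ≥0∞, C ≠ ⊤ ∧
      ∀ X : ℝ≥0∞, 1 ≤ X → ∀ V Λ : ℝ≥0∞,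
        X ^ k * (P * (V ^ (2 * l) * Λ ^ (2 * (1 - l)) + Λ ^ (2 : ℝ))) ≤
          ENNReal.ofReal ε * V ^ 2 + C * X ^ γ * Λ ^ 2 := by
  have h1 : 0 < 1 - l := by linarith
  have hε0 : ENNReal.ofReal ε ≠ 0 := by simpa using hε
  refine ⟨k / (1 - l), fun γ hγ P hP => ⟨ENNReal.ofReal ε ^ (-(l / (1 - l))) * P ^ (1 / (1 - l)) + P,
    ?_, fun X hX V Λ => ?_⟩⟩
  · refine ENNReal.add_ne_top.2 ⟨ENNReal.mul_ne_top ?_ ?_, hP⟩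
    · exact ENNReal.rpow_ne_top_of_ne_zero hε0 ENNReal.ofReal_ne_top
    · exact ENNReal.rpow_ne_top_of_nonneg (by positivity) hP
  have hk : (k : ℝ) ≤ k / (1 - l) := le_div_self (Nat.cast_nonneg k) h1 (by linarith)
  have h2 : X ^ k * P * Λ ^ (2 : ℝ) ≤ P * X ^ γ * Λ ^ 2 := by
    rw [mul_comm (X ^ k), ← ENNReal.rpow_natCast X, ENNReal.rpow_two]
    gcongr
    exact hk.trans hγ
  have h3 := mul_rpow_mul_rpow_le (P := X ^ k * P) (V := V) (Λ := Λ) hl0 hl1 hε0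
    ENNReal.ofReal_ne_top
  have h4 : (X ^ k * P) ^ (1 / (1 - l)) ≤ P ^ (1 / (1 - l)) * X ^ γ := by
    rw [ENNReal.mul_rpow_of_nonneg _ _ (by positivity), mul_comm, ← ENNReal.rpow_natCast,
      ← ENNReal.rpow_mul, mul_one_div]
    gcongr
  calc X ^ k * (P * (V ^ (2 * l) * Λ ^ (2 * (1 - l)) + Λ ^ (2 : ℝ)))
      = X ^ k * P * (V ^ (2 * l) * Λ ^ (2 * (1 - l))) + X ^ k * P * Λ ^ (2 : ℝ) := by ring
    _ ≤ (ENNReal.ofReal ε * V ^ 2 + ENNReal.ofReal ε ^ (-(l / (1 - l))) *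
          (P ^ (1 / (1 - l)) * X ^ γ) * Λ ^ 2) + P * X ^ γ * Λ ^ 2 :=
        add_le_add (h3.trans (by gcongr)) h2
    _ = _ := by ring

/-- The estimate for a fixed pair of bounds passes to the infimum of the bounds. -/
theorem le_of_forall_gt_bounds {I V Λ c₁ c₂ : ℝ≥0∞} (hV : V ≠ ⊤) (hc₁ : c₁ ≠ ⊤) (hc₂0 : c₂ ≠ 0)
    (hc₂ : c₂ ≠ ⊤)
    (h : ∀ V' Λ' : ℝ≥0∞, V < V' → Λ < Λ' → V' ≠ ⊤ → Λ' ≠ ⊤ → I ≤ c₁ * V' ^ 2 + c₂ * Λ' ^ 2) :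
    I ≤ c₁ * V ^ 2 + c₂ * Λ ^ 2 := by
  rcases eq_or_ne Λ ⊤ with rfl | hΛ
  · simp [ENNReal.mul_top hc₂0]
  have hlim : Tendsto (fun a : ℝ≥0∞ => c₁ * (V + a) ^ 2 + c₂ * (Λ + a) ^ 2) (nhdsWithin 0 (Ioi 0))
      (nhds (c₁ * V ^ 2 + c₂ * Λ ^ 2)) := by
    have hadd : ∀ y : ℝ≥0∞, Tendsto (fun a : ℝ≥0∞ => y + a) (nhdsWithin 0 (Ioi 0)) (nhds y) := by
      intro y
      have : Tendsto (fun a : ℝ≥0∞ => y + a) (nhds 0) (nhds (y + 0)) :=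
        (continuous_const.add continuous_id).tendsto 0
      rw [add_zero] at this
      exact this.mono_left nhdsWithin_le_nhds
    refine (ENNReal.Tendsto.const_mul ?_ (Or.inr hc₁)).add
      (ENNReal.Tendsto.const_mul ?_ (Or.inr hc₂))
    · exact ENNReal.Tendsto.pow (hadd V)
    · exact ENNReal.Tendsto.pow (hadd Λ)
  refine ge_of_tendsto hlim ?_
  have hlt : ∀ᶠ a : ℝ≥0∞ in nhdsWithin 0 (Ioi 0), a < 1 :=
    mem_nhdsWithin_of_mem_nhds (Iio_mem_nhds zero_lt_one)
  filter_upwards [self_mem_nhdsWithin, hlt] with a ha ha1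
  have hat : a ≠ ⊤ := (ha1.trans ENNReal.one_lt_top).ne
  exact h _ _ (ENNReal.lt_add_right hV (ne_of_gt ha)) (ENNReal.lt_add_right hΛ (ne_of_gt ha))
    (ENNReal.add_ne_top.2 ⟨hV, hat⟩) (ENNReal.add_ne_top.2 ⟨hΛ, hat⟩)

theorem exponent_conditions {n : ℕ} (hn : 1 ≤ n) {s a₁ a₃ b₃ : ℝ} (hs : s < 2 / ((n : ℝ) + 1))
    (h₁ : s + a₁ < 2 / n)
    (h₃ : (n : ℝ) * (1 - (n : ℝ) / 2 * s)⁻¹ * a₃ + (2 + (1 - (n : ℝ) / 2 * s)⁻¹ + ((n : ℝ) + 1) *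
      ((1 - ((n : ℝ) + 1) / 2 * s)⁻¹ - (1 - (n : ℝ) / 2 * s)⁻¹)) * b₃ < 2) :
    0 < 2 / (n : ℝ) - s ∧ 0 < 2 / ((n : ℝ) + 1) - s ∧ a₁ < 2 / n - s ∧
      a₃ / (2 / n - s) + (1 + 1 / (2 / ((n : ℝ) + 1) - s) - 1 / (2 / n - s)) * b₃ < 1 := by
  have hn0 : (0 : ℝ) < n := by exact_mod_cast hn
  have hlt : 2 / ((n : ℝ) + 1) < 2 / n := div_lt_div_of_pos_left two_pos hn0 (by linarith)
  have hα₁ : 0 < 2 / (n : ℝ) - s := by linarith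
  have hα₂ : 0 < 2 / ((n : ℝ) + 1) - s := by linarith
  refine ⟨hα₁, hα₂, by linarith, ?_⟩
  have e1 : (1 - (n : ℝ) / 2 * s)⁻¹ = 2 / n * (1 / (2 / n - s)) := by
    rw [show 1 - (n : ℝ) / 2 * s = n / 2 * (2 / n - s) by field_simp, mul_inv, inv_div, one_div]
  have e2 : (1 - ((n : ℝ) + 1) / 2 * s)⁻¹ = 2 / (n + 1) * (1 / (2 / (n + 1) - s)) := by
    rw [show 1 - ((n : ℝ) + 1) / 2 * s = (n + 1) / 2 * (2 / (n + 1) - s) by field_simp, mul_inv,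
      inv_div, one_div]
  rw [e1, e2] at h₃
  set u := 1 / (2 / (n : ℝ) - s)
  set v := 1 / (2 / ((n : ℝ) + 1) - s)
  have e3 : (n : ℝ) * (2 / n * u) * a₃ + (2 + 2 / n * u + ((n : ℝ) + 1) *
      (2 / (n + 1) * v - 2 / n * u)) * b₃ = 2 * (u * a₃ + (1 + v - u) * b₃) := by
    field_simp; ring
  rw [e3] at h₃
  have e4 : a₃ / (2 / (n : ℝ) - s) = u * a₃ := by rw [div_eq_mul_one_div, mul_comm]
  rw [e4]; linarith

theorem recip_lt_of_lt {d : ℕ} (hd : 1 ≤ d) {p : ℝ≥0∞} (hp : (d : ℝ≥0∞) / 2 < p) :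
    recip p < 2 / (d : ℝ) := by
  have hd0 : (d : ℝ≥0∞) ≠ 0 := by simp; omega
  have h := ENNReal.inv_lt_inv.2 hp
  rw [ENNReal.inv_div (by simp) (by simp)] at h
  have h2 := (ENNReal.toReal_lt_toReal h.ne_top (ENNReal.div_ne_top (by simp) hd0)).2 h
  simpa [recip, ENNReal.toReal_div] using h2

theorem recip_mem_Icc {p : ℝ≥0∞} (hp : 1 ≤ p) : recip p ∈ Icc (0 : ℝ) 1 := by
  refine ⟨ENNReal.toReal_nonneg, ?_⟩
  exact ENNReal.toReal_le_of_le_ofReal zero_le_one (by simpa using hp)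

theorem recip_anti {p q : ℝ≥0∞} (hp : 1 ≤ p) (hpq : p ≤ q) : recip q ≤ recip p :=
  ENNReal.toReal_mono (ENNReal.inv_ne_top.2 (zero_lt_one.trans_le hp).ne')
    (ENNReal.inv_le_inv.2 hpq)

theorem variational_estimate
    (d : ℕ) (hd : 2 ≤ d)
    (p0 p1 p3 q3 : ℝ≥0∞)
    (hp0 : (d : ℝ≥0∞) / 2 < p0) (hp1 : 1 ≤ p1)
    (hp01 : recip p0 + recip p1 < 2 / ((d : ℝ) - 1))
    (hp3 : 1 ≤ p3) (hp3q3 : p3 ≤ q3)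
    (hq3 : ((d : ℝ) - 1) * theta1 d p0 * recip p3
      + (2 + theta1 d p0 + (d : ℝ) * (theta2 d p0 - theta1 d p0)) * recip q3 < 2)
    (ε : ℝ) (hε : ε ∈ Ioo (0 : ℝ) 1) :
    ∃ r s : ℝ, (r, s) ∈ scrI d (kappa p0) ∧ ∃ γ : ℝ, 0 < γ ∧
    ∀ K₁ K₂ : ℝ≥0, ∃ Cε : ℝ, 0 < Cε ∧
    ∀ τ₁ τ₂ : ℝ, 1 ≤ τ₁ → τ₁ < τ₂ → τ₂ ≤ 2 →
    ∀ g₁ g₂ : ℝ × Vec d → ℝ,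
      MemLocXT p1 ⊤ g₁ → MemLocXT p3 q3 g₂ →
      normXT p1 ⊤ ((cyl d τ₂).indicator g₁) ≤ K₁ →
      normXT p3 q3 ((cyl d τ₂).indicator g₂) ≤ K₂ →
    ∀ (w : ℝ × Vec d → ℝ) (Dw : ℝ × Vec d → Vec d),
      HasWeakSpatialGradOn (interior (cyl d τ₂)) w Dw →
      (∃ M : ℝ, ∀ᵐ z ∂(volume.restrict (cyl d τ₂)), |w z| ≤ M) →
      normV (kappa p0) (cyl d τ₂) w Dw < ⊤ →
      (⨅ η ∈ cutoffClass d τ₁ τ₂,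
          (normTX 1 1 (fun z => g₁ z * w z ^ 2 * gradLen η z ^ 2)
            + normTX 1 1 (fun z => g₂ z * w z ^ 2 * gradLen η z)))
        ≤ ENNReal.ofReal ε * normV (kappa p0) (cyl d τ₂) w Dw ^ 2
          + ENNReal.ofReal (Cε * (τ₂ - τ₁) ^ (-γ))
            * normTX (ENNReal.ofReal s) (ENNReal.ofReal r) ((cyl d τ₂).indicator w) ^ 2 := by
  obtain ⟨n, rfl⟩ : ∃ n, d = n + 1 := ⟨d - 1, by omega⟩
  have hn : 1 ≤ n := by omega
  have hs := recip_lt_of_lt (by omega) hp0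
  have hs0 : 0 ≤ recip p0 := ENNReal.toReal_nonneg
  have hq3' : 1 ≤ q3 := hp3.trans hp3q3
  rw [theta1, theta2] at hq3
  push_cast at hs hp01 hq3
  rw [add_sub_cancel_right] at hp01 hq3
  obtain ⟨hα₁, hα₂, ha₁, ha₃⟩ := exponent_conditions hn hs hp01 hq3
  obtain ⟨β, A₁, B₁, A₃, B₃, hβ0, hβ1, hβ, ⟨hB₁, hBA₁, hA₁, haA₁, hc₁⟩,
    ⟨hB₃, hBA₃, hA₃, haA₃, hbB₃, hc₃⟩⟩ := exists_perturbed_exponents hα₂ hα₁ (recip_mem_Icc hp1)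
      (recip_mem_Icc hp3) (recip_mem_Icc hq3').1 (recip_anti hp3 hp3q3) ha₁ ha₃
  obtain ⟨m₁, ω₁, l₁, hl₁, hE₁, hH₁⟩ :=
    exists_slice_exponents hn hs0 hs hβ0 hβ1 hB₁ hBA₁ hA₁ hc₁
  obtain ⟨m₃, ω₃, l₃, hl₃, hE₃, hH₃⟩ :=
    exists_slice_exponents hn hs0 hs hβ0 hβ1 hB₃ hBA₃ hA₃ hc₃
  obtain ⟨C₁, hC₁t, hC₁⟩ := slice_estimate hE₁ hH₁
  obtain ⟨C₃, hC₃t, hC₃⟩ := slice_estimate hE₃ hH₃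
  change SliceBound n (kappa p0) _ _ _ _ _ _ at hC₁ hC₃
  have hκ : 1 ≤ kappa p0 := hE₁.one_le_kappa
  have hκ' : 2 / kappa p0 = recip p0 + 1 := by rw [kappa, div_div_cancel₀ two_ne_zero]
  have hb2 : 2 ≤ 2 / (1 - β) := hE₁.two_le_b
  set b := 2 / (1 - β) with hb
  have hb1 : 1 ≤ b := by linarith
  have hS₁ : SliceData n (kappa p0) b m₁ A₁ B₁ l₁ C₁ :=
    ⟨hE₁.one_lt_m, hH₁.A_pos, hA₁, hH₁.l_nonneg, hl₁.le, hC₁⟩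
  have hS₃ : SliceData n (kappa p0) b m₃ A₃ B₃ l₃ C₃ :=
    ⟨hE₃.one_lt_m, hH₃.A_pos, hA₃, hH₃.l_nonneg, hl₃.le, hC₃⟩
  have hε2 : 0 < ε / 2 := half_pos hε.1
  obtain ⟨γ₁, hγ₁⟩ := exists_absorption (4 * n + 7) hε2 hH₁.l_nonneg hl₁
  obtain ⟨γ₃, hγ₃⟩ := exists_absorption (4 * n + 7) hε2 hH₃.l_nonneg hl₃
  refine ⟨b, b, ⟨hb2, hb1, ?_⟩, max (max γ₁ γ₃) 1, by positivity, fun K₁ K₂ => ?_⟩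
  · have : 1 / b = (1 - β) / 2 := by rw [hb, one_div_div]
    rw [hκ', this]
    push_cast
    linarith
  set γ := max (max γ₁ γ₃) 1 with hγ
  obtain ⟨K₁', hK₁t, hK₁⟩ := exists_weight (d := n + 1) (p := p1) (q := ⊤)
    (zero_lt_one.trans_le hp1).ne' (by simp) hH₁.A_pos hB₁ haA₁ (by simpa [recip] using hB₁.le) K₁
  obtain ⟨K₃', hK₃t, hK₃⟩ := exists_weight (d := n + 1) (p := p3) (q := q3)
    (zero_lt_one.trans_le hp3).ne' (zero_lt_one.trans_le hq3').ne' hH₃.A_pos hB₃ haA₃ hbB₃ K₂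
  obtain ⟨Cc, hCct, hcut⟩ := exists_cutoff n
  obtain ⟨D₁, hD₁t, hD₁⟩ := hγ₁ γ ((le_max_left _ _).trans (le_max_left _ _))
    (Cc * (C₁ * K₁')) (ENNReal.mul_ne_top hCct (ENNReal.mul_ne_top hC₁t hK₁t))
  obtain ⟨D₃, hD₃t, hD₃⟩ := hγ₃ γ ((le_max_right _ _).trans (le_max_left _ _))
    (Cc * (C₃ * K₃')) (ENNReal.mul_ne_top hCct (ENNReal.mul_ne_top hC₃t hK₃t))
  have hDt : D₁ + D₃ + 1 ≠ ⊤ := by simp [hD₁t, hD₃t]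
  have hD0 : 0 < (D₁ + D₃ + 1).toReal := ENNReal.toReal_pos (by simp) hDt
  refine ⟨(D₁ + D₃ + 1).toReal, hD0, ?_⟩
  intro τ₁ τ₂ h1 h12 h2 g₁ g₂ hg₁ hg₂ hgK₁ hgK₂ w Dw hw hM hV
  obtain ⟨M, hM⟩ := hM
  have hδ0 : 0 < τ₂ - τ₁ := sub_pos.2 h12
  have hX1 : 1 ≤ ENNReal.ofReal (τ₂ - τ₁)⁻¹ := by
    simpa using (one_le_inv₀ hδ0).2 (by linarith)
  have hcoef : ENNReal.ofReal ((D₁ + D₃ + 1).toReal * (τ₂ - τ₁) ^ (-γ)) =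
      (D₁ + D₃ + 1) * ENNReal.ofReal (τ₂ - τ₁)⁻¹ ^ γ := by
    rw [ENNReal.ofReal_mul hD0.le, ENNReal.ofReal_toReal hDt, Real.rpow_neg hδ0.le,
      ← Real.inv_rpow hδ0.le, ENNReal.ofReal_rpow_of_pos (inv_pos.2 hδ0)]
  refine le_of_forall_gt_bounds hV.ne ENNReal.ofReal_ne_top ?_ ENNReal.ofReal_ne_top ?_
  · exact (ENNReal.ofReal_pos.2 (mul_pos hD0 (Real.rpow_pos_of_pos hδ0 _))).ne'
  intro V Λ hVV hΛΛ hVt hΛt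
  obtain ⟨W, D, hW, hWM, hED⟩ := exists_energy (zero_lt_one.trans_le hκ) (zero_lt_one.trans_le hb1)
    hw hM (ne_bot_of_gt hVV) hVt (ne_bot_of_gt hΛΛ) hΛt hVV.le hΛΛ.le
  obtain ⟨f₁, hf₁m, hf₁, hG₁⟩ := hK₁ (by linarith) h2 hg₁.1 hgK₁
  obtain ⟨f₂, hf₂m, hf₂, hG₂⟩ := hK₃ (by linarith) h2 hg₂.1 hgK₂
  refine ENNReal.le_of_forall_pos_le_add fun err herr _ => ?_
  obtain ⟨η, hη, hest⟩ := hcut hκ hb1 h1 h12 h2 hED hS₁ hS₃ hG₁ hG₂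
    (lintegral_density_ne_top hg₁.1 hf₁ hf₁m hED.measurable_W hWM)
    (lintegral_density_ne_top hg₂.1 hf₂ hf₂m hED.measurable_W hWM)
    (err := (err : ℝ≥0∞)) (by simpa using herr.ne')
  refine iInf₂_le_of_le η hη ?_
  have e₁ := normTX_weight_eq hη hf₁ hW two_ne_zero
  have e₂ := normTX_weight_eq hη hf₂ hW one_ne_zero
  simp only [pow_one] at e₂
  rw [e₁, e₂]
  refine hest.trans (add_le_add ?_ le_rfl)
  rw [hcoef]
  set X := ENNReal.ofReal (τ₂ - τ₁)⁻¹ with hX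
  calc _ = X ^ (4 * n + 7) * (Cc * (C₁ * K₁') *
            (V ^ (2 * l₁) * Λ ^ (2 * (1 - l₁)) + Λ ^ (2 : ℝ))) +
          X ^ (4 * n + 7) * (Cc * (C₃ * K₃') *
            (V ^ (2 * l₃) * Λ ^ (2 * (1 - l₃)) + Λ ^ (2 : ℝ))) := by ring
    _ ≤ (ENNReal.ofReal (ε / 2) * V ^ 2 + D₁ * X ^ γ * Λ ^ 2) +
          (ENNReal.ofReal (ε / 2) * V ^ 2 + D₃ * X ^ γ * Λ ^ 2) :=
        add_le_add (hD₁ X hX1 V Λ) (hD₃ X hX1 V Λ)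
    _ = (ENNReal.ofReal (ε / 2) + ENNReal.ofReal (ε / 2)) * V ^ 2 +
          (D₁ + D₃) * X ^ γ * Λ ^ 2 := by ring
    _ ≤ ENNReal.ofReal ε * V ^ 2 + (D₁ + D₃ + 1) * X ^ γ * Λ ^ 2 := by
        rw [← ENNReal.ofReal_add hε2.le hε2.le, add_halves]
        exact add_le_add le_rfl (mul_le_mul' (mul_le_mul' le_self_add le_rfl) le_rfl)
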